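/- Let t ≥ 2 and k ≥ 1 be integers. For every algebraic number α with 0 < |α| < 1, the two complex numbers H_k(α) and H_k(α^{t^k}) are algebraically independent over ℚ. -/

import Mathlib

open Polynomial

/-- The (Type 1) Stern polynomials `a_t(n; z) ∈ ℤ[z]` of Dilcher and Eriksen:
`a_t(0;z) = 0`, `a_t(1;z) = 1`, and for `n ≥ 1`,
`a_t(2n;z) = z·a_t(n;z^t)`, `a_t(2n+1;z) = a_t(n+1;z^t) + a_t(n;z^t)`. -/
noncomputable def sternPoly (t : ℕ) : ℕ → Polynomial ℤ
  | 0 => 0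
  | 1 => 1
  | n + 2 =>
    if h : (n + 2) % 2 = 0 then
      X * (sternPoly t ((n + 2) / 2)).comp (X ^ t)
    else
      (sternPoly t ((n + 2) / 2 + 1)).comp (X ^ t) +
        (sternPoly t ((n + 2) / 2)).comp (X ^ t)
decreasing_by all_goals omega

/-- `α_n = (2^{kn} - (-1)^n) / (2^k + 1)`, a nonnegative integer. -/
def sternAlpha (k n : ℕ) : ℕ :=
  (((2 : ℤ) ^ (k * n) - (-1) ^ n) / (2 ^ k + 1)).toNat


section stern
variable {R : Type*} [CommRing R]

/-- value of the Stern polynomial -/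
noncomputable def sv (t n : ℕ) (z : R) : R := Polynomial.aeval z (sternPoly t n)

lemma sv_zero (t : ℕ) (z : R) : sv t 0 z = 0 := by simp [sv, sternPoly]
lemma sv_one (t : ℕ) (z : R) : sv t 1 z = 1 := by simp [sv, sternPoly]

lemma sv_even (t n : ℕ) (z : R) : sv t (2 * n) z = z * sv t n (z ^ t) := by
  rcases n with _ | n
  · simp [sv_zero]
  · have h : 2 * (n + 1) = 2 * n + 2 := by ring
    rw [h]
    unfold sv
    rw [sternPoly, dif_pos (by omega)]
    have h2 : (2 * n + 2) / 2 = n + 1 := by omega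
    rw [h2]
    simp [Polynomial.aeval_comp]

lemma sv_odd (t n : ℕ) (z : R) :
    sv t (2 * n + 1) z = sv t (n + 1) (z ^ t) + sv t n (z ^ t) := by
  rcases n with _ | n
  · simp [sv_zero, sv_one]
  · have h : 2 * (n + 1) + 1 = (2 * n + 1) + 2 := by ring
    rw [h]
    unfold sv
    rw [sternPoly, dif_neg (by omega)]
    have h2 : (2 * n + 1 + 2) / 2 = n + 1 := by omega
    rw [h2]
    simp [Polynomial.aeval_comp]

/-- the polynomial A_k -/
noncomputable def sternA (t k : ℕ) : Polynomial ℤ :=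
  ∑ j ∈ Finset.range k, X ^ (t ^ k - t ^ (j + 1))

lemma sternA_succ (t k : ℕ) (y : R) :
    aeval y (sternA t (k + 1)) = aeval (y ^ t) (sternA t k) + y ^ (t ^ (k+1) - t) := by
  simp only [sternA, map_sum, map_pow, aeval_X]
  rw [Finset.sum_range_succ']
  simp only [zero_add, pow_one]
  congr 1
  refine Finset.sum_congr rfl fun j hj => ?_
  rw [← pow_mul, Nat.mul_sub, ← pow_succ', ← pow_succ']

lemma sv_two_pow_mul (t : ℕ) (ht : 2 ≤ t) (k m : ℕ) (y : R) :
    sv t (2 ^ k * m) (y ^ (t - 1)) = y ^ (t ^ k - 1) * sv t m ((y ^ t ^ k) ^ (t - 1)) := by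
  induction k generalizing y with
  | zero => simp
  | succ k ih =>
    have h : 2 ^ (k + 1) * m = 2 * (2 ^ k * m) := by ring
    rw [h, sv_even, ← pow_mul, mul_comm (t - 1) t, pow_mul, ih, ← mul_assoc]
    congr 1
    · rw [← pow_mul, ← pow_add]
      congr 1
      have h1 : 1 ≤ t ^ k := Nat.one_le_pow _ _ (by omega)
      rw [Nat.mul_sub, ← pow_succ']
      have : t ≤ t ^ (k + 1) := by
        rw [pow_succ']; exact Nat.le_mul_of_pos_right _ h1
      omega
    · congr 2
      rw [← pow_mul, ← pow_succ']

lemma sv_two_pow_mul_add (t : ℕ) (ht : 2 ≤ t) (k m : ℕ) (y : R) :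
    sv t (2 ^ k * m + 1) (y ^ (t - 1)) =
      sv t (m + 1) ((y ^ t ^ k) ^ (t - 1)) +
        aeval y (sternA t k) * sv t m ((y ^ t ^ k) ^ (t - 1)) := by
  induction k generalizing y with
  | zero => simp [sternA]
  | succ k ih =>
    have h : 2 ^ (k + 1) * m = 2 * (2 ^ k * m) := by ring
    rw [h, sv_odd, ← pow_mul, mul_comm (t - 1) t, pow_mul, ih, sv_two_pow_mul t ht, sternA_succ,
      ← pow_mul y t (t ^ k), ← pow_succ', ← pow_mul y t (t^k - 1), Nat.mul_sub, ← pow_succ', mul_one]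
    ring

lemma sv_two_pow_mul_sub (t : ℕ) (ht : 2 ≤ t) (k m l : ℕ) (hl : l + 1 = 2 ^ k * (m + 1)) (y : R) :
    sv t l (y ^ (t - 1)) =
      sv t m ((y ^ t ^ k) ^ (t - 1)) +
        aeval y (sternA t k) * sv t (m + 1) ((y ^ t ^ k) ^ (t - 1)) := by
  induction k generalizing y l with
  | zero =>
    simp at hl
    subst hl
    simp [sternA]
  | succ k ih =>
    obtain ⟨l', hl'⟩ : ∃ l', l' + 1 = 2 ^ k * (m + 1) :=
      ⟨2 ^ k * (m + 1) - 1, Nat.sub_add_cancel (Nat.mul_pos (by positivity) (by omega))⟩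
    have h : l = 2 * l' + 1 := by
      have : 2 ^ (k + 1) * (m + 1) = 2 * (2 ^ k * (m + 1)) := by ring
      omega
    rw [h, sv_odd, ← pow_mul, mul_comm (t - 1) t, pow_mul, ih l' hl', hl', sv_two_pow_mul t ht,
      sternA_succ,
      ← pow_mul y t (t ^ k), ← pow_succ', ← pow_mul y t (t^k - 1), Nat.mul_sub, ← pow_succ', mul_one]
    ring

lemma sternAlpha_spec (k n : ℕ) :
    ((2 : ℤ) ^ k + 1) * (sternAlpha k n : ℤ) = 2 ^ (k * n) - (-1) ^ n := by
  have hd : ((2 : ℤ) ^ k + 1) ∣ 2 ^ (k * n) - (-1) ^ n := by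
    have := sub_dvd_pow_sub_pow ((2 : ℤ) ^ k) (-1) n
    rwa [sub_neg_eq_add, ← pow_mul] at this
  have hnn : (0 : ℤ) ≤ 2 ^ (k * n) - (-1) ^ n := by
    have h1 : (1 : ℤ) ≤ 2 ^ (k * n) := one_le_pow₀ (by norm_num)
    rcases neg_one_pow_eq_or ℤ n with h | h <;> rw [h] <;> linarith
  have hp : (0 : ℤ) < 2 ^ k + 1 := by positivity
  unfold sternAlpha
  rw [Int.toNat_of_nonneg (Int.ediv_nonneg hnn hp.le), Int.mul_ediv_cancel' hd]

lemma sternAlpha_zero (k : ℕ) : sternAlpha k 0 = 0 := by simp [sternAlpha]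

lemma sternAlpha_succ (k n : ℕ) :
    (sternAlpha k (n + 1) : ℤ) = 2 ^ k * sternAlpha k n + (-1) ^ n := by
  have h1 := sternAlpha_spec k n
  have h2 := sternAlpha_spec k (n + 1)
  have hp : ((2 : ℤ) ^ k + 1) ≠ 0 := by positivity
  apply mul_left_cancel₀ hp
  rw [h2, mul_add k n 1, pow_add, mul_one]
  linear_combination (-(2:ℤ)^k) * h1

lemma sternAlpha_one (k : ℕ) : sternAlpha k 1 = 1 := by
  have := sternAlpha_succ k 0
  simp [sternAlpha_zero] at this
  exact_mod_cast this

/-- the sequence p_n(y) -/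
noncomputable def pst (t k n : ℕ) (y : R) : R := sv t (sternAlpha k n) (y ^ (t - 1))

lemma pst_rec (t k : ℕ) (ht : 2 ≤ t) (n : ℕ) (y : R) :
    pst t k (n + 2) y = aeval y (sternA t k) * pst t k (n + 1) (y ^ t ^ k) +
      y ^ (t ^ k * (t ^ k - 1)) * pst t k n ((y ^ t ^ k) ^ t ^ k) := by
  have h1 := sternAlpha_succ k (n + 1)
  have h0 := sternAlpha_succ k n
  unfold pst
  have key : sv t (sternAlpha k (n + 2)) (y ^ (t - 1)) =
      sv t (2 ^ k * sternAlpha k n) ((y ^ t ^ k) ^ (t - 1)) +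
      aeval y (sternA t k) * sv t (sternAlpha k (n + 1)) ((y ^ t ^ k) ^ (t - 1)) := by
    rcases neg_one_pow_eq_or ℤ n with h | h
    · rw [pow_succ, h] at h1
      rw [h] at h0
      have e0 : sternAlpha k (n + 1) = 2 ^ k * sternAlpha k n + 1 := by exact_mod_cast h0
      have e1 : sternAlpha k (n + 2) + 1 = 2 ^ k * sternAlpha k (n + 1) := by
        zify; rw [h1]; ring
      rw [e0] at e1 ⊢
      exact sv_two_pow_mul_sub t ht k _ _ e1 y
    · rw [pow_succ, h] at h1
      rw [h] at h0
      have e0 : sternAlpha k (n + 1) + 1 = 2 ^ k * sternAlpha k n := by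
        zify; rw [h0]; ring
      have e1 : sternAlpha k (n + 2) = 2 ^ k * sternAlpha k (n + 1) + 1 := by
        zify; rw [h1]; ring
      rw [e1, ← e0]
      exact sv_two_pow_mul_add t ht k _ y
  rw [key, sv_two_pow_mul t ht k _ (y ^ t ^ k), ← pow_mul y (t ^ k) (t ^ k - 1)]
  ring

lemma pst_zero (t k : ℕ) (y : R) : pst t k 0 y = 0 := by simp [pst, sternAlpha_zero, sv_zero]
lemma pst_one (t k : ℕ) (y : R) : pst t k 1 y = 1 := by simp [pst, sternAlpha_one, sv_one]

lemma pst_rec' (t k : ℕ) (ht : 2 ≤ t) (n : ℕ) (y : R) :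
    pst t k (n + 2) y = aeval (y ^ (t ^ k) ^ n) (sternA t k) * pst t k (n + 1) y +
      (y ^ (t ^ k) ^ n) ^ (t ^ k - 1) * pst t k n y := by
  induction n using Nat.strong_induction_on generalizing y with
  | _ n ih =>
    rcases n with _ | _ | n
    · rw [pst_rec t k ht]; simp [pst_zero, pst_one]
    · have h2 := fun y : R => pst_rec t k ht 0 y
      simp only [pst_zero, pst_one, mul_zero, add_zero, mul_one, zero_add] at h2
      rw [pst_rec t k ht, zero_add, h2, h2, pst_one, pst_one, pow_one, ← pow_mul]
      ring
    · rw [pst_rec t k ht, ih (n + 1) (by omega), ih n (by omega) ((y ^ t ^ k) ^ t ^ k), pst_rec t k ht (n+1) y,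
        pst_rec t k ht n y]
      have e1 : (y ^ t ^ k) ^ (t ^ k) ^ (n + 1) = y ^ (t ^ k) ^ (n + 1 + 1) := by
        rw [← pow_mul, ← pow_succ']
      have e2 : ((y ^ t ^ k) ^ (t ^ k)) ^ (t ^ k) ^ n = y ^ (t ^ k) ^ (n + 1 + 1) := by
        rw [← pow_mul, ← pow_mul]; congr 1; ring
      rw [e1, e2]
      ring

lemma sternA_natDegree (t k : ℕ) (ht : 2 ≤ t) (hk : 1 ≤ k) :
    (sternA t k).natDegree + 2 ≤ t ^ k := by
  have h : (sternA t k).natDegree ≤ t ^ k - t := by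
    unfold sternA
    apply Polynomial.natDegree_sum_le_of_forall_le
    intro j hj
    rw [natDegree_X_pow]
    have : t ≤ t ^ (j + 1) := Nat.le_self_pow (by omega) t
    omega
  have : t ≤ t ^ k := Nat.le_self_pow (by omega) t
  omega

lemma sternA_coeff_zero (t k : ℕ) (ht : 2 ≤ t) (hk : 1 ≤ k) : (sternA t k).coeff 0 = 1 := by
  unfold sternA
  obtain ⟨k, rfl⟩ : ∃ m, k = m + 1 := ⟨k - 1, by omega⟩
  rw [Finset.sum_range_succ, Polynomial.coeff_add, Polynomial.finsetSum_coeff,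
    Finset.sum_eq_zero]
  · simp
  · intro j hj
    rw [coeff_X_pow, if_neg]
    have : t ^ (j + 1) < t ^ (k + 1) := Nat.pow_lt_pow_right (by omega)
      (by simpa using hj)
    omega
end stern


section formal
open PowerSeries in
lemma expand_X_pow_dvd {R : Type*} [CommRing R] (q : ℕ) (hq : q ≠ 0) (n : ℕ) (f : PowerSeries R)
    (h : (PowerSeries.X : PowerSeries R) ^ n ∣ f) :
    (PowerSeries.X : PowerSeries R) ^ (q * n) ∣ PowerSeries.expand q hq f := by
  obtain ⟨g, rfl⟩ := h
  rw [map_mul, map_pow, PowerSeries.expand_X, ← pow_mul]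
  exact dvd_mul_right _ _

lemma eq_zero_of_forall_dvd {R : Type*} [CommRing R] (f : PowerSeries R)
    (h : ∀ n, (PowerSeries.X : PowerSeries R) ^ n ∣ f) : f = 0 := by
  ext m
  have := (PowerSeries.X_pow_dvd_iff.1 (h (m + 1))) m (by omega)
  simpa using this

lemma exists_formal_h (q : ℕ) (hq : 2 ≤ q) (hq0 : q ≠ 0) (A : ℤ[X]) (hA : A.coeff 0 = 1) :
    ∃ h : PowerSeries ℤ, PowerSeries.constantCoeff h = 1 ∧
      h = (A : PowerSeries ℤ) * PowerSeries.expand q hq0 h +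
        PowerSeries.X ^ (q * (q - 1)) * PowerSeries.expand q hq0 (PowerSeries.expand q hq0 h) := by
  set T : PowerSeries ℤ → PowerSeries ℤ := fun h => (A : PowerSeries ℤ) * PowerSeries.expand q hq0 h +
        PowerSeries.X ^ (q * (q - 1)) * PowerSeries.expand q hq0 (PowerSeries.expand q hq0 h) with hT
  have hTsub : ∀ f g, T f - T g = (A : PowerSeries ℤ) * PowerSeries.expand q hq0 (f - g) +
        PowerSeries.X ^ (q * (q - 1)) * PowerSeries.expand q hq0 (PowerSeries.expand q hq0 (f - g)) := by
    intro f g; simp only [hT, map_sub]; ring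
  have hTd : ∀ f g n, (PowerSeries.X : PowerSeries ℤ) ^ (n + 1) ∣ f - g →
      (PowerSeries.X : PowerSeries ℤ) ^ (n + 2) ∣ T f - T g := by
    intro f g n h
    rw [hTsub]
    have h1 := expand_X_pow_dvd q hq0 _ _ h
    have h2 := expand_X_pow_dvd q hq0 _ _ h1
    have e1 : n + 2 ≤ q * (n + 1) := by nlinarith
    have e2 : n + 2 ≤ q * (q * (n + 1)) := by nlinarith
    exact dvd_add (Dvd.dvd.mul_left ((pow_dvd_pow _ e1).trans h1) _)
      (Dvd.dvd.mul_left ((pow_dvd_pow _ e2).trans h2) _)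
  set hs : ℕ → PowerSeries ℤ := fun j => T^[j] 1 with hhs
  have hs_succ : ∀ j, hs (j + 1) = T (hs j) := fun j => by
    simp only [hhs, Function.iterate_succ_apply']
  have hd : ∀ j, (PowerSeries.X : PowerSeries ℤ) ^ (j + 1) ∣ hs (j + 1) - hs j := by
    intro j
    induction j with
    | zero =>
      rw [hs_succ]
      have : hs 0 = 1 := rfl
      rw [this, zero_add, pow_one, PowerSeries.X_dvd_iff]
      simp only [hT, map_one, mul_one, map_sub, map_add, map_pow, PowerSeries.constantCoeff_X]
      rw [← PowerSeries.coeff_zero_eq_constantCoeff_apply, Polynomial.coeff_coe, hA,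
        zero_pow]
      · ring
      · have : 0 < q * (q - 1) := Nat.mul_pos (by omega) (by omega)
        omega
    | succ j ih =>
      rw [hs_succ (j + 1)]
      nth_rewrite 2 [hs_succ j]
      exact hTd _ _ _ ih
  have hstab : ∀ m j, m ≤ j → PowerSeries.coeff m (hs j) = PowerSeries.coeff m (hs m) := by
    intro m j hj
    induction j, hj using Nat.le_induction with
    | base => rfl
    | succ j hj ih =>
      have := PowerSeries.X_pow_dvd_iff.1 (hd j) m (by omega)
      rw [map_sub, sub_eq_zero] at this
      rw [this, ih]
  set h : PowerSeries ℤ := PowerSeries.mk fun m => PowerSeries.coeff m (hs m) with hh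
  have hhd : ∀ j, (PowerSeries.X : PowerSeries ℤ) ^ (j + 1) ∣ h - hs j := by
    intro j
    rw [PowerSeries.X_pow_dvd_iff]
    intro m hm
    rw [map_sub, hh, PowerSeries.coeff_mk, hstab m j (by omega), sub_self]
  refine ⟨h, ?_, ?_⟩
  · rw [← PowerSeries.coeff_zero_eq_constantCoeff_apply, hh, PowerSeries.coeff_mk]
    simp [hhs]
  · change h = T h
    rw [← sub_eq_zero]
    apply eq_zero_of_forall_dvd
    intro n
    have h1 : h - T h = (h - hs (n + 1)) + (T (hs n) - T h) := by rw [hs_succ]; ring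
    rw [h1]
    refine dvd_add ((pow_dvd_pow _ (by omega)).trans (hhd (n + 1))) ?_
    refine (pow_dvd_pow _ (by omega)).trans (hTd _ _ n ?_)
    rw [← neg_sub, dvd_neg]
    exact hhd n

abbrev PS := PowerSeries ℂ
abbrev LL := FractionRing (PowerSeries ℂ)

lemma expand_inj (q : ℕ) (hq : q ≠ 0) {R : Type*} [CommRing R] :
    Function.Injective (PowerSeries.expand (R := R) q hq) := by
  intro f g h
  ext n
  have := congrArg (PowerSeries.coeff (q * n)) h
  simpa [PowerSeries.coeff_expand, hq, Nat.pos_of_ne_zero hq] using this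

/-- the substitution X ↦ X^q on the fraction field -/
noncomputable def sigL (q : ℕ) (hq : q ≠ 0) : LL →+* LL :=
  IsFractionRing.lift (A := PS) (K := LL) (g := (algebraMap PS LL).comp
    (PowerSeries.expand q hq).toRingHom)
    ((IsFractionRing.injective PS LL).comp (expand_inj q hq))

lemma sigL_algebraMap (q : ℕ) (hq : q ≠ 0) (f : PS) :
    sigL q hq (algebraMap PS LL f) = algebraMap PS LL (PowerSeries.expand q hq f) := by
  simp [sigL]

/-- The data of the formal functional equation over `ℂ`. -/
structure FD where
  q : ℕ
  hq : 2 ≤ q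
  hq0 : q ≠ 0
  A : PS
  A0 : PowerSeries.constantCoeff A = 1
  Adeg : ∀ n, q ≤ n + 1 → PowerSeries.coeff n A = 0
  h : PS
  h0 : PowerSeries.constantCoeff h = 1
  heq : h = A * PowerSeries.expand q hq0 h +
        PowerSeries.X ^ (q * (q - 1)) * PowerSeries.expand q hq0 (PowerSeries.expand q hq0 h)

namespace FD
variable (D : FD)

noncomputable def s : LL →+* LL := sigL D.q D.hq0
noncomputable def e : PS → PS := PowerSeries.expand D.q D.hq0
noncomputable def x : LL := algebraMap PS LL PowerSeries.X
noncomputable def a : LL := algebraMap PS LL D.A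
noncomputable def h1 : LL := algebraMap PS LL D.h
noncomputable def h2 : LL := algebraMap PS LL (D.e D.h)
noncomputable def h3 : LL := algebraMap PS LL (D.e (D.e D.h))

lemma s_map (f : PS) : D.s (algebraMap PS LL f) = algebraMap PS LL (D.e f) := sigL_algebraMap _ _ _
lemma s_h1 : D.s D.h1 = D.h2 := D.s_map _
lemma s_h2 : D.s D.h2 = D.h3 := D.s_map _
lemma s_x : D.s x = x ^ D.q := by
  rw [x, s_map, ← map_pow, FD.e, PowerSeries.expand_X]
lemma x_ne : x ≠ 0 := by
  unfold x
  rw [Ne, FaithfulSMul.algebraMap_eq_zero_iff]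
  exact PowerSeries.X_ne_zero
lemma e0 (f : PS) : PowerSeries.constantCoeff (D.e f) = PowerSeries.constantCoeff f := by
  simp [FD.e]
lemma map_ne (f : PS) (hf : PowerSeries.constantCoeff f = 1) : algebraMap PS LL f ≠ 0 := by
  rw [Ne, FaithfulSMul.algebraMap_eq_zero_iff]
  rintro rfl
  simp at hf
lemma h1_ne : D.h1 ≠ 0 := map_ne _ D.h0
lemma h2_ne : D.h2 ≠ 0 := map_ne _ (by rw [e0, D.h0])
lemma h3_ne : D.h3 ≠ 0 := map_ne _ (by rw [e0, e0, D.h0])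
lemma h1_eq : D.h1 = D.a * D.h2 + x ^ (D.q * (D.q - 1)) * D.h3 := by
  conv_lhs => rw [h1, D.heq]
  simp only [map_add, map_mul, map_pow]
  rfl

lemma coeff_mul_e (f g : PS) (n : ℕ) (hn : n < D.q) :
    PowerSeries.coeff n (f * D.e g) = PowerSeries.coeff n f * PowerSeries.constantCoeff g := by
  rw [PowerSeries.coeff_mul, Finset.sum_eq_single (n, 0)]
  · simp [FD.e]
  · rintro ⟨i, j⟩ hij hne
    rw [Finset.HasAntidiagonal.mem_antidiagonal] at hij
    simp only at hij ⊢
    rw [FD.e, PowerSeries.coeff_expand, if_neg, mul_zero]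
    intro hd
    have : j ≠ 0 := by
      rintro rfl
      apply hne
      simp at hij
      rw [hij]
    have := Nat.le_of_dvd (by omega) hd
    omega
  · intro h; simp at h

lemma coeff_mul_ee (f g : PS) (n : ℕ) (hn : n < D.q * D.q) :
    PowerSeries.coeff n (f * D.e (D.e g)) = PowerSeries.coeff n f * PowerSeries.constantCoeff g := by
  rw [PowerSeries.coeff_mul, Finset.sum_eq_single (n, 0)]
  · simp [FD.e]
  · rintro ⟨i, j⟩ hij hne
    rw [Finset.HasAntidiagonal.mem_antidiagonal] at hij
    simp only at hij ⊢
    rw [FD.e, PowerSeries.coeff_expand]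
    split_ifs with hd
    · rw [PowerSeries.coeff_expand, if_neg, mul_zero]
      intro hd2
      have hj : j ≠ 0 := by
        rintro rfl
        apply hne
        simp at hij
        rw [hij]
      have h3 : D.q * D.q ∣ j := (Nat.dvd_div_iff_mul_dvd hd).1 hd2
      have := Nat.le_of_dvd (by omega) h3
      omega
    · simp
  · intro h; simp at h

lemma N_eq : D.q * (D.q - 1) + (D.q - 1) = D.q * D.q - 1 := by
  obtain ⟨m, hm⟩ : ∃ m, D.q = m + 1 := ⟨D.q - 1, by have := D.hq; omega⟩
  rw [hm]
  simp
  ring_nf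
  omega

lemma coeff_h_q : PowerSeries.coeff (D.q - 1) D.h = 0 := by
  have hq := D.hq
  rw [D.heq, map_add, ← FD.e, D.coeff_mul_e _ _ _ (by omega), D.Adeg _ (by omega),
    PowerSeries.coeff_X_pow_mul', if_neg]
  · simp
  · have : D.q * (D.q - 1) ≥ 2 * (D.q - 1) := Nat.mul_le_mul_right _ hq
    omega

lemma coeff_h_N : PowerSeries.coeff (D.q * (D.q - 1)) D.h = 1 := by
  have hq := D.hq
  rw [D.heq, map_add, PowerSeries.coeff_X_pow_mul', if_pos le_rfl, Nat.sub_self,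
    PowerSeries.coeff_mul, Finset.sum_eq_zero]
  · simp [D.h0]
  · rintro ⟨i, j⟩ hij
    rw [Finset.HasAntidiagonal.mem_antidiagonal] at hij
    simp only at hij ⊢
    rw [PowerSeries.coeff_expand]
    split_ifs with hd
    · by_cases hi : D.q ≤ i + 1
      · rw [D.Adeg _ hi, zero_mul]
      · have hqi : D.q ∣ i := (Nat.dvd_add_left hd).1 (by rw [hij]; exact dvd_mul_right _ _)
        have hi0 : i = 0 := Nat.eq_zero_of_dvd_of_lt hqi (by omega)
        subst hi0
        rw [zero_add] at hij
        rw [hij, Nat.mul_div_cancel_left _ (by omega), D.coeff_h_q, mul_zero]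
    · simp

lemma star_int (m : PS) (h : D.h * D.e (D.e m) =
    D.A + PowerSeries.X ^ (D.q * D.q - 1) * D.e (D.e D.h) * m) : False := by
  have hq := D.hq
  have hqq : 2 * 2 ≤ D.q * D.q := Nat.mul_le_mul hq hq
  have h1 := congrArg PowerSeries.constantCoeff h
  simp only [map_mul, map_add, e0, D.h0, D.A0, map_pow, PowerSeries.constantCoeff_X] at h1
  rw [zero_pow (by omega)] at h1
  have hm : PowerSeries.constantCoeff m = 1 := by simpa using h1
  have h2 := congrArg (PowerSeries.coeff (D.q * (D.q - 1))) h
  have e := D.N_eq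
  rw [D.coeff_mul_ee _ _ _ (by omega), D.coeff_h_N, hm, map_add, D.Adeg, mul_assoc,
    PowerSeries.coeff_X_pow_mul', if_neg (by omega)] at h2
  · simp at h2
  · have : D.q * (D.q - 1) ≥ 2 * (D.q - 1) := Nat.mul_le_mul_right _ hq
    omega

lemma star (m : LL) (h : D.h1 * D.s (D.s m) = D.a + x ^ (D.q * D.q - 1) * D.h3 * m) : False := by
  have hq := D.hq
  have inj := IsFractionRing.injective PS LL
  have key : ∀ f : PS, m = algebraMap PS LL f → False := by
    rintro f rfl
    apply D.star_int f
    apply inj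
    rw [D.s_map, D.s_map] at h
    simp only [map_mul, map_add, map_pow]
    exact h
  by_cases hm : m = 0
  · exact key 0 (by simp [hm])
  rcases ValuationRing.isInteger_or_isInteger PS m with ⟨f, hf⟩ | ⟨f, hf⟩
  · exact key f hf.symm
  have hf0 : f ≠ 0 := by
    rintro rfl
    simp at hf
    exact hm hf.symm
  by_cases hu : PowerSeries.constantCoeff f = 0
  · apply hf0
    have hE : D.h * f = D.e (D.e f) * (D.A * f + PowerSeries.X ^ (D.q * D.q - 1) * D.e (D.e D.h)) := by
      apply inj
      simp only [map_mul, map_add, map_pow]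
      rw [← s_map, ← s_map, hf]
      change D.h1 * _ = _ * (D.a * _ + x ^ _ * D.h3)
      rw [map_inv₀, map_inv₀]
      have : D.s (D.s m) ≠ 0 := by simpa using hm
      field_simp
      linear_combination h
    have hx : (PowerSeries.X : PS) ∣ f := PowerSeries.X_dvd_iff.2 hu
    have hunit : IsUnit D.h := PowerSeries.isUnit_iff_constantCoeff.2 (by rw [D.h0]; exact isUnit_one)
    have step : ∀ n, (PowerSeries.X : PS) ^ (n + 1) ∣ f := by
      intro n
      induction n with
      | zero => simpa using hx
      | succ n ih =>
        have h1 := expand_X_pow_dvd D.q D.hq0 _ _ (expand_X_pow_dvd D.q D.hq0 _ _ ih)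
        have h2 : n + 1 + 1 ≤ D.q * (D.q * (n + 1)) := by
          have e1 : 2 * (n + 1) ≤ D.q * (n + 1) := Nat.mul_le_mul_right _ hq
          have e2 : 1 * (D.q * (n + 1)) ≤ D.q * (D.q * (n + 1)) := Nat.mul_le_mul_right _ (by omega)
          omega
        have h3 : (PowerSeries.X : PS) ^ (n + 1 + 1) ∣ D.h * f := by
          rw [hE]
          exact Dvd.dvd.mul_right ((pow_dvd_pow _ h2).trans h1) _
        exact (hunit.dvd_mul_left).1 h3
    apply eq_zero_of_forall_dvd
    intro n
    exact (pow_dvd_pow _ (by omega)).trans (step n)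
  · have hunit : IsUnit f := PowerSeries.isUnit_iff_constantCoeff.2 (isUnit_iff_ne_zero.2 hu)
    obtain ⟨g, hg⟩ := hunit.exists_right_inv
    refine key g ?_
    have := congrArg (algebraMap PS LL) hg
    rw [map_mul, hf, map_one] at this
    field_simp at this
    exact this.symm

/-- no solution of `σ y = 1 - X^{q(q-1)} (h3/h1) y` -/
lemma star_one (y : LL) (h : D.s y * D.h1 = D.h1 - x ^ (D.q * (D.q - 1)) * D.h3 * y) : False := by
  have hx := x_ne
  have n1 := D.h1_ne
  have n2 := D.h2_ne
  have n3 := D.h3_ne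
  set m := (1 - y) / (x ^ (D.q - 1) * D.h2) with hm
  have hy : y = 1 - x ^ (D.q - 1) * D.h2 * m := by rw [hm]; field_simp; ring
  have hsm : D.h1 * D.s m = y := by
    rw [hm, map_div₀, map_sub, map_one, map_mul, map_pow, s_x, s_h2, ← pow_mul]
    field_simp
    linear_combination -h
  apply D.star m
  have h2 := congrArg D.s hsm
  rw [map_mul, hy, map_sub, map_one, map_mul, map_mul, map_pow, s_x, s_h2, s_h1, ← pow_mul] at h2
  apply mul_left_cancel₀ n2
  rw [← N_eq, pow_add]
  rw [hy] at hsm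
  linear_combination D.h1 * h2 - x ^ (D.q * (D.q - 1)) * D.h3 * hsm + D.h1_eq
end FD
end formal


section hat
variable {k : Type*} [CommRing k]

/-- `hat N B A G (T) = (T-A)^N G(B/(T-A))` -/
noncomputable def hat (N : ℕ) (B A : k) (G : k[X]) : k[X] :=
  ∑ i ∈ Finset.range (N + 1), C (G.coeff i * B ^ i) * (X - C A) ^ (N - i)

lemma hat_X_mul (N : ℕ) (B A : k) (G : k[X]) :
    hat (N + 1) B A (X * G) = C B * hat N B A G := by
  unfold hat
  rw [Finset.sum_range_succ', Finset.mul_sum]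
  simp only [coeff_X_mul, coeff_X_mul_zero, zero_mul, C_0, add_zero, Nat.reduceSubDiff]
  refine Finset.sum_congr rfl fun i _ => ?_
  rw [pow_succ, ← mul_assoc, C_mul (b := B)]
  ring

lemma hat_succ (N : ℕ) (B A : k) (G : k[X]) (h : G.natDegree ≤ N) :
    hat (N + 1) B A G = (X - C A) * hat N B A G := by
  unfold hat
  rw [Finset.sum_range_succ, Finset.mul_sum, coeff_eq_zero_of_natDegree_lt (by omega)]
  simp only [zero_mul, C_0, add_zero]
  refine Finset.sum_congr rfl fun i hi => ?_
  rw [Finset.mem_range] at hi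
  have : N + 1 - i = (N - i) + 1 := by omega
  rw [this, pow_succ]
  ring

lemma hat_C_mul (N : ℕ) (B A c : k) (G : k[X]) :
    hat N B A (C c * G) = C c * hat N B A G := by
  unfold hat
  rw [Finset.mul_sum]
  refine Finset.sum_congr rfl fun i hi => ?_
  rw [coeff_C_mul, mul_assoc, C_mul, mul_assoc]

lemma hat_sub (N : ℕ) (B A : k) (G H : k[X]) :
    hat N B A (G - H) = hat N B A G - hat N B A H := by
  unfold hat
  rw [← Finset.sum_sub_distrib]
  refine Finset.sum_congr rfl fun i hi => ?_
  rw [coeff_sub, sub_mul, C_sub, sub_mul]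

lemma hat_eval (N : ℕ) (B A r s : k) (hs : s * (r - A) = B) (G : k[X]) (h : G.natDegree ≤ N) :
    (hat N B A G).eval r = (r - A) ^ N * G.eval s := by
  unfold hat
  rw [eval_finsetSum, eval_eq_sum_range' (n := N + 1) (by omega), Finset.mul_sum]
  refine Finset.sum_congr rfl fun i hi => ?_
  rw [Finset.mem_range] at hi
  simp only [eval_mul, eval_C, eval_pow, eval_sub, eval_X]
  rw [← hs, mul_pow]
  have : N = i + (N - i) := by omega
  conv_rhs => rw [this, pow_add]
  ring

lemma hat_map {k' : Type*} [CommRing k'] (f : k →+* k') (N : ℕ) (B A : k) (G : k[X]) :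
    (hat N B A G).map f = hat N (f B) (f A) (G.map f) := by
  unfold hat
  simp [Polynomial.map_sum]

lemma hat_deriv (N : ℕ) (B A : k) (G : k[X]) :
    (X - C A) * derivative (hat N B A G) =
      C (N : k) * hat N B A G - hat N B A (X * derivative G) := by
  unfold hat
  rw [derivative_sum, Finset.mul_sum, Finset.mul_sum, ← Finset.sum_sub_distrib]
  refine Finset.sum_congr rfl fun i hi => ?_
  rw [Finset.mem_range] at hi
  have hc : (X * derivative G).coeff i = i * G.coeff i := by
    rcases i with _ | i
    · simp
    · rw [coeff_X_mul, coeff_derivative]; push_cast; ring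
  rw [hc]
  obtain ⟨j, rfl⟩ : ∃ j, N = i + j := ⟨N - i, by omega⟩
  rw [Nat.add_sub_cancel_left, derivative_C_mul, derivative_X_sub_C_pow]
  rcases j with _ | j
  · simp only [Nat.cast_zero, C_mul, C_0, zero_mul, mul_zero, add_zero, pow_zero, mul_one, map_natCast]
    ring
  · simp only [Nat.add_sub_cancel, pow_succ, C_mul, Nat.cast_add, C_add, Nat.cast_one, C_1, map_natCast]
    ring

lemma hat_natDegree_le (N : ℕ) (B A : k) (G : k[X]) : (hat N B A G).natDegree ≤ N := by
  unfold hat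
  apply natDegree_sum_le_of_forall_le
  intro i hi
  refine (natDegree_C_mul_le _ _).trans ((natDegree_pow_le).trans ?_)
  calc (N - i) * (X - C A).natDegree ≤ (N - i) * 1 := Nat.mul_le_mul_left _ (natDegree_X_sub_C_le A)
    _ ≤ N := by omega

lemma hat_logderiv (N : ℕ) (B A r s : k) (hs : s * (r - A) = B) (G : k[X]) (h : G.natDegree ≤ N) :
    (r - A) * (derivative (hat N B A G)).eval r =
      (r - A) ^ N * (N * G.eval s - s * (derivative G).eval s) := by
  have h1 := congrArg (Polynomial.eval r) (hat_deriv N B A G)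
  simp only [eval_mul, eval_sub, eval_X, eval_C] at h1
  rw [h1, hat_eval N B A r s hs G h, hat_eval N B A r s hs]
  · simp only [eval_mul, eval_X]; ring
  · by_cases hG : derivative G = 0
    · simp [hG]
    · have := natDegree_derivative_lt (p := G) (by
        intro h0
        exact hG (derivative_of_natDegree_zero h0))
      exact (natDegree_mul_le).trans ((add_le_add_left natDegree_X_le _).trans (by omega))
end hat

namespace FD
variable (D : FD)
noncomputable def r : LL := D.h1 / D.h2
noncomputable def sr : LL := D.h2 / D.h3
noncomputable def B : LL := x ^ (D.q * (D.q - 1))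

lemma s_r : D.s D.r = D.sr := by rw [r, map_div₀, s_h1, s_h2, sr]
lemma B_ne : D.B ≠ 0 := pow_ne_zero _ x_ne
lemma r_ne : D.r ≠ 0 := div_ne_zero D.h1_ne D.h2_ne
lemma sr_ne : D.sr ≠ 0 := div_ne_zero D.h2_ne D.h3_ne
lemma sr_mul : D.sr * (D.r - D.a) = D.B := by
  have n2 := D.h2_ne
  have n3 := D.h3_ne
  have := D.h1_eq
  unfold sr r B
  field_simp
  linear_combination this
lemma r_sub_ne : D.r - D.a ≠ 0 := by
  intro h
  have := D.sr_mul
  rw [h, mul_zero] at this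
  exact D.B_ne this.symm

lemma star_r (y : LL) (h : D.s y * (D.r * D.sr) = D.r * D.sr - D.B * y) : False := by
  apply D.star_one y
  have n2 := D.h2_ne
  have n3 := D.h3_ne
  unfold sr r B at h
  field_simp at h
  linear_combination h

instance : CharZero LL := charZero_of_injective_algebraMap (R := ℂ) (algebraMap ℂ LL).injective
instance (F : Subfield LL) : CharZero F :=
  ⟨fun a b h => by
    have := congrArg (algebraMap F LL) h
    simpa using this⟩

section alg

/-- σ restricted to F -/
noncomputable def sF (F : Subfield LL) (hF : ∀ z ∈ F, D.s z ∈ F) : F →+* F := RingHom.restrict D.s F F hF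

lemma eval_map_sF (F : Subfield LL) (hF : ∀ z ∈ F, D.s z ∈ F) (p : F[X]) (z : LL) :
    aeval (D.s z) (p.map (D.sF F hF)) = D.s (aeval z p) := by
  rw [aeval_def, eval₂_map, aeval_def, hom_eval₂]
  rfl

/-- If `r` is algebraic over `F`, then its degree is 1. -/
lemma r_deg_one (F : Subfield LL) (hF : ∀ z ∈ F, D.s z ∈ F) (hx : x ∈ F) (ha : D.a ∈ F) (hr : IsIntegral F D.r) :
    (minpoly F D.r).natDegree = 1 := by
  by_contra hdeg
  set μ := minpoly F D.r with hμ
  have hpos : 0 < μ.natDegree := minpoly.natDegree_pos hr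
  obtain ⟨N, hN⟩ : ∃ N, μ.natDegree = N + 1 := ⟨μ.natDegree - 1, by omega⟩
  have hN0 : N ≠ 0 := by omega
  set σ := D.sF F hF
  have hB : D.B ∈ F := pow_mem hx _
  set μL : LL[X] := μ.map (algebraMap F LL) with hμL
  have hroot : μL.IsRoot D.r := by
    rw [IsRoot, hμL, eval_map_algebraMap]; exact minpoly.aeval F D.r
  obtain ⟨ν, hν⟩ := dvd_iff_isRoot.2 hroot
  have hνdeg : ν.natDegree = N := by
    have hm : μL.Monic := (minpoly.monic hr).map _
    have h1 : μL.natDegree = N + 1 := by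
      rw [hμL, natDegree_map, hN]
    have hν0 : ν ≠ 0 := by
      rintro rfl
      rw [mul_zero] at hν
      exact hm.ne_zero hν
    rw [hν, natDegree_mul (X_sub_C_ne_zero _) hν0, natDegree_X_sub_C] at h1
    omega
  -- hat of μ^σ
  have hhat : ∃ c : F, hat (N + 1) (⟨D.B, hB⟩ : F) ⟨D.a, ha⟩ (μ.map σ) = C c * μ := by
    have hd : μ ∣ hat (N + 1) (⟨D.B, hB⟩ : F) ⟨D.a, ha⟩ (μ.map σ) := by
      apply minpoly.dvd
      rw [← eval_map_algebraMap, hat_map]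
      have hz : hat (N+1) (algebraMap F LL ⟨D.B, hB⟩) (algebraMap F LL ⟨D.a, ha⟩)
          ((μ.map σ).map (algebraMap F LL)) = hat (N+1) D.B D.a ((μ.map σ).map (algebraMap F LL)) := rfl
      rw [hz, hat_eval _ _ _ _ D.sr D.sr_mul, ← s_r, eval_map_algebraMap, D.eval_map_sF F hF,
        minpoly.aeval, map_zero, mul_zero]
      rw [natDegree_map, natDegree_map, hN]
    obtain ⟨c, hc⟩ := hd
    by_cases hc0 : c = 0
    · exact ⟨0, by rw [hc, hc0]; simp⟩
    have h1 := hat_natDegree_le (N + 1) (⟨D.B, hB⟩ : F) ⟨D.a, ha⟩ (μ.map σ)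
    rw [hc, natDegree_mul (minpoly.ne_zero hr) hc0, hN] at h1
    refine ⟨c.coeff 0, ?_⟩
    rw [hc, mul_comm]
    congr 1
    exact eq_C_of_natDegree_eq_zero (by omega)
  obtain ⟨c, hc⟩ := hhat
  have hcL := congrArg (Polynomial.map (algebraMap F LL)) hc
  rw [hat_map, Polynomial.map_mul, ← hμL, map_C] at hcL
  have hmm : (μ.map σ).map (algebraMap F LL) = μL.map D.s := by
    rw [hμL, Polynomial.map_map, Polynomial.map_map]; rfl
  change hat (N+1) D.B D.a ((μ.map σ).map (algebraMap F LL)) = _ at hcL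
  set νs := ν.map D.s with hνs
  have hνsdeg : νs.natDegree = N := by rw [hνs, natDegree_map, hνdeg]
  have hfac : hat (N + 1) D.B D.a (μL.map D.s) =
      (C D.B - C D.sr * (X - C D.a)) * hat N D.B D.a νs := by
    rw [hν, Polynomial.map_mul, Polynomial.map_sub, map_X, map_C, s_r, ← hνs, sub_mul, hat_sub,
      hat_X_mul, hat_C_mul, hat_succ _ _ _ _ hνsdeg.le]
    ring
  have hlin : (C D.B - C D.sr * (X - C D.a)) = C (-D.sr) * (X - C D.r) := by
    rw [← D.sr_mul]; simp only [C_mul, C_sub, C_neg]; ring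
  rw [hmm, hfac, hlin] at hcL
  have hcL2 : C (-D.sr) * hat N D.B D.a νs = C (algebraMap F LL c) * ν := by
    apply mul_left_cancel₀ (X_sub_C_ne_zero D.r)
    rw [hν] at hcL
    linear_combination hcL
  have ev1 := congrArg (Polynomial.eval D.r) hcL2
  have ev2 := congrArg (fun p => (D.r - D.a) * Polynomial.eval D.r (derivative p)) hcL2
  simp only [derivative_C_mul, eval_mul, eval_C] at ev1 ev2
  rw [hat_eval _ _ _ _ D.sr D.sr_mul _ hνsdeg.le] at ev1
  rw [mul_left_comm, hat_logderiv _ _ _ _ D.sr D.sr_mul _ hνsdeg.le] at ev2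
  have e1 : νs.eval D.sr = D.s (ν.eval D.r) := by rw [hνs, ← s_r, eval_map, eval₂_hom]
  have e2 : (derivative νs).eval D.sr = D.s ((derivative ν).eval D.r) := by
    rw [hνs, derivative_map, ← s_r, eval_map, eval₂_hom]
  rw [e1] at ev1 ev2
  rw [e2] at ev2
  have hν0 : ν.eval D.r ≠ 0 := by
    have hsep : (derivative μL).eval D.r ≠ 0 := by
      rw [hμL, derivative_map, eval_map_algebraMap]
      exact (minpoly.irreducible hr).separable.aeval_derivative_ne_zero (minpoly.aeval F D.r)
    rw [hν] at hsep
    simpa [derivative_mul] using hsep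
  set P := ν.eval D.r
  set P' := (derivative ν).eval D.r
  have hsP : D.s P ≠ 0 := by simpa using hν0
  have hw : (D.r - D.a) ^ N ≠ 0 := pow_ne_zero _ D.r_sub_ne
  have hcne : algebraMap F LL c ≠ 0 := by
    intro h0
    rw [h0, zero_mul] at ev1
    have := D.sr_ne
    simp_all
  -- divide
  set ρ := P' / P with hρ
  have hsρ : D.s ρ * D.s P = D.s P' := by rw [hρ, map_div₀]; field_simp
  have hρP : P' = ρ * P := by rw [hρ]; field_simp
  have key : (D.r - D.a) * ρ = N - D.sr * D.s ρ := by
    have h3 : -D.sr * ((D.r - D.a) ^ N * (N * D.s P - D.sr * D.s P')) =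
      (D.r - D.a) * ρ * (-D.sr * ((D.r - D.a) ^ N * D.s P)) := by
      rw [ev1, ev2, hρP]; ring
    rw [← hsρ] at h3
    have h4 : -D.sr * ((D.r - D.a) ^ N * D.s P) ≠ 0 :=
      mul_ne_zero (neg_ne_zero.2 D.sr_ne) (mul_ne_zero hw hsP)
    apply mul_right_cancel₀ h4
    linear_combination -h3
  have hNc : (N : LL) ≠ 0 := Nat.cast_ne_zero.2 hN0
  apply D.star_r (D.r * ρ / N)
  rw [map_div₀, map_mul, s_r, map_natCast, ← sr_mul]
  field_simp
  linear_combination (D.r * D.sr) * key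
end alg
end FD


namespace FD
variable (D : FD)

lemma aeval_x (U : ℂ[X]) : aeval x U = algebraMap PS LL (U : PS) := by
  induction U using Polynomial.induction_on' with
  | add p q hp hq => simp [hp, hq]
  | monomial n c =>
    rw [aeval_monomial, Polynomial.coe_monomial, x, ← map_pow,
      IsScalarTower.algebraMap_apply ℂ PS LL, ← map_mul]
    congr 1
    ext m
    rw [PowerSeries.algebraMap_apply, PowerSeries.coeff_C_mul, PowerSeries.coeff_X_pow,
      PowerSeries.coeff_monomial]
    simp

lemma s_C (c : ℂ) : D.s (algebraMap ℂ LL c) = algebraMap ℂ LL c := by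
  rw [IsScalarTower.algebraMap_apply ℂ PS LL, s_map]
  congr 1
  exact PowerSeries.expand_C _ _ _

lemma s_aeval (U : ℂ[X]) (z : LL) : D.s (aeval z U) = aeval (D.s z) U := by
  rw [aeval_def, aeval_def, hom_eval₂]
  congr 1
  ext c
  · exact D.s_C c

lemma s_aeval_x (U : ℂ[X]) : D.s (aeval x U) = aeval x (Polynomial.expand ℂ D.q U) := by
  rw [s_aeval, s_x, expand_aeval]

lemma aeval_x_inj (U : ℂ[X]) (h : aeval (x : LL) U = 0) : U = 0 := by
  rw [aeval_x, FaithfulSMul.algebraMap_eq_zero_iff] at h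
  exact_mod_cast h

lemma x_transc : Transcendental ℂ (x : LL) := by
  rw [transcendental_iff]
  exact aeval_x_inj

/-- the field ℂ(x) -/
noncomputable def F0 : IntermediateField ℂ LL := IntermediateField.adjoin ℂ {(x : LL)}

lemma x_mem : (x : LL) ∈ F0 := IntermediateField.mem_adjoin_simple_self ℂ x

lemma aeval_mem_F0 (z : LL) (hz : z ∈ F0) (U : ℂ[X]) : aeval z U ∈ F0 := by
  have : aeval z U = ((aeval (⟨z, hz⟩ : F0) U : F0) : LL) := by
    exact (IntermediateField.aeval_coe F0 ⟨z, hz⟩ U)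
  rw [this]
  exact SetLike.coe_mem _

lemma F0_stab (z : LL) (hz : z ∈ F0) : D.s z ∈ F0 := by
  obtain ⟨U, V, rfl⟩ := (IntermediateField.mem_adjoin_simple_iff ℂ z).1 hz
  rw [map_div₀, s_aeval_x, s_aeval_x]
  exact div_mem (aeval_mem_F0 _ x_mem _) (aeval_mem_F0 _ x_mem _)

noncomputable def Ap : ℂ[X] := PowerSeries.trunc (D.q - 1) D.A

lemma Ap_deg : D.Ap.natDegree + 2 ≤ D.q := by
  have hq := D.hq
  have : D.Ap.natDegree < D.q - 1 := by
    obtain ⟨m, hm⟩ : ∃ m, D.q - 1 = m + 1 := ⟨D.q - 2, by omega⟩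
    unfold Ap
    rw [hm]
    exact PowerSeries.natDegree_trunc_lt _ _
  omega

lemma Ap_coe : (D.Ap : PS) = D.A := by
  ext n
  rw [Polynomial.coeff_coe, Ap, PowerSeries.coeff_trunc]
  split_ifs with h
  · rfl
  · rw [D.Adeg _ (by omega)]

lemma aeval_Ap : aeval x D.Ap = D.a := by rw [aeval_x, Ap_coe, a]
lemma a_mem : D.a ∈ F0 := by rw [← aeval_Ap]; exact aeval_mem_F0 _ x_mem _

lemma r_notMem : D.r ∉ F0 := by
  intro hr
  have hq := D.hq
  obtain ⟨U, V, hUV⟩ := (IntermediateField.mem_adjoin_simple_iff ℂ D.r).1 hr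
  have hV0 : V ≠ 0 := by
    rintro rfl
    apply D.r_ne
    rw [hUV]; simp
  have hU0 : U ≠ 0 := by
    rintro rfl
    apply D.r_ne
    rw [hUV]; simp
  obtain ⟨p, v, hcop, hpv⟩ : ∃ p v : ℂ[X], IsCoprime p v ∧ v ≠ 0 ∧ p ≠ 0 ∧ D.r = aeval x p / aeval x v := by
    obtain ⟨p, hp⟩ := EuclideanDomain.gcd_dvd_left U V
    obtain ⟨v, hv⟩ := EuclideanDomain.gcd_dvd_right U V
    set g := EuclideanDomain.gcd U V with hg
    have hg0 : g ≠ 0 := by rintro h0; rw [h0, zero_mul] at hv; exact hV0 hv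
    refine ⟨p, v, ?_, ?_, ?_, ?_⟩
    · have hb := EuclideanDomain.gcd_eq_gcd_ab U V
      rw [← hg] at hb
      refine ⟨EuclideanDomain.gcdA U V, EuclideanDomain.gcdB U V, ?_⟩
      apply mul_left_cancel₀ hg0
      conv_rhs => rw [mul_one, hb]
      linear_combination (-EuclideanDomain.gcdA U V) * hp + (-EuclideanDomain.gcdB U V) * hv
    · rintro rfl; rw [mul_zero] at hv; exact hV0 hv
    · rintro rfl; rw [mul_zero] at hp; exact hU0 hp
    · have hgx : aeval (x : LL) g ≠ 0 := fun h => hg0 (aeval_x_inj _ h)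
      rw [hUV, hp, hv, map_mul, map_mul, mul_div_mul_left _ _ hgx]
  obtain ⟨hv0, hp0, hr'⟩ := hpv
  have hvx : aeval (x : LL) v ≠ 0 := fun h => hv0 (aeval_x_inj _ h)
  set pσ := Polynomial.expand ℂ D.q p with hpσ
  set vσ := Polynomial.expand ℂ D.q v with hvσ
  have hvσx : aeval (x : LL) vσ ≠ 0 := by
    rw [hvσ, ← D.s_aeval_x]; simpa using hvx
  have hsr : D.sr = aeval x pσ / aeval x vσ := by
    rw [← s_r, hr', map_div₀, s_aeval_x, s_aeval_x]
  -- polynomial identity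
  have id1 : pσ * (p - D.Ap * v) = X ^ (D.q * (D.q - 1)) * (v * vσ) := by
    rw [← sub_eq_zero]
    apply aeval_x_inj
    have h := D.sr_mul
    rw [hr', hsr, B] at h
    simp only [map_sub, map_mul, map_pow, aeval_X, aeval_Ap]
    field_simp at h
    linear_combination h
  -- constant coefficient
  have hc : p.coeff 0 ≠ 0 := by
    have h : (D.h * (v : PS)) = (D.e D.h) * (p : PS) := by
      apply IsFractionRing.injective PS LL
      rw [map_mul, map_mul, ← aeval_x, ← aeval_x]
      have := hr'
      unfold r at this
      have n2 := D.h2_ne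
      field_simp at this
      exact this
    have h2 := congrArg PowerSeries.constantCoeff h
    rw [map_mul, map_mul, e0, D.h0, one_mul, one_mul, ← PowerSeries.coeff_zero_eq_constantCoeff_apply,
      ← PowerSeries.coeff_zero_eq_constantCoeff_apply, Polynomial.coeff_coe, Polynomial.coeff_coe] at h2
    intro h0
    obtain ⟨α, β, hab⟩ := hcop
    have := congrArg (fun f => Polynomial.coeff f 0) hab
    simp [mul_coeff_zero, h2, h0] at this
  have hcop2 : IsCoprime pσ vσ := hcop.map (Polynomial.expand ℂ D.q).toRingHom
  have hpσ0 : pσ.coeff 0 ≠ 0 := by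
    rw [hpσ, coeff_expand (by omega), if_pos (dvd_zero _)]
    simpa using hc
  have hcX : IsCoprime pσ (X ^ (D.q * (D.q - 1))) := by
    apply IsCoprime.pow_right
    rw [isCoprime_comm]
    exact (Polynomial.irreducible_X.coprime_iff_not_dvd).2 (fun h => hpσ0 (X_dvd_iff.1 h))
  have hd1 : pσ ∣ v := by
    have h1 : pσ ∣ X ^ (D.q * (D.q - 1)) * (v * vσ) := ⟨_, id1.symm⟩
    have h2 : pσ ∣ v * vσ := hcX.dvd_of_dvd_mul_left h1
    exact hcop2.dvd_of_dvd_mul_right h2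
  have hqdeg : p.natDegree * D.q ≤ v.natDegree := by
    rw [← natDegree_expand]
    exact natDegree_le_of_dvd hd1 hv0
  have hvσ0 : vσ ≠ 0 := by rintro h; rw [h] at hvσx; simp at hvσx
  have hpσne : pσ ≠ 0 := by rintro h; rw [h] at hpσ0; simp at hpσ0
  have hne : p - D.Ap * v ≠ 0 := by
    intro h
    rw [h, mul_zero] at id1
    exact mul_ne_zero (pow_ne_zero _ X_ne_zero) (mul_ne_zero hv0 hvσ0) id1.symm
  have hdeg := congrArg natDegree id1
  rw [natDegree_mul hpσne hne, natDegree_mul (pow_ne_zero _ X_ne_zero) (mul_ne_zero hv0 hvσ0),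
    natDegree_mul hv0 hvσ0, natDegree_X_pow, hpσ, hvσ, natDegree_expand, natDegree_expand] at hdeg
  have hle : (p - D.Ap * v).natDegree ≤ D.q - 2 + v.natDegree := by
    refine (natDegree_sub_le _ _).trans (max_le ?_ ?_)
    · nlinarith
    · refine natDegree_mul_le.trans ?_
      have := D.Ap_deg
      omega
  have e1 : v.natDegree ≤ v.natDegree * D.q := Nat.le_mul_of_pos_right _ (by omega)
  have e2 : 2 * (D.q - 1) ≤ D.q * (D.q - 1) := Nat.mul_le_mul_right _ hq
  omega

lemma r_transc : Transcendental F0 D.r := by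
  intro h
  have h2 : IsAlgebraic F0.toSubfield D.r := h
  have hi : IsIntegral F0.toSubfield D.r := h2.isIntegral
  have h1 := D.r_deg_one F0.toSubfield (fun z hz => D.F0_stab z hz) x_mem D.a_mem hi
  have := minpoly.mem_range_of_degree_eq_one F0.toSubfield D.r (by
    rw [degree_eq_natDegree (minpoly.ne_zero hi), h1]; rfl)
  obtain ⟨z, hz⟩ := this
  apply D.r_notMem
  rw [← hz]
  exact z.2
end FD


namespace FD
variable (D : FD)

noncomputable def σ0 : (F0 : IntermediateField ℂ LL) →+* (F0 : IntermediateField ℂ LL) :=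
  RingHom.restrict D.s F0 F0 D.F0_stab

lemma aeval_map_σ0 (p : F0[X]) (z : LL) :
    aeval (D.s z) (p.map D.σ0) = D.s (aeval z p) := by
  rw [aeval_def, eval₂_map, aeval_def, hom_eval₂]
  rfl

lemma B_mem : D.B ∈ F0 := pow_mem x_mem _

noncomputable def hat0 (N : ℕ) (G : F0[X]) : F0[X] :=
  hat N (⟨D.B, D.B_mem⟩ : F0) ⟨D.a, D.a_mem⟩ (G.map D.σ0)

lemma hat0_aeval (N : ℕ) (G : F0[X]) (h : G.natDegree ≤ N) :
    aeval D.r (D.hat0 N G) = (D.r - D.a) ^ N * D.s (aeval D.r G) := by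
  rw [← eval_map_algebraMap, hat0, hat_map]
  change eval D.r (hat N D.B D.a _) = _
  rw [hat_eval _ _ _ _ D.sr D.sr_mul, ← s_r, eval_map_algebraMap, aeval_map_σ0]
  rw [natDegree_map, natDegree_map]; exact h

lemma hat0_deriv (N : ℕ) (G : F0[X]) (h : G.natDegree ≤ N) :
    (D.r - D.a) * aeval D.r (derivative (D.hat0 N G)) =
      (D.r - D.a) ^ N * (N * D.s (aeval D.r G) - D.sr * D.s (aeval D.r (derivative G))) := by
  rw [← eval_map_algebraMap, ← derivative_map, hat0, hat_map]
  change _ * eval D.r (derivative (hat N D.B D.a _)) = _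
  rw [hat_logderiv _ _ _ _ D.sr D.sr_mul, derivative_map, derivative_map, ← s_r,
    eval_map_algebraMap, aeval_map_σ0, eval_map_algebraMap, aeval_map_σ0]
  rw [natDegree_map, natDegree_map]; exact h

/-- ℂ(x,r) -/
noncomputable def E0 : IntermediateField F0 LL := IntermediateField.adjoin F0 {D.r}

lemma r_mem : D.r ∈ D.E0 := IntermediateField.mem_adjoin_simple_self _ _

lemma F0_le (z : LL) (hz : z ∈ F0) : z ∈ D.E0 := D.E0.algebraMap_mem ⟨z, hz⟩

lemma sr_mem : D.sr ∈ D.E0 := by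
  have : D.sr = D.B / (D.r - D.a) := by
    rw [← sr_mul]; have := D.r_sub_ne; field_simp
  rw [this]
  exact div_mem (D.F0_le _ D.B_mem) (sub_mem D.r_mem (D.F0_le _ D.a_mem))

lemma aeval_mem_E0 (z : LL) (hz : z ∈ D.E0) (U : F0[X]) : aeval z U ∈ D.E0 := by
  have : aeval z U = ((aeval (⟨z, hz⟩ : D.E0) U : D.E0) : LL) := by
    exact (IntermediateField.aeval_coe D.E0 ⟨z, hz⟩ U)
  rw [this]
  exact SetLike.coe_mem _

lemma E0_stab (z : LL) (hz : z ∈ D.E0) : D.s z ∈ D.E0 := by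
  obtain ⟨U, V, rfl⟩ := (IntermediateField.mem_adjoin_simple_iff F0 z).1 hz
  rw [map_div₀, ← aeval_map_σ0, ← aeval_map_σ0, s_r]
  exact div_mem (D.aeval_mem_E0 _ D.sr_mem _) (D.aeval_mem_E0 _ D.sr_mem _)

noncomputable def σE : D.E0 →+* D.E0 := RingHom.restrict D.s D.E0 D.E0 D.E0_stab

lemma aeval_map_σE (p : D.E0[X]) (z : LL) :
    aeval (D.s z) (p.map D.σE) = D.s (aeval z p) := by
  rw [aeval_def, eval₂_map, aeval_def, hom_eval₂]
  rfl

lemma no_mult (m : ℕ) (hm : m ≠ 0) (c : LL) (hc : c ∈ D.E0) (hc0 : c ≠ 0)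
    (h : D.s c * D.r ^ m = c) : False := by
  obtain ⟨U, V, rfl⟩ := (IntermediateField.mem_adjoin_simple_iff F0 c).1 hc
  obtain ⟨M, rfl⟩ : ∃ M, m = M + 1 := ⟨m - 1, by omega⟩
  have hu0 : aeval D.r U ≠ 0 := fun h0 => hc0 (by rw [h0, zero_div])
  have hv0 : aeval D.r V ≠ 0 := fun h0 => hc0 (by rw [h0, div_zero])
  set N := max U.natDegree V.natDegree
  have hUN : U.natDegree ≤ N := le_max_left _ _
  have hVN : V.natDegree ≤ N := le_max_right _ _
  have eU := D.hat0_aeval N U hUN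
  have eV := D.hat0_aeval N V hVN
  have dU := D.hat0_deriv N U hUN
  have dV := D.hat0_deriv N V hVN
  have hsu0 : D.s (aeval D.r U) ≠ 0 := by simpa using hu0
  have hsv0 : D.s (aeval D.r V) ≠ 0 := by simpa using hv0
  rw [map_div₀] at h
  have E1 : D.s (aeval D.r U) * aeval D.r V * D.r ^ (M + 1) = aeval D.r U * D.s (aeval D.r V) := by
    field_simp at h
    linear_combination h
  have id1 : D.hat0 N U * V * X ^ (M + 1) = U * D.hat0 N V := by
    rw [← sub_eq_zero]
    apply (transcendental_iff.1 D.r_transc)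
    simp only [map_sub, map_mul, map_pow, aeval_X]
    rw [eU, eV]
    linear_combination (D.r - D.a) ^ N * E1
  have id2 := congrArg (fun p => (D.r - D.a) * aeval D.r (derivative p)) id1
  simp only [derivative_mul, derivative_X_pow, map_add, map_mul, map_pow, aeval_X,
    map_natCast, eU, eV, Nat.add_sub_cancel] at id2
  set u := aeval D.r U
  set v := aeval D.r V
  set u' := aeval D.r (derivative U)
  set v' := aeval D.r (derivative V)
  set w := (D.r - D.a) ^ N with hw
  have hw0 : w ≠ 0 := pow_ne_zero _ D.r_sub_ne
  have hr0 := D.r_ne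
  set pu := u' / u with hpu
  set pv := v' / v with hpv
  have u'e : u' = pu * u := by rw [hpu]; field_simp
  have v'e : v' = pv * v := by rw [hpv]; field_simp
  have su'e : D.s u' = D.s pu * D.s u := by rw [← map_mul, ← u'e]
  have sv'e : D.s v' = D.s pv * D.s v := by rw [← map_mul, ← v'e]
  have key : D.r * D.sr * (D.s pu - D.s pv) =
      (M + 1) * (D.r - D.a) - (D.r - D.a) * D.r * (pu - pv) := by
    have hZ : w * D.s u * v * D.r ^ (M + 1) ≠ 0 :=
      mul_ne_zero (mul_ne_zero (mul_ne_zero hw0 hsu0) hv0) (pow_ne_zero _ hr0)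
    apply mul_left_cancel₀ hZ
    rw [su'e] at dU
    rw [sv'e] at dV
    rw [u'e, v'e] at id2
    push_cast at id2
    rw [pow_succ] at *
    linear_combination (-D.r) * id2 + (v * D.r ^ M * D.r ^ 2) * dU - (D.r * u) * dV
      - (- D.r * (D.r - D.a) * pu * w - D.r * w * N + D.r * D.sr * D.s pv * w) * E1
  apply D.star_r (1 - D.r * (pu - pv) / (M + 1))
  have hM : ((M : LL) + 1) ≠ 0 := by exact_mod_cast Nat.succ_ne_zero M
  have hM2 : D.s ((M : LL) + 1) = (M : LL) + 1 := by simp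
  rw [map_sub, map_one, map_div₀, map_mul, s_r, hM2, map_sub, ← sr_mul]
  field_simp
  linear_combination (-D.sr) * key

lemma h1_transc : Transcendental D.E0 D.h1 := by
  intro halg
  have hi : IsIntegral D.E0 D.h1 := halg.isIntegral
  set μ := minpoly D.E0 D.h1 with hμ
  set rE : D.E0 := ⟨D.r, D.r_mem⟩
  have hrE : rE ≠ 0 := by
    intro h
    exact D.r_ne (congrArg Subtype.val h)
  have hmon : (scaleRoots (μ.map D.σE) rE).Monic :=
    (monic_scaleRoots_iff rE).2 ((minpoly.monic hi).map _)
  have hroot : aeval D.h1 (scaleRoots (μ.map D.σE) rE) = 0 := by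
    have h0 : aeval D.h2 (μ.map D.σE) = 0 := by
      rw [← s_h1, aeval_map_σE, minpoly.aeval, map_zero]
    have := scaleRoots_aeval_eq_zero (r := rE) h0
    have e : algebraMap D.E0 LL rE * D.h2 = D.h1 := by
      change D.r * D.h2 = D.h1
      have := D.h2_ne
      rw [r]; field_simp
    rwa [e] at this
  have hμ2 : scaleRoots (μ.map D.σE) rE = μ := by
    apply minpoly.unique _ _ hmon hroot
    intro p hp hp0
    have := minpoly.min D.E0 D.h1 hp hp0
    rwa [degree_scaleRoots, degree_map]
  have h0 := congrArg (fun p => ((p.coeff 0 : D.E0) : LL)) hμ2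
  simp only [coeff_scaleRoots, coeff_map, natDegree_map, Nat.sub_zero] at h0
  refine D.no_mult μ.natDegree (minpoly.natDegree_pos hi).ne' (μ.coeff 0 : D.E0) (SetLike.coe_mem _) ?_ ?_
  · intro hz
    exact minpoly.coeff_zero_ne_zero hi D.h1_ne (Subtype.ext hz)
  · exact h0
end FD


lemma algInd_transfer {k M : Type*} [Field k] [Field M] [Algebra k M] (n : ℕ)
    (v y : Fin n → M) (hv : AlgebraicIndependent k v)
    (h : ∀ i, v i ∈ IntermediateField.adjoin k (Set.range y)) :
    AlgebraicIndependent k y := by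
  set E := IntermediateField.adjoin k (Set.range y)
  have hy : ∀ i, y i ∈ E := fun i => IntermediateField.subset_adjoin _ _ ⟨i, rfl⟩
  let v' : Fin n → E := fun i => ⟨v i, h i⟩
  let y' : Fin n → E := fun i => ⟨y i, hy i⟩
  have hv' : AlgebraicIndependent k v' := AlgebraicIndependent.of_comp E.val hv
  have halg : Algebra.IsAlgebraic (Algebra.adjoin k (Set.range y')) E := by
    constructor
    intro e
    obtain ⟨r, s, hrs⟩ := (IntermediateField.mem_adjoin_range_iff k y (e : M)).1 e.2
    have he : e = MvPolynomial.aeval y' r * (MvPolynomial.aeval y' s)⁻¹ := by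
      apply Subtype.ext
      have key : ∀ p : MvPolynomial (Fin n) k, ((MvPolynomial.aeval y' p : E) : M) = MvPolynomial.aeval y p := by
        intro p
        have := MvPolynomial.map_aeval y' (algebraMap E M) p
        rw [MvPolynomial.aeval_def]
        exact this
      simp only [MulMemClass.coe_mul, key]
      rw [hrs, div_eq_mul_inv, ← key s]
      rfl
    have hmem : ∀ p : MvPolynomial (Fin n) k, IsAlgebraic (Algebra.adjoin k (Set.range y')) (MvPolynomial.aeval y' p) := by
      intro p
      have : MvPolynomial.aeval y' p ∈ Algebra.adjoin k (Set.range y') := by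
        rw [Algebra.adjoin_range_eq_range_aeval]
        exact ⟨p, rfl⟩
      exact isAlgebraic_algebraMap (⟨_, this⟩ : Algebra.adjoin k (Set.range y'))
    rw [he]
    exact (hmem r).mul (hmem s).inv
  have hb := Algebra.IsAlgebraic.isTranscendenceBasis_of_lift_le_trdeg_of_finite k y'
    hv'.lift_cardinalMk_le_trdeg
  exact hb.1.map' (f := E.val) Subtype.val_injective

namespace FD
variable (D : FD)

abbrev MM := FractionRing LL[X]

noncomputable def toM : PS[X] →ₐ[ℂ] MM :=
  (IsScalarTower.toAlgHom ℂ LL[X] MM).comp (Polynomial.mapAlgHom (IsScalarTower.toAlgHom ℂ PS LL))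

lemma toM_C (f : PS) : toM (C f) = algebraMap LL MM (algebraMap PS LL f) := by
  simp [toM, IsScalarTower.algebraMap_apply LL LL[X] MM]

lemma indep_base : AlgebraicIndependent ℂ
    ![algebraMap LL MM x, algebraMap LL MM D.r, algebraMap LL MM D.h1, toM X] := by
  -- over F0: r, h1
  have i1 : AlgebraicIndependent D.E0 ![D.h1] :=
    algebraicIndependent_iff_transcendental.2 D.h1_transc
  have i2 : AlgebraicIndependent F0 ![(⟨D.r, D.r_mem⟩ : D.E0)] := by
    rw [algebraicIndependent_iff_transcendental]
    intro h
    apply D.r_transc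
    exact h.algebraMap (A := LL)
  have i3 := i2.sumElim_comp i1
  have i4 : AlgebraicIndependent ℂ ![(⟨x, x_mem⟩ : F0)] := by
    rw [algebraicIndependent_iff_transcendental]
    intro h
    apply x_transc
    exact h.algebraMap (A := LL)
  have i5 := i4.sumElim_comp i3
  have i6 : AlgebraicIndependent LL ![(toM X : MM)] := by
    rw [algebraicIndependent_iff_transcendental]
    have : (toM X : MM) = algebraMap LL[X] MM X := by simp [toM]
    rw [this, transcendental_iff]
    intro p hp
    rw [aeval_algebraMap_apply, aeval_X_left_apply, FaithfulSMul.algebraMap_eq_zero_iff] at hp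
    exact hp
  have i7 := i5.sumElim_comp i6
  let f : Fin 4 → Fin 1 ⊕ ((Fin 1 ⊕ Fin 1) ⊕ Fin 1) :=
    ![.inr (.inr 0), .inr (.inl (.inr 0)), .inr (.inl (.inl 0)), .inl 0]
  have hf : Function.Injective f := by decide
  have i8 := i7.comp f hf
  convert i8 using 1
  funext i
  fin_cases i <;> rfl

lemma indep_abc (ξ1 ξ2 Dd : ℂ) (h1 : ξ1 ≠ 0) (hD : Dd ≠ 0) (a b c : PS[X])
    (ha : C D.h * a = C (PowerSeries.C ξ1) * (1 - C (PowerSeries.X ^ (D.q - 1) * D.e D.h) * X))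
    (hb : C (PowerSeries.C ξ1) * b = C (PowerSeries.C ξ2) * a -
      C (PowerSeries.C Dd * PowerSeries.X ^ D.q * D.e D.h))
    (hc : c = C (PowerSeries.C ξ1) * X) :
    AlgebraicIndependent ℂ ![C PowerSeries.X, a, b, c] := by
  apply AlgebraicIndependent.of_comp toM
  refine algInd_transfer 4 _ _ D.indep_base ?_
  set E := IntermediateField.adjoin ℂ (Set.range (toM ∘ ![C PowerSeries.X, a, b, c]))
  have hC : ∀ z : ℂ, toM (C (PowerSeries.C z)) ∈ E := by
    intro z
    have : toM (C (PowerSeries.C z)) = algebraMap ℂ MM z := by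
      rw [← AlgHom.commutes toM]; rfl
    rw [this]; exact E.algebraMap_mem z
  have hC0 : ∀ z : ℂ, z ≠ 0 → toM (C (PowerSeries.C z)) ≠ 0 := by
    intro z hz
    have : toM (C (PowerSeries.C z)) = algebraMap ℂ MM z := by
      rw [← AlgHom.commutes toM]; rfl
    rw [this]; simpa using hz
  have m0 : toM (C PowerSeries.X) ∈ E := IntermediateField.subset_adjoin _ _ ⟨0, rfl⟩
  have m1 : toM a ∈ E := IntermediateField.subset_adjoin _ _ ⟨1, rfl⟩
  have m2 : toM b ∈ E := IntermediateField.subset_adjoin _ _ ⟨2, rfl⟩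
  have m3 : toM c ∈ E := IntermediateField.subset_adjoin _ _ ⟨3, rfl⟩
  have inj1 : Function.Injective (algebraMap LL MM) := (algebraMap LL MM).injective
  have hx0 : toM (C PowerSeries.X) ≠ 0 := by
    rw [toM_C]; exact (_root_.map_ne_zero _).2 x_ne
  have hT : toM X ∈ E := by
    have : toM X = toM c / toM (C (PowerSeries.C ξ1)) := by
      rw [hc, map_mul, mul_div_cancel_left₀ _ (hC0 _ h1)]
    rw [this]; exact div_mem m3 (hC _)
  have hh2 : toM (C (D.e D.h)) ∈ E := by
    have e := congrArg toM hb
    simp only [map_mul, map_sub, map_pow, C_mul, C_pow] at e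
    have : toM (C (D.e D.h)) = (toM (C (PowerSeries.C ξ2)) * toM a - toM (C (PowerSeries.C ξ1)) * toM b) /
        (toM (C (PowerSeries.C Dd)) * toM (C PowerSeries.X) ^ D.q) := by
      have := hC0 _ hD
      rw [eq_div_iff (mul_ne_zero this (pow_ne_zero _ hx0))]
      linear_combination e
    rw [this]
    exact div_mem (sub_mem (mul_mem (hC _) m1) (mul_mem (hC _) m2)) (mul_mem (hC _) (pow_mem m0 _))
  have hh20 : toM (C (D.e D.h)) ≠ 0 := by
    rw [toM_C]; exact (_root_.map_ne_zero _).2 D.h2_ne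
  have hh10 : toM (C D.h) ≠ 0 := by
    rw [toM_C]; exact (_root_.map_ne_zero _).2 D.h1_ne
  have hh1 : toM (C D.h) ∈ E := by
    have e := congrArg toM ha
    have ha0 : toM a ≠ 0 := by
      intro h0
      rw [map_mul, h0, mul_zero, map_mul] at e
      rcases mul_eq_zero.1 e.symm with e | e
      · exact hC0 _ h1 e
      · have i6 : Transcendental LL (toM X : MM) := by
          have : (toM X : MM) = algebraMap LL[X] MM X := by simp [toM]
          rw [this, transcendental_iff]
          intro p hp
          rw [aeval_algebraMap_apply, aeval_X_left_apply, FaithfulSMul.algebraMap_eq_zero_iff] at hp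
          exact hp
        have := transcendental_iff.1 i6 (1 - C (algebraMap PS LL (PowerSeries.X ^ (D.q - 1) * D.e D.h)) * X) (by
          rw [map_sub, map_mul, map_one, toM_C] at e
          simp only [map_sub, map_one, map_mul, aeval_C, aeval_X] at e ⊢
          exact e)
        have := congrArg (Polynomial.eval 0) this
        simp at this
    simp only [map_mul, map_sub, map_pow, C_mul, C_pow, map_one] at e
    have : toM (C D.h) = toM (C (PowerSeries.C ξ1)) *
      (1 - toM (C PowerSeries.X) ^ (D.q - 1) * toM (C (D.e D.h)) * toM X) / toM a := by
      rw [eq_div_iff ha0, e]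
    rw [this]
    exact div_mem (mul_mem (hC _) (sub_mem (one_mem _) (mul_mem (mul_mem (pow_mem m0 _) hh2) hT))) m1
  intro i
  fin_cases i
  · change algebraMap LL MM x ∈ E
    rw [x, ← toM_C]; exact m0
  · change algebraMap LL MM D.r ∈ E
    rw [r, map_div₀, FD.h1, FD.h2, ← toM_C, ← toM_C]
    exact div_mem hh1 hh2
  · change algebraMap LL MM D.h1 ∈ E
    rw [FD.h1, ← toM_C]; exact hh1
  · exact hT
end FD


open Asymptotics Filter in
/-- `RpN ev w N φ s`: `s n` agrees with the value at `w n` of a polynomial approximation of `φ`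
to order `N`. -/
def RpN {R : Type*} [CommRing R] (ev : ℕ → R →+* ℂ) (w : ℕ → ℂ) (N : ℕ) (φ : PowerSeries R)
    (s : ℕ → ℂ) : Prop :=
  ∃ p : R[X], (PowerSeries.X ^ N ∣ φ - (p : PowerSeries R)) ∧
    (fun n => s n - p.eval₂ (ev n) (w n)) =O[atTop] (fun n => w n ^ N)

def Rp {R : Type*} [CommRing R] (ev : ℕ → R →+* ℂ) (w : ℕ → ℂ) (φ : PowerSeries R)
    (s : ℕ → ℂ) : Prop := ∀ N, RpN ev w N φ s

namespace Rp
open Asymptotics Filter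
variable {R : Type*} [CommRing R] {ev : ℕ → R →+* ℂ} {w : ℕ → ℂ} {φ ψ : PowerSeries R} {s u : ℕ → ℂ}

lemma eval_bdd (hev : ∀ r, (fun n => ev n r) =O[atTop] (fun _ => (1 : ℂ)))
    (hw : w =O[atTop] (fun _ => (1 : ℂ))) (p : R[X]) :
    (fun n => p.eval₂ (ev n) (w n)) =O[atTop] (fun _ => (1 : ℂ)) := by
  simp only [eval₂_eq_sum_range]
  refine IsBigO.fun_sum ?_
  intro i _
  have := (hev (p.coeff i)).mul (hw.pow i)
  simpa using this

lemma bdd (hev : ∀ r, (fun n => ev n r) =O[atTop] (fun _ => (1 : ℂ)))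
    (hw : w =O[atTop] (fun _ => (1 : ℂ))) (h : Rp ev w φ s) : s =O[atTop] (fun _ => (1 : ℂ)) := by
  obtain ⟨p, -, h2⟩ := h 0
  simp only [pow_zero] at h2
  simpa using h2.add (eval_bdd hev hw p)

lemma ofPoly (p : R[X]) : Rp ev w (p : PowerSeries R) (fun n => p.eval₂ (ev n) (w n)) := by
  intro N
  refine ⟨p, by simp, ?_⟩
  simpa using isBigO_zero _ _

lemma const (r : R) : Rp ev w (PowerSeries.C r) (fun n => ev n r) := by
  have := ofPoly (ev := ev) (w := w) (C r)
  simpa using this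

lemma X : Rp ev w (PowerSeries.X) w := by
  have := ofPoly (ev := ev) (w := w) (Polynomial.X)
  simpa using this

lemma add (h : Rp ev w φ s) (h' : Rp ev w ψ u) : Rp ev w (φ + ψ) (fun n => s n + u n) := by
  intro N
  obtain ⟨p, h1, h2⟩ := h N
  obtain ⟨p', h1', h2'⟩ := h' N
  refine ⟨p + p', ?_, ?_⟩
  · have := dvd_add h1 h1'
    rw [Polynomial.coe_add]; convert this using 1; ring
  · refine (h2.add h2').congr_left ?_
    intro n; simp only [eval₂_add]; ring

lemma mul (hev : ∀ r, (fun n => ev n r) =O[atTop] (fun _ => (1 : ℂ)))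
    (hw : w =O[atTop] (fun _ => (1 : ℂ))) (h : Rp ev w φ s) (h' : Rp ev w ψ u) :
    Rp ev w (φ * ψ) (fun n => s n * u n) := by
  intro N
  obtain ⟨p, h1, h2⟩ := h N
  obtain ⟨p', h1', h2'⟩ := h' N
  refine ⟨p * p', ?_, ?_⟩
  · have := dvd_add (h1.mul_right ψ) (h1'.mul_left (p : PowerSeries R))
    rw [Polynomial.coe_mul]; convert this using 1; ring
  · have e1 := h2.mul (h'.bdd hev hw)
    have e2 := (eval_bdd hev hw p).mul h2'
    simp only [mul_one, one_mul] at e1 e2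
    refine (e1.add e2).congr_left ?_
    intro n; simp only [eval₂_mul]; ring

lemma congr (h : Rp ev w φ s) (e : ∀ᶠ n in atTop, s n = u n) : Rp ev w φ u := by
  intro N
  obtain ⟨p, h1, h2⟩ := h N
  refine ⟨p, h1, h2.congr' ?_ EventuallyEq.rfl⟩
  filter_upwards [e] with n hn; rw [hn]

lemma neg (h : Rp ev w φ s) : Rp ev w (-φ) (fun n => - s n) := by
  intro N
  obtain ⟨p, h1, h2⟩ := h N
  refine ⟨-p, ?_, ?_⟩
  · have := (dvd_neg.2 h1)
    rw [Polynomial.coe_neg]; convert this using 1; ring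
  · refine h2.neg_left.congr_left ?_
    intro n; simp only [eval₂_neg]; ring

lemma sub (h : Rp ev w φ s) (h' : Rp ev w ψ u) : Rp ev w (φ - ψ) (fun n => s n - u n) := by
  have := h.add h'.neg
  simpa [sub_eq_add_neg] using this

lemma pow (hev : ∀ r, (fun n => ev n r) =O[atTop] (fun _ => (1 : ℂ)))
    (hw : w =O[atTop] (fun _ => (1 : ℂ))) (h : Rp ev w φ s) (k : ℕ) :
    Rp ev w (φ ^ k) (fun n => s n ^ k) := by
  induction k with
  | zero => have := const (ev := ev) (w := w) 1; simpa using this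
  | succ k ih => simp only [pow_succ]; exact ih.mul hev hw h

lemma sum {ι : Type*} (t : Finset ι) (φ : ι → PowerSeries R) (s : ι → ℕ → ℂ)
    (h : ∀ i ∈ t, Rp ev w (φ i) (s i)) : Rp ev w (∑ i ∈ t, φ i) (fun n => ∑ i ∈ t, s i n) := by
  classical
  induction t using Finset.induction_on with
  | empty => have := const (ev := ev) (w := w) 0; simpa using this
  | insert i t hi ih =>
    simp only [Finset.sum_insert hi]
    exact (h i (Finset.mem_insert_self _ _)).add (ih (fun j hj => h j (Finset.mem_insert_of_mem hj)))

lemma inv (hev : ∀ r, (fun n => ev n r) =O[atTop] (fun _ => (1 : ℂ)))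
    (hw : w =O[atTop] (fun _ => (1 : ℂ))) (h : Rp ev w φ s) (hψ : φ * ψ = 1)
    (hs : (fun n => (s n)⁻¹) =O[atTop] (fun _ => (1 : ℂ))) (hs0 : ∀ᶠ n in atTop, s n ≠ 0) :
    Rp ev w ψ (fun n => (s n)⁻¹) := by
  intro N
  obtain ⟨p, h1, h2⟩ := h N
  let p' := PowerSeries.trunc N ψ
  have hp' : PowerSeries.X ^ N ∣ ψ - (p' : PowerSeries R) := by
    rw [PowerSeries.X_pow_dvd_iff]
    intro m hm
    simp [p', PowerSeries.coeff_trunc, hm]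
  refine ⟨p', hp', ?_⟩
  have hd : PowerSeries.X ^ N ∣ ((1 - p * p' : R[X]) : PowerSeries R) := by
    have := dvd_add (h1.mul_right ψ) (hp'.mul_left (p : PowerSeries R))
    rw [Polynomial.coe_sub, Polynomial.coe_mul, Polynomial.coe_one]
    convert this using 1
    linear_combination -hψ
  have hd2 : Polynomial.X ^ N ∣ (1 - p * p' : R[X]) := by
    rw [Polynomial.X_pow_dvd_iff]
    intro d hdN
    have := PowerSeries.X_pow_dvd_iff.1 hd d hdN
    rwa [Polynomial.coeff_coe] at this
  obtain ⟨g, hg⟩ := hd2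
  have e1 : (fun n => (1 - p * p').eval₂ (ev n) (w n)) =O[atTop] (fun n => w n ^ N) := by
    rw [hg]
    simp only [eval₂_mul, eval₂_pow, eval₂_X]
    have := (isBigO_refl (fun n => w n ^ N) atTop).mul (eval_bdd hev hw g)
    simpa using this
  have e2 := h2.mul (eval_bdd hev hw p')
  simp only [mul_one] at e2
  have e3 := hs.mul (e1.sub e2)
  simp only [one_mul] at e3
  refine e3.congr' ?_ EventuallyEq.rfl
  filter_upwards [hs0] with n hn
  simp only [eval₂_sub, eval₂_mul, eval₂_one]
  field_simp
  ring

lemma shift (Q : ℕ) (hQ : Q ≠ 0) (hQ1 : 1 ≤ Q) (hw : w =O[atTop] (fun _ => (1 : ℂ)))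
    (hwq : ∀ n, w (n + 1) = w n ^ Q) (hev : ∀ n r, ev (n + 1) r = ev n r) (h : Rp ev w φ s) :
    Rp ev w (PowerSeries.expand Q hQ φ) (fun n => s (n + 1)) := by
  intro N
  obtain ⟨p, h1, h2⟩ := h N
  refine ⟨Polynomial.expand R Q p, ?_, ?_⟩
  · obtain ⟨g, hg⟩ := h1
    have hp : ((Polynomial.expand R Q p : R[X]) : PowerSeries R) = PowerSeries.expand Q hQ (p : PowerSeries R) := by
      ext n
      rw [Polynomial.coeff_coe, Polynomial.coeff_expand (Nat.pos_of_ne_zero hQ), PowerSeries.coeff_expand]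
      simp
    rw [hp, ← map_sub, hg, map_mul, map_pow, PowerSeries.expand_X, ← pow_mul]
    exact (pow_dvd_pow _ (Nat.le_mul_of_pos_left _ hQ1)).mul_right _
  · have h3 := h2.comp_tendsto (tendsto_add_atTop_nat 1)
    have h4 : (fun n => w (n + 1) ^ N) =O[atTop] (fun n => w n ^ N) := by
      obtain ⟨Q', rfl⟩ : ∃ Q', Q = Q' + 1 := ⟨Q - 1, by omega⟩
      have := ((hw.pow Q').mul (isBigO_refl w atTop)).pow N
      simp only [one_pow, one_mul] at this
      refine this.congr_left ?_
      intro n; rw [hwq, pow_succ]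
    refine (h3.trans h4).congr_left ?_
    intro n
    simp only [Function.comp]
    rw [hwq, Polynomial.expand_eq_comp_X_pow, Polynomial.eval₂_comp]
    simp only [eval₂_X_pow]
    congr 1
    apply Polynomial.eval₂_congr _ rfl rfl
    ext r; exact hev n r

lemma comp (h : Rp ev w φ s) (f : ℕ → ℕ) (hf : Tendsto f atTop atTop) :
    Rp (fun n => ev (f n)) (fun n => w (f n)) φ (fun n => s (f n)) := by
  intro N
  obtain ⟨p, h1, h2⟩ := h N
  exact ⟨p, h1, h2.comp_tendsto hf⟩

lemma ofInt {φ : PowerSeries ℤ} (h : Rp (fun _ => Int.castRingHom ℂ) w φ s) (ev : ℕ → R →+* ℂ) :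
    Rp ev w (φ.map (Int.castRingHom R)) s := by
  intro N
  obtain ⟨p, h1, h2⟩ := h N
  refine ⟨p.map (Int.castRingHom R), ?_, ?_⟩
  · have := map_dvd (PowerSeries.map (Int.castRingHom R)) h1
    rwa [map_pow, PowerSeries.map_X, map_sub, ← Polynomial.polynomial_map_coe] at this
  · refine h2.congr_left ?_
    intro n
    rw [eval₂_map]
    congr 2
    exact RingHom.ext_int _ _

lemma isBigO_of_dvd (hev : ∀ r, (fun n => ev n r) =O[atTop] (fun _ => (1 : ℂ)))
    (hw : w =O[atTop] (fun _ => (1 : ℂ))) (h : Rp ev w φ s) (N : ℕ) (hd : PowerSeries.X ^ N ∣ φ) :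
    s =O[atTop] (fun n => w n ^ N) := by
  obtain ⟨p, h1, h2⟩ := h N
  have hp : PowerSeries.X ^ N ∣ (p : PowerSeries R) := by
    have := dvd_sub hd h1
    simpa using this
  have hp2 : Polynomial.X ^ N ∣ p := by
    rw [Polynomial.X_pow_dvd_iff]
    intro d hdN
    have := PowerSeries.X_pow_dvd_iff.1 hp d hdN
    rwa [Polynomial.coeff_coe] at this
  obtain ⟨g, rfl⟩ := hp2
  simp only [eval₂_mul, eval₂_pow, eval₂_X] at h2
  have := (isBigO_refl (fun n => w n ^ N) atTop).mul (eval_bdd hev hw g)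
  simp only [mul_one] at this
  simpa using h2.add this

/-- zero lemma over `ℂ` -/
lemma eq_zero (hw : Tendsto w atTop (nhds 0)) (hw0 : ∀ n, w n ≠ 0) {φ : PowerSeries ℂ}
    (h : Rp (fun _ => RingHom.id ℂ) w φ s) (hs : ∀ N : ℕ, s =O[atTop] (fun n => w n ^ N)) : φ = 0 := by
  by_contra hne
  have hw1 : w =O[atTop] (fun _ => (1 : ℂ)) := hw.isBigO_one ℂ
  have hev : ∀ r : ℂ, (fun n : ℕ => RingHom.id ℂ r) =O[atTop] (fun _ => (1 : ℂ)) :=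
    fun r => isBigO_const_const _ one_ne_zero _
  set N := φ.order.toNat
  obtain ⟨p, h1, h2⟩ := h (N + 1)
  have hN : PowerSeries.coeff N φ ≠ 0 := PowerSeries.coeff_order hne
  have hlow : ∀ m < N, PowerSeries.coeff m φ = 0 := fun m hm =>
    PowerSeries.coeff_of_lt_order_toNat m hm
  have hpc : ∀ m < N + 1, p.coeff m = PowerSeries.coeff m φ := by
    intro m hm
    have := PowerSeries.X_pow_dvd_iff.1 h1 m hm
    rw [map_sub, Polynomial.coeff_coe] at this
    exact (sub_eq_zero.1 this).symm
  have hp2 : Polynomial.X ^ N ∣ p := by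
    rw [Polynomial.X_pow_dvd_iff]
    intro d hdN
    rw [hpc d (by omega), hlow d hdN]
  obtain ⟨g, rfl⟩ := hp2
  have hg0 : g.eval 0 ≠ 0 := by
    have := hpc N (by omega)
    rw [Polynomial.coeff_X_pow_mul'] at this
    simp only [le_refl, if_true, Nat.sub_self] at this
    rw [← Polynomial.coeff_zero_eq_eval_zero, this]; exact hN
  have h3 := (hs (N + 1)).sub h2
  have h4 : (fun n => w n ^ N * g.eval (w n)) =O[atTop] (fun n => w n ^ N * w n) := by
    refine h3.congr ?_ ?_
    · intro n; simp [eval₂_mul, eval₂_pow, eval₂_id]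
    · intro n; rw [pow_succ]
  have h5 : (fun n => g.eval (w n)) =O[atTop] w := by
    have := (isBigO_refl (fun n => (w n ^ N)⁻¹) atTop).mul h4
    refine this.congr ?_ ?_ <;> intro n <;> field_simp [hw0 n]
  have h6 : Tendsto (fun n => g.eval (w n)) atTop (nhds 0) := h5.trans_tendsto hw
  have h7 : Tendsto (fun n => g.eval (w n)) atTop (nhds (g.eval 0)) :=
    (g.continuous.tendsto 0).comp hw
  exact hg0 (tendsto_nhds_unique h7 h6)

end Rp


lemma p_bound (C ε : ℝ) (hC : 0 ≤ C) (hε : 0 ≤ ε) (h4 : 4 * (C + 1) * ε ≤ 1) (p α β : ℕ → ℂ)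
    (p0 : p 0 = 0) (p1 : p 1 = 1) (hp : ∀ j, p (j + 2) = α j * p (j + 1) + β j * p j)
    (hα : ∀ j, ‖α j - 1‖ ≤ C * (ε * (1 / 2) ^ j)) (hβ : ∀ j, ‖β j‖ ≤ ε * (1 / 2) ^ j) (j : ℕ) :
    ‖p j‖ ≤ 2 ∧ ‖p (j + 1) - 1‖ ≤ 4 * (C + 1) * ε * (1 - (1 / 2) ^ j) := by
  induction j with
  | zero => simp [p0, p1]
  | succ j ih =>
    obtain ⟨i1, i2⟩ := ih
    have hh : (0 : ℝ) < (1 / 2) ^ j := by positivity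
    have hpos : 0 ≤ 4 * (C + 1) * ε := by positivity
    have i3 : ‖p (j + 1)‖ ≤ 2 := by
      have : ‖p (j + 1)‖ ≤ ‖p (j + 1) - 1‖ + ‖(1 : ℂ)‖ := by
        simpa using norm_add_le (p (j + 1) - 1) 1
      rw [norm_one] at this
      nlinarith
    refine ⟨i3, ?_⟩
    have e : p (j + 1 + 1) - 1 = (p (j + 1) - 1) + ((α j - 1) * p (j + 1) + β j * p j) := by
      rw [show j + 1 + 1 = j + 2 from rfl, hp]; ring
    have n1 : ‖(α j - 1) * p (j + 1)‖ ≤ C * (ε * (1 / 2) ^ j) * 2 := by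
      rw [norm_mul]
      exact mul_le_mul (hα j) i3 (norm_nonneg _) (by positivity)
    have n2 : ‖β j * p j‖ ≤ (ε * (1 / 2) ^ j) * 2 := by
      rw [norm_mul]
      exact mul_le_mul (hβ j) i1 (norm_nonneg _) (by positivity)
    rw [e]
    refine (norm_add_le _ _).trans ((add_le_add i2 ((norm_add_le _ _).trans (add_le_add n1 n2))).trans ?_)
    rw [pow_succ]
    apply le_of_eq; ring

/-- Analytic data of the recursion. -/
structure SD where
  q : ℕ
  hq : 2 ≤ q
  A : ℤ[X]
  A0 : A.coeff 0 = 1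
  Adeg : A.natDegree + 2 ≤ q
  w : ℕ → ℂ
  hw : ∀ n, w (n + 1) = w n ^ q
  hw0 : w 0 ≠ 0
  hw1 : ‖w 0‖ < 1
  a : ℕ → ℂ
  b : ℕ → ℂ
  ha : ∀ n, a (n + 2) = aeval (w n) A * a (n + 1) + w n ^ (q - 1) * a n
  hb : ∀ n, b (n + 2) = aeval (w n) A * b (n + 1) + w n ^ (q - 1) * b n
  hd : a 1 * b 0 - b 1 * a 0 ≠ 0
  ξ1 : ℂ
  ξ2 : ℂ
  hξ1 : Filter.Tendsto a Filter.atTop (nhds ξ1)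
  hξ2 : Filter.Tendsto b Filter.atTop (nhds ξ2)

namespace SD
open Asymptotics Filter
variable (S : SD)

lemma w_eq (n : ℕ) : S.w n = S.w 0 ^ S.q ^ n := by
  induction n with
  | zero => simp
  | succ n ih => rw [S.hw, ih, ← pow_mul, ← pow_succ]

lemma w_ne (n : ℕ) : S.w n ≠ 0 := by rw [w_eq]; exact pow_ne_zero _ S.hw0

lemma w_tendsto : Tendsto S.w atTop (nhds 0) := by
  have h1 : Tendsto (fun n => S.q ^ n) atTop atTop := tendsto_pow_atTop_atTop_of_one_lt (by have := S.hq; omega)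
  have h2 := (tendsto_pow_atTop_nhds_zero_of_norm_lt_one S.hw1).comp h1
  refine h2.congr ?_
  intro n; simp [S.w_eq n]

lemma w_bdd : S.w =O[atTop] (fun _ => (1 : ℂ)) := S.w_tendsto.isBigO_one ℂ

lemma w_half (n : ℕ) (hn : ‖S.w n‖ ≤ 1 / 2) (j : ℕ) : ‖S.w (n + j)‖ ≤ ‖S.w n‖ * (1 / 2) ^ j := by
  induction j with
  | zero => simp
  | succ j ih =>
    have hle : ‖S.w (n + j)‖ ≤ 1 / 2 := ih.trans (by
      have : ((1 : ℝ) / 2) ^ j ≤ 1 := pow_le_one₀ (by norm_num) (by norm_num)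
      nlinarith [norm_nonneg (S.w n)])
    rw [← add_assoc, S.hw, norm_pow]
    have : ‖S.w (n + j)‖ ^ S.q ≤ ‖S.w (n + j)‖ ^ 2 :=
      pow_le_pow_of_le_one (norm_nonneg _) (by linarith) S.hq
    rw [pow_succ]
    nlinarith [norm_nonneg (S.w (n + j))]

noncomputable def d (n : ℕ) : ℂ := S.a (n + 1) * S.b n - S.b (n + 1) * S.a n
noncomputable def h (n : ℕ) : ℂ := (S.ξ1 * S.b n - S.ξ2 * S.a n) / S.d n

lemma d_succ (n : ℕ) : S.d (n + 1) = - S.w n ^ (S.q - 1) * S.d n := by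
  simp only [d]
  rw [show n + 1 + 1 = n + 2 from rfl, S.ha, S.hb]; ring

lemma d_ne (n : ℕ) : S.d n ≠ 0 := by
  induction n with
  | zero => exact S.hd
  | succ n ih =>
    rw [d_succ]
    exact mul_ne_zero (neg_ne_zero.2 (pow_ne_zero _ (S.w_ne n))) ih

lemma d_h (n : ℕ) : S.h n * S.d n = S.ξ1 * S.b n - S.ξ2 * S.a n := div_mul_cancel₀ _ (S.d_ne n)

lemma h_rec (n : ℕ) : S.h n = aeval (S.w n) S.A * S.h (n + 1) +
    S.w n ^ (S.q * (S.q - 1)) * S.h (n + 2) := by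
  have h0 := S.d_h n
  have h1 := S.d_h (n + 1)
  have h2 := S.d_h (n + 2)
  rw [S.ha, S.hb, show n + 2 = n + 1 + 1 from rfl, S.d_succ (n + 1), S.d_succ n, S.hw, ← pow_mul] at h2
  rw [S.d_succ] at h1
  have hd := S.d_ne n
  have hw := pow_ne_zero (S.q - 1) (S.w_ne n)
  apply mul_right_cancel₀ (mul_ne_zero hw hd)
  linear_combination S.w n ^ (S.q - 1) * h0 - h2 + (aeval (S.w n) S.A) * h1

lemma xi1_eq (n : ℕ) : S.ξ1 = S.a (n + 1) * S.h n + S.w n ^ (S.q - 1) * S.h (n + 1) * S.a n := by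
  have h0 := S.d_h n
  have h1 := S.d_h (n + 1)
  rw [S.d_succ] at h1
  have hd := S.d_ne n
  apply mul_right_cancel₀ hd
  have e : S.d n = S.a (n + 1) * S.b n - S.b (n + 1) * S.a n := rfl
  linear_combination S.a n * h1 - S.a (n + 1) * h0 + S.ξ1 * e

lemma xi2_eq (n : ℕ) : S.ξ2 = S.b (n + 1) * S.h n + S.w n ^ (S.q - 1) * S.h (n + 1) * S.b n := by
  have h0 := S.d_h n
  have h1 := S.d_h (n + 1)
  rw [S.d_succ] at h1
  have hd := S.d_ne n
  apply mul_right_cancel₀ hd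
  have e : S.d n = S.a (n + 1) * S.b n - S.b (n + 1) * S.a n := rfl
  linear_combination S.b n * h1 - S.b (n + 1) * h0 + S.ξ2 * e

lemma A_bound : ∃ C : ℝ, 0 ≤ C ∧ ∀ z : ℂ, ‖z‖ ≤ 1 → ‖aeval z S.A - 1‖ ≤ C * ‖z‖ := by
  obtain ⟨g, hg⟩ : Polynomial.X ∣ S.A - 1 := by
    rw [Polynomial.X_dvd_iff]; simp [S.A0]
  obtain ⟨C, hC⟩ := (isCompact_closedBall (0 : ℂ) 1).exists_bound_of_continuousOn
    (f := fun z => aeval z g) (Polynomial.continuous_aeval g).continuousOn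
  refine ⟨C, (norm_nonneg _).trans (hC 0 (by simp)), ?_⟩
  intro z hz
  have : aeval z S.A - 1 = z * aeval z g := by
    have := congrArg (aeval z) hg
    simpa using this
  rw [this, norm_mul, mul_comm]
  exact mul_le_mul_of_nonneg_right (hC z (by simpa using hz)) (norm_nonneg _)

lemma h_sub_one : (fun n => S.h n - 1) =O[atTop] S.w := by
  obtain ⟨C, hC, hA⟩ := S.A_bound
  apply IsBigO.of_bound (4 * (C + 1))
  have hpos : (0 : ℝ) < 1 / (4 * (C + 1)) := by positivity
  have t0 : Tendsto (fun n => ‖S.w n‖) atTop (nhds 0) := by simpa using S.w_tendsto.norm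
  filter_upwards [t0.eventually (ge_mem_nhds (show (0 : ℝ) < 1 / 2 by norm_num)),
    t0.eventually (ge_mem_nhds hpos)] with n h1 h2
  have hw := S.w_half n h1
  have hle : ∀ j, ‖S.w (n + j)‖ ≤ 1 := by
    intro j
    refine (hw j).trans ?_
    have : ((1 : ℝ) / 2) ^ j ≤ 1 := pow_le_one₀ (by norm_num) (by norm_num)
    have h0 : (0 : ℝ) ≤ (1 / 2) ^ j := by positivity
    nlinarith [norm_nonneg (S.w n)]
  let p : ℕ → ℂ := fun j => (S.a (n + j) * S.b n - S.b (n + j) * S.a n) / S.d n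
  have hb := p_bound C ‖S.w n‖ hC (norm_nonneg _) (by
      rw [le_div_iff₀ (by positivity)] at h2; linarith) p (fun j => aeval (S.w (n + j)) S.A)
      (fun j => S.w (n + j) ^ (S.q - 1)) (by simp only [p, add_zero]; ring_nf)
      (by simp only [p]; exact div_self (S.d_ne n))
      (by intro j; simp only [p]; rw [← add_assoc, S.ha, S.hb, ← add_assoc]; ring)
      (by
        intro j
        exact (hA _ (hle j)).trans (mul_le_mul_of_nonneg_left (hw j) hC))
      (by
        intro j
        rw [norm_pow]
        refine le_trans ?_ (hw j)
        exact pow_le_of_le_one (norm_nonneg _) (hle j) (by have := S.hq; omega))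
  have hlim : Tendsto (fun j => p (j + 1)) atTop (nhds (S.h n)) := by
    have ta : Tendsto (fun j => S.a (n + (j + 1))) atTop (nhds S.ξ1) :=
      S.hξ1.comp (tendsto_atTop_mono (fun j => show j ≤ n + (j + 1) by omega) tendsto_id)
    have tb : Tendsto (fun j => S.b (n + (j + 1))) atTop (nhds S.ξ2) :=
      S.hξ2.comp (tendsto_atTop_mono (fun j => show j ≤ n + (j + 1) by omega) tendsto_id)
    exact ((ta.mul_const _).sub (tb.mul_const _)).div_const _
  refine le_of_tendsto (hlim.sub_const 1).norm (Eventually.of_forall ?_)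
  intro j
  refine (hb j).2.trans ?_
  have h0 : (0 : ℝ) ≤ (1 / 2) ^ j := by positivity
  have : 0 ≤ 4 * (C + 1) * ‖S.w n‖ := by positivity
  nlinarith

lemma h_tendsto : Tendsto S.h atTop (nhds 1) := by
  have := S.h_sub_one.trans_tendsto S.w_tendsto
  simpa using this.add_const 1

lemma xi_ne : S.ξ1 ≠ 0 ∨ S.ξ2 ≠ 0 := by
  by_contra hc
  push Not at hc
  have : ∀ n, S.h n = 0 := by intro n; simp [h, hc.1, hc.2]
  have h1 := S.h_tendsto
  have h2 : Tendsto S.h atTop (nhds 0) := by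
    rw [show S.h = fun _ => 0 from funext this]; exact tendsto_const_nhds
  exact one_ne_zero (tendsto_nhds_unique h1 h2)

lemma rp_h (hh : PowerSeries ℤ) (hh0 : PowerSeries.constantCoeff hh = 1) (hq0 : S.q ≠ 0)
    (heq : hh = (S.A : PowerSeries ℤ) * PowerSeries.expand S.q hq0 hh + PowerSeries.X ^ (S.q * (S.q - 1)) *
      PowerSeries.expand S.q hq0 (PowerSeries.expand S.q hq0 hh)) :
    Rp (fun _ => Int.castRingHom ℂ) S.w hh S.h := by
  have hev : ∀ r : ℤ, (fun n : ℕ => Int.castRingHom ℂ r) =O[atTop] (fun _ => (1 : ℂ)) :=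
    fun r => isBigO_const_const _ one_ne_zero _
  have key : ∀ N, RpN (fun _ => Int.castRingHom ℂ) S.w (N + 1) hh S.h := by
    intro N
    induction N with
    | zero =>
      refine ⟨1, ?_, ?_⟩
      · rw [zero_add, pow_one, PowerSeries.X_dvd_iff]; simp [hh0]
      · simpa using S.h_sub_one
    | succ N ih =>
      obtain ⟨p, h1, h2⟩ := ih
      have hp : ∀ p : ℤ[X], ((Polynomial.expand ℤ S.q p : ℤ[X]) : PowerSeries ℤ) = PowerSeries.expand S.q hq0 (p : PowerSeries ℤ) := by
        intro p
        ext n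
        rw [Polynomial.coeff_coe, Polynomial.coeff_expand (Nat.pos_of_ne_zero hq0), PowerSeries.coeff_expand]
        simp
      have hN : N + 1 + 1 ≤ S.q * (N + 1) := by have := S.hq; nlinarith
      have dv : ∀ f : PowerSeries ℤ, PowerSeries.X ^ (N + 1) ∣ f → PowerSeries.X ^ (N + 1 + 1) ∣ PowerSeries.expand S.q hq0 f := by
        rintro f ⟨g, rfl⟩
        rw [map_mul, map_pow, PowerSeries.expand_X, ← pow_mul]
        exact (pow_dvd_pow _ hN).mul_right _
      refine ⟨S.A * Polynomial.expand ℤ S.q p + Polynomial.X ^ (S.q * (S.q - 1)) *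
        Polynomial.expand ℤ S.q (Polynomial.expand ℤ S.q p), ?_, ?_⟩
      · have e1 := dv _ h1
        have e2 := dv _ ((pow_dvd_pow _ (Nat.le_succ _)).trans e1)
        rw [map_sub] at e1
        rw [map_sub, map_sub] at e2
        have e3 := dvd_add (e1.mul_left (S.A : PowerSeries ℤ)) (e2.mul_left (PowerSeries.X ^ (S.q * (S.q - 1))))
        rw [Polynomial.coe_add, Polynomial.coe_mul, Polynomial.coe_mul, Polynomial.coe_pow, Polynomial.coe_X, hp, hp, hp]
        convert e3 using 1
        linear_combination heq
      · have o1 : (fun n => S.h (n + 1) - p.eval₂ (Int.castRingHom ℂ) (S.w (n + 1))) =O[atTop] (fun n => S.w n ^ (N + 1 + 1)) := by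
          have h3 := h2.comp_tendsto (tendsto_add_atTop_nat 1)
          refine h3.trans ?_
          obtain ⟨m, hm⟩ := Nat.exists_eq_add_of_le hN
          have := (isBigO_refl (fun n => S.w n ^ (N + 1 + 1)) atTop).mul (S.w_bdd.pow m)
          simp only [one_pow, mul_one] at this
          refine this.congr_left ?_
          intro n
          simp only [Function.comp]
          rw [← pow_add, ← hm, S.hw, ← pow_mul]
        have o2 : (fun n => S.h (n + 2) - p.eval₂ (Int.castRingHom ℂ) (S.w (n + 2))) =O[atTop] (fun n => S.w n ^ (N + 1 + 1)) := by
          have h3 := o1.comp_tendsto (tendsto_add_atTop_nat 1)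
          refine h3.trans ?_
          have h4 : (fun n => S.w (n + 1)) =O[atTop] S.w := by
            have := (S.w_bdd.pow (S.q - 1)).mul (isBigO_refl S.w atTop)
            simp only [one_pow, one_mul] at this
            refine this.congr_left ?_
            intro n
            rw [S.hw, ← pow_succ]
            congr 1
            have := S.hq; omega
          exact h4.pow _
        have o31 := (Rp.eval_bdd hev S.w_bdd S.A).mul o1
        have o32 := (S.w_bdd.pow (S.q * (S.q - 1))).mul o2
        simp only [one_mul, one_pow] at o31 o32
        have o3 := o31.add o32
        refine o3.congr_left ?_
        intro n
        have ex : ∀ (p : ℤ[X]) z, (Polynomial.expand ℤ S.q p).eval₂ (Int.castRingHom ℂ) z = p.eval₂ (Int.castRingHom ℂ) (z ^ S.q) := by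
          intro p z
          rw [Polynomial.expand_eq_comp_X_pow, Polynomial.eval₂_comp]; simp
        simp only [eval₂_add, eval₂_mul, eval₂_pow, eval₂_X, ex]
        rw [S.hw (n + 1), S.hw n]
        have := S.h_rec n
        rw [aeval_def, algebraMap_int_eq] at this
        rw [this]
        ring
  intro N
  obtain ⟨p, h1, h2⟩ := key N
  refine ⟨p, (pow_dvd_pow _ (Nat.le_succ _)).trans h1, h2.trans ?_⟩
  have := (isBigO_refl (fun n => S.w n ^ N) atTop).mul S.w_bdd
  simpa [pow_succ] using this

end SD


section lin
variable {k : Type*} [CommRing k] (α β : k)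

lemma lin_pow_natDegree (i : ℕ) : ((C α + C β * X) ^ i).natDegree ≤ i := by
  refine natDegree_pow_le.trans ?_
  have : (C α + C β * X).natDegree ≤ 1 := by
    rw [add_comm]; exact natDegree_linear_le
  nlinarith

lemma lin_pow_coeff (i : ℕ) : ((C α + C β * X) ^ i).coeff i = β ^ i ∧
    ((C α + C β * X) ^ (i + 1)).coeff i = (i + 1) * α * β ^ i := by
  induction i with
  | zero => simp
  | succ i ih =>
    have e : ∀ j, (C α + C β * X) ^ (j + 1) = C α * (C α + C β * X) ^ j + C β * ((C α + C β * X) ^ j * X) := by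
      intro j; ring
    constructor
    · rw [e, coeff_add, coeff_C_mul, coeff_C_mul, coeff_mul_X, ih.1,
        coeff_eq_zero_of_natDegree_lt (lt_of_le_of_lt (lin_pow_natDegree α β i) (Nat.lt_succ_self i))]
      ring
    · have h1 : ((C α + C β * X) ^ (i + 1)).coeff (i + 1) = β ^ (i + 1) := by
        rw [e, coeff_add, coeff_C_mul, coeff_C_mul, coeff_mul_X, ih.1,
          coeff_eq_zero_of_natDegree_lt (lt_of_le_of_lt (lin_pow_natDegree α β i) (Nat.lt_succ_self i))]
        ring
      rw [e, coeff_add, coeff_C_mul, coeff_C_mul, coeff_mul_X, ih.2, h1]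
      push_cast; ring

lemma eraseLead_eq' (p : k[X]) : p.eraseLead = p - C p.leadingCoeff * X ^ p.natDegree :=
  eq_sub_of_add_eq p.eraseLead_add_C_mul_X_pow
end lin

open Asymptotics Filter in
/-- Pairs (formal series, sequence represented by it). -/
noncomputable def PP (V : ℕ → ℂ) (hV : V =O[atTop] (fun _ => (1 : ℂ))) : Subalgebra ℂ (PS × (ℕ → ℂ)) where
  carrier := {p | Rp (fun _ => RingHom.id ℂ) V p.1 p.2}
  mul_mem' := fun ha hb => Rp.mul (fun _ => isBigO_const_const _ one_ne_zero _) hV ha hb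
  add_mem' := fun ha hb => Rp.add ha hb
  algebraMap_mem' := fun r => Rp.const (ev := fun _ => RingHom.id ℂ) (w := V) r

namespace PP
open Asymptotics Filter
variable (V : ℕ → ℂ) (hV : V =O[atTop] (fun _ => (1 : ℂ)))

noncomputable def pi : PP V hV →ₐ[ℂ] PS := (AlgHom.fst ℂ PS (ℕ → ℂ)).comp (PP V hV).val
noncomputable def ev (m : ℕ) : PP V hV →ₐ[ℂ] ℂ :=
  (Pi.evalAlgHom ℂ (fun _ : ℕ => ℂ) m).comp ((AlgHom.snd ℂ PS (ℕ → ℂ)).comp (PP V hV).val)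
noncomputable def val (y : ℕ → ℂ) (m : ℕ) : (PP V hV)[X] →ₐ[ℂ] ℂ :=
  (aeval (y m)).comp (mapAlgHom (ev V hV m))

variable {V hV}

lemma val_C (y : ℕ → ℂ) (m : ℕ) (p : PP V hV) : val V hV y m (C p) = ev V hV m p := by simp [val]
lemma val_X (y : ℕ → ℂ) (m : ℕ) : val V hV y m X = y m := by simp [val]
lemma val_eq (y : ℕ → ℂ) (m : ℕ) (p : (PP V hV)[X]) :
    val V hV y m p = ∑ i ∈ Finset.range (p.natDegree + 1), ev V hV m (p.coeff i) * y m ^ i := by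
  have := congrArg (val V hV y m) (p.as_sum_range_C_mul_X_pow)
  rw [this, map_sum]
  simp only [map_mul, map_pow, val_C, val_X]

def Flat (y : ℕ → ℂ) (p : (PP V hV)[X]) : Prop := ∀ N : ℕ, (fun m => val V hV y m p) =O[atTop] (fun m => V m ^ N)

lemma ev_bdd (p : PP V hV) : (fun m => ev V hV m p) =O[atTop] (fun _ => (1 : ℂ)) :=
  Rp.bdd (fun _ => isBigO_const_const _ one_ne_zero _) hV p.2

lemma Flat.C_mul {y : ℕ → ℂ} {p : (PP V hV)[X]} (h : Flat y p) (c : PP V hV) : Flat y (C c * p) := by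
  intro N
  have := (ev_bdd c).mul (h N)
  simp only [one_mul] at this
  refine this.congr_left ?_
  intro m; simp [val_C]

lemma Flat.sub {y : ℕ → ℂ} {p p' : (PP V hV)[X]} (h : Flat y p) (h' : Flat y p') : Flat y (p - p') := by
  intro N
  refine ((h N).sub (h' N)).congr_left ?_
  intro m
  exact (map_sub (val V hV y m) p p').symm

lemma flat_of_pi {y : ℕ → ℂ} (hy : y =O[atTop] (fun _ => (1 : ℂ))) (c : PP V hV) (hc : pi V hV c = 0) (i : ℕ) :
    Flat y (C c * X ^ i) := by
  intro N
  have h1 := Rp.isBigO_of_dvd (fun _ => isBigO_const_const _ one_ne_zero _) hV c.2 N (by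
    have : c.1.1 = 0 := hc
    rw [this]; exact dvd_zero _)
  have := h1.mul (hy.pow i)
  simp only [one_pow, mul_one] at this
  refine this.congr_left ?_
  intro m; simp only [map_mul, map_pow, val_C, val_X]; rfl

end PP

namespace FD
open Asymptotics Filter
variable (D : FD)

section
variable {V : ℕ → ℂ} (hV : V =O[atTop] (fun _ => (1 : ℂ))) (hVq : ∀ m, V (m + 1) = V m ^ (D.q * D.q))

lemma shiftP (p : PP V hV) (hVq : ∀ m, V (m + 1) = V m ^ (D.q * D.q)) :
    ((D.e (D.e p.1.1), fun m => p.1.2 (m + 1)) : PS × (ℕ → ℂ)) ∈ PP V hV := by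
  have hQ : D.q * D.q ≠ 0 := mul_ne_zero D.hq0 D.hq0
  have := Rp.shift (D.q * D.q) hQ (Nat.pos_of_ne_zero hQ) hV hVq (fun _ _ => rfl) p.2
  have e : PowerSeries.expand (D.q * D.q) hQ p.1.1 = D.e (D.e p.1.1) := PowerSeries.expand_mul _ _ _ _ _
  rw [e] at this
  exact this

lemma star_fin (r' : ℕ) (φ χ : PS) (hlead : φ ≠ 0)
    (hc2 : D.e (D.e φ) * (PowerSeries.X ^ (D.q * D.q - 1) * D.e (D.e D.h)) ^ (r' + 1) * χ =
      φ * (D.e (D.e χ) * D.h * (PowerSeries.X ^ (D.q * D.q - 1) * D.e (D.e D.h)) ^ r' +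
        D.e (D.e φ) * (((r' : PS) + 1) * D.A * (PowerSeries.X ^ (D.q * D.q - 1) * D.e (D.e D.h)) ^ r'))) : False := by
  have hc3 := congrArg (algebraMap PS LL) hc2
  simp only [map_mul, map_add, map_pow, map_natCast, map_one, ← s_map] at hc3
  have hφ0 : algebraMap PS LL φ ≠ 0 := by
    intro h; exact hlead ((FaithfulSMul.algebraMap_eq_zero_iff PS LL).1 h)
  have hφ1 : D.s (D.s (algebraMap PS LL φ)) ≠ 0 := (_root_.map_ne_zero _).2 ((_root_.map_ne_zero _).2 hφ0)
  have hB : (algebraMap PS LL PowerSeries.X ^ (D.q * D.q - 1) * D.s (D.s (algebraMap PS LL D.h))) ≠ 0 :=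
    mul_ne_zero (pow_ne_zero _ x_ne) ((_root_.map_ne_zero _).2 ((_root_.map_ne_zero _).2 D.h1_ne))
  have hr1 : ((r' : LL) + 1) ≠ 0 := by exact_mod_cast Nat.succ_ne_zero r'
  apply D.star (-(algebraMap PS LL χ) / ((r' + 1) * algebraMap PS LL φ))
  rw [map_div₀, map_div₀, map_neg, map_neg, map_mul, map_mul, map_add, map_add, map_natCast, map_natCast, map_one, map_one]
  rw [← s_h2, ← s_h1]
  change algebraMap PS LL D.h * _ = algebraMap PS LL D.A + (algebraMap PS LL PowerSeries.X) ^ _ * D.s (D.s (algebraMap PS LL D.h)) * _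
  generalize algebraMap PS LL φ = f at *
  generalize algebraMap PS LL χ = g at *
  generalize algebraMap PS LL D.A = aa at *
  generalize hBB : (algebraMap PS LL PowerSeries.X ^ (D.q * D.q - 1) * D.s (D.s (algebraMap PS LL D.h))) = B at *
  generalize D.s (D.s f) = f2 at *
  generalize D.s (D.s g) = g2 at *
  generalize algebraMap PS LL D.h = h at *
  have hc4 : f2 * B * g = f * (g2 * h + f2 * ((r' + 1) * aa)) := by
    apply mul_right_cancel₀ (pow_ne_zero r' hB)
    rw [pow_succ] at hc3
    linear_combination hc3
  field_simp
  linear_combination hc4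

lemma flat_zero (hVt : Tendsto V atTop (nhds 0)) (hV0 : ∀ m, V m ≠ 0)
    (hVq : ∀ m, V (m + 1) = V m ^ (D.q * D.q)) (hs h3s As y : ℕ → ℂ)
    (r1 : Rp (fun _ => RingHom.id ℂ) V D.h hs)
    (r3 : Rp (fun _ => RingHom.id ℂ) V (D.e (D.e D.h)) h3s)
    (rA : Rp (fun _ => RingHom.id ℂ) V D.A As)
    (hy : y =O[atTop] (fun _ => (1 : ℂ)))
    (rel : ∀ m, hs m * y (m + 1) = As m + V m ^ (D.q * D.q - 1) * h3s m * y m)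
    (p : (PP V hV)[X]) (hp : PP.Flat y p) : p.map (PP.pi V hV).toRingHom = 0 := by
  by_contra hne
  obtain ⟨r, hr⟩ : ∃ r, r = p.natDegree := ⟨_, rfl⟩
  induction r using Nat.strong_induction_on generalizing p with
  | _ r ih =>
  -- leading coefficient
  have hlead : PP.pi V hV (p.coeff r) ≠ 0 := by
    intro h0
    have he : p.eraseLead = p - C (p.coeff r) * X ^ r := by
      have := eraseLead_eq' p
      rw [leadingCoeff, ← hr] at this
      exact this
    have hfl : PP.Flat y p.eraseLead := by
      rw [he]; exact hp.sub (PP.flat_of_pi hy _ h0 _)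
    have hmap : p.eraseLead.map (PP.pi V hV).toRingHom ≠ 0 := by
      rw [he, Polynomial.map_sub, Polynomial.map_mul, Polynomial.map_C]
      have : (PP.pi V hV).toRingHom (p.coeff r) = 0 := h0
      rw [this]; simpa using hne
    have hr0 : r ≠ 0 := by
      intro hr0
      have hd : p = C (p.coeff 0) := eq_C_of_natDegree_eq_zero (by rw [← hr, hr0])
      apply hne
      rw [hd, Polynomial.map_C]
      rw [hr0] at h0
      have : (PP.pi V hV).toRingHom (p.coeff 0) = 0 := h0
      rw [this, C_0]
    have hlt : p.eraseLead.natDegree < r := by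
      have := p.eraseLead_natDegree_le
      omega
    exact ih _ hlt _ hfl hmap rfl
  by_cases hr0 : r = 0
  · have hd : p = C (p.coeff 0) := eq_C_of_natDegree_eq_zero (by rw [← hr, hr0])
    rw [hr0] at hlead
    apply hlead
    refine Rp.eq_zero hVt hV0 (p.coeff 0).2 ?_
    intro N
    have := hp N
    rw [hd] at this
    simp only [PP.val_C] at this
    exact this
  -- the transform
  obtain ⟨r', rfl⟩ : ∃ r', r = r' + 1 := ⟨r - 1, by omega⟩
  let ah : PP V hV := ⟨(D.A, As), rA⟩
  let hh : PP V hV := ⟨(D.h, hs), r1⟩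
  have hev : ∀ r : ℂ, (fun n : ℕ => RingHom.id ℂ r) =O[atTop] (fun _ => (1 : ℂ)) :=
    fun r => isBigO_const_const _ one_ne_zero _
  let bb : PP V hV := ⟨(PowerSeries.X ^ (D.q * D.q - 1) * D.e (D.e D.h), fun m => V m ^ (D.q * D.q - 1) * h3s m),
    ((Rp.X (ev := fun _ => RingHom.id ℂ) (w := V)).pow hev hV _).mul hev hV r3⟩
  let sg : PP V hV → PP V hV := fun c => ⟨_, D.shiftP hV c hVq⟩
  let τ : (PP V hV)[X] := ∑ i ∈ Finset.range (r' + 1 + 1), C (sg (p.coeff i) * hh ^ (r' + 1 - i)) * (C ah + C bb * X) ^ i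
  have hval : ∀ m, PP.val V hV y m τ = hs m ^ (r' + 1) * PP.val V hV y (m + 1) p := by
    intro m
    rw [PP.val_eq y (m + 1) p, ← hr, map_sum, Finset.mul_sum]
    apply Finset.sum_congr rfl
    intro i hi
    have hi' : i ≤ r' + 1 := by have := Finset.mem_range.1 hi; omega
    rw [map_mul (PP.val V hV y m), map_pow, map_add, map_mul (PP.val V hV y m) (C bb), PP.val_C, PP.val_C, PP.val_C,
      PP.val_X, map_mul, map_pow]
    have e1 : PP.ev V hV m ah = As m := rfl
    have e2 : PP.ev V hV m hh = hs m := rfl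
    have e3 : PP.ev V hV m bb = V m ^ (D.q * D.q - 1) * h3s m := rfl
    have e4 : PP.ev V hV m (sg (p.coeff i)) = PP.ev V hV (m + 1) (p.coeff i) := rfl
    rw [e1, e2, e3, e4, ← rel m, mul_pow]
    have : hs m ^ (r' + 1) = hs m ^ (r' + 1 - i) * hs m ^ i := by rw [← pow_add]; congr 1; omega
    rw [this]; ring
  have hτflat : PP.Flat y τ := by
    intro N
    have h1 := (hp N).comp_tendsto (tendsto_add_atTop_nat 1)
    have h4 : (fun n => V (n + 1) ^ N) =O[atTop] (fun n => V n ^ N) := by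
      have hQ : D.q * D.q ≠ 0 := mul_ne_zero D.hq0 D.hq0
      have := ((hV.pow (D.q * D.q - 1)).mul (isBigO_refl V atTop)).pow N
      simp only [one_pow, one_mul] at this
      refine this.congr_left ?_
      intro n; rw [hVq, ← pow_succ]; congr 2; omega
    have h5 := ((r1.bdd hev hV).pow (r' + 1)).mul (h1.trans h4)
    simp only [one_pow, one_mul] at h5
    exact h5.congr_left (fun m => (hval m).symm)
  have hτdeg : τ.natDegree ≤ r' + 1 := by
    apply natDegree_sum_le_of_forall_le
    intro i hi
    have hi' : i ≤ r' + 1 := by have := Finset.mem_range.1 hi; omega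
    refine (natDegree_C_mul_le _ _).trans ((lin_pow_natDegree _ _ _).trans hi')
  have hτ1 : τ.coeff (r' + 1) = sg (p.coeff (r' + 1)) * bb ^ (r' + 1) := by
    simp only [τ, finsetSum_coeff]
    rw [Finset.sum_range_succ, Finset.sum_eq_zero]
    · rw [coeff_C_mul, (lin_pow_coeff ah bb (r' + 1)).1]; simp
    · intro i hi
      rw [coeff_C_mul, coeff_eq_zero_of_natDegree_lt (lt_of_le_of_lt (lin_pow_natDegree _ _ _) (Finset.mem_range.1 hi)), mul_zero]
  have hτ0 : τ.coeff r' = sg (p.coeff r') * hh * bb ^ r' + sg (p.coeff (r' + 1)) * ((r' + 1) * ah * bb ^ r') := by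
    simp only [τ, finsetSum_coeff]
    rw [Finset.sum_range_succ, Finset.sum_range_succ, Finset.sum_eq_zero]
    · rw [coeff_C_mul, (lin_pow_coeff ah bb r').1, coeff_C_mul, (lin_pow_coeff ah bb r').2]; simp
    · intro i hi
      rw [coeff_C_mul, coeff_eq_zero_of_natDegree_lt (lt_of_le_of_lt (lin_pow_natDegree _ _ _) (Finset.mem_range.1 hi)), mul_zero]
  let U : (PP V hV)[X] := C (τ.coeff (r' + 1)) * p - C (p.coeff (r' + 1)) * τ
  have hUflat : PP.Flat y U := (hp.C_mul _).sub (hτflat.C_mul _)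
  have hUdeg : U.natDegree < r' + 1 := by
    have h1 : U.natDegree ≤ r' + 1 :=
      (natDegree_sub_le _ _).trans (max_le ((natDegree_C_mul_le _ _).trans hr.ge) ((natDegree_C_mul_le _ _).trans hτdeg))
    have h2 : U.coeff (r' + 1) = 0 := by simp only [U, coeff_sub, coeff_C_mul]; ring
    have h3 := natDegree_lt_iff_degree_lt (p := U) (n := r' + 1)
    by_contra hcon
    have h4 : U.natDegree = r' + 1 := by omega
    have h5 : U.leadingCoeff = 0 := by rw [leadingCoeff, h4, h2]
    rw [leadingCoeff_eq_zero] at h5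
    rw [h5] at h4; simp at h4
  have hU0 : U.map (PP.pi V hV).toRingHom = 0 := by
    by_contra hcon
    exact ih _ hUdeg U hUflat hcon rfl
  have hc := congrArg (fun P => P.coeff r') hU0
  simp only [coeff_map, coeff_zero, U, coeff_sub, coeff_C_mul, hτ1, hτ0] at hc
  set φ : PS := PP.pi V hV (p.coeff (r' + 1)) with hφ
  set χ : PS := PP.pi V hV (p.coeff r') with hχ
  have hc2 : D.e (D.e φ) * (PowerSeries.X ^ (D.q * D.q - 1) * D.e (D.e D.h)) ^ (r' + 1) * χ =
      φ * (D.e (D.e χ) * D.h * (PowerSeries.X ^ (D.q * D.q - 1) * D.e (D.e D.h)) ^ r' +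
        D.e (D.e φ) * (((r' : PS) + 1) * D.A * (PowerSeries.X ^ (D.q * D.q - 1) * D.e (D.e D.h)) ^ r')) := by
    have e1 : PP.pi V hV ah = D.A := rfl
    have e2 : PP.pi V hV hh = D.h := rfl
    have e3 : PP.pi V hV bb = PowerSeries.X ^ (D.q * D.q - 1) * D.e (D.e D.h) := rfl
    have e4 : ∀ i, PP.pi V hV (sg (p.coeff i)) = D.e (D.e (PP.pi V hV (p.coeff i))) := fun _ => rfl
    have this : PP.pi V hV (sg (p.coeff (r' + 1)) * bb ^ (r' + 1) * p.coeff r' -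
      p.coeff (r' + 1) * (sg (p.coeff r') * hh * bb ^ r' + sg (p.coeff (r' + 1)) * (((r' : PP V hV) + 1) * ah * bb ^ r'))) = 0 := hc
    rw [map_sub, map_mul, map_mul, map_mul, map_add, map_mul, map_mul, map_mul, map_mul, map_mul, map_add, map_one, map_natCast,
      map_pow, map_pow, e1, e2, e3, e4, e4, ← hφ, ← hχ] at this
    exact sub_eq_zero.1 this
  exact D.star_fin r' φ χ hlead hc2
end
end FD


namespace SD
open Asymptotics Filter
variable (S : SD)

lemma q_ne : S.q ≠ 0 := by have := S.hq; omega

noncomputable def hz : PowerSeries ℤ := (exists_formal_h S.q S.hq S.q_ne S.A S.A0).choose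

lemma hz0 : PowerSeries.constantCoeff S.hz = 1 := (exists_formal_h S.q S.hq S.q_ne S.A S.A0).choose_spec.1
lemma hz_eq : S.hz = (S.A : PowerSeries ℤ) * PowerSeries.expand S.q S.q_ne S.hz +
    PowerSeries.X ^ (S.q * (S.q - 1)) * PowerSeries.expand S.q S.q_ne (PowerSeries.expand S.q S.q_ne S.hz) :=
  (exists_formal_h S.q S.hq S.q_ne S.A S.A0).choose_spec.2

noncomputable def fd : FD where
  q := S.q
  hq := S.hq
  hq0 := S.q_ne
  A := (S.A : PowerSeries ℤ).map (Int.castRingHom ℂ)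
  A0 := by
    have := S.A0
    rw [← PowerSeries.coeff_zero_eq_constantCoeff_apply, PowerSeries.coeff_map, Polynomial.coeff_coe, this]
    simp
  Adeg := by
    intro n hn
    have : S.A.coeff n = 0 := coeff_eq_zero_of_natDegree_lt (by have := S.Adeg; omega)
    simp [this]
  h := S.hz.map (Int.castRingHom ℂ)
  h0 := by
    have := S.hz0
    rw [← PowerSeries.coeff_zero_eq_constantCoeff_apply, PowerSeries.coeff_map, PowerSeries.coeff_zero_eq_constantCoeff_apply, this]
    simp
  heq := by
    have := congrArg (PowerSeries.map (Int.castRingHom ℂ)) S.hz_eq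
    simpa only [map_add, map_mul, map_pow, PowerSeries.map_X, PowerSeries.map_expand] using this

noncomputable def V (m : ℕ) : ℂ := S.w (2 * m)
noncomputable def Dd : ℂ := S.d 0 / S.w 0

lemma Dd_ne : S.Dd ≠ 0 := div_ne_zero (S.d_ne 0) S.hw0

lemma tt : Tendsto (fun m : ℕ => 2 * m) atTop atTop :=
  tendsto_atTop_mono (fun m => show m ≤ 2 * m by omega) tendsto_id

lemma V_ne (m : ℕ) : S.V m ≠ 0 := S.w_ne _
lemma V_tendsto : Tendsto S.V atTop (nhds 0) := S.w_tendsto.comp tt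
lemma V_bdd : S.V =O[atTop] (fun _ => (1 : ℂ)) := S.V_tendsto.isBigO_one ℂ
lemma V_succ (m : ℕ) : S.V (m + 1) = S.V m ^ (S.q * S.q) := by
  simp only [V]
  rw [show 2 * (m + 1) = 2 * m + 1 + 1 by ring, S.hw, S.hw, ← pow_mul]

lemma d_even (m : ℕ) : S.d (2 * m) = S.Dd * S.V m := by
  induction m with
  | zero => simp only [Dd, V, mul_zero]; exact (div_mul_cancel₀ _ S.hw0).symm
  | succ m ih =>
    rw [V_succ, show 2 * (m + 1) = 2 * m + 1 + 1 by ring, S.d_succ, S.d_succ, ih, S.hw, ← pow_mul]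
    change -S.V m ^ _ * (-S.V m ^ _ * _) = _
    have e : S.q * S.q = S.q * (S.q - 1) + (S.q - 1) + 1 := by
      obtain ⟨k, hk⟩ : ∃ k, S.q = k + 1 := ⟨S.q - 1, by have := S.hq; omega⟩
      rw [hk]; simp; ring
    rw [e]; ring

section
variable {R : Type*} [CommRing R] (ev : ℕ → R →+* ℂ)

lemma rpz : Rp (fun _ => Int.castRingHom ℂ) S.w S.hz S.h := S.rp_h S.hz S.hz0 S.q_ne S.hz_eq
lemma rpz2 : Rp (fun _ => Int.castRingHom ℂ) S.w (PowerSeries.expand S.q S.q_ne S.hz) (fun n => S.h (n + 1)) :=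
  S.rpz.shift S.q S.q_ne (by have := S.hq; omega) S.w_bdd S.hw (fun _ _ => rfl)
lemma rpz3 : Rp (fun _ => Int.castRingHom ℂ) S.w
    (PowerSeries.expand S.q S.q_ne (PowerSeries.expand S.q S.q_ne S.hz)) (fun n => S.h (n + 2)) :=
  S.rpz2.shift S.q S.q_ne (by have := S.hq; omega) S.w_bdd S.hw (fun _ _ => rfl)

lemma rp1 : Rp ev S.V (S.hz.map (Int.castRingHom R)) (fun m => S.h (2 * m)) :=
  (S.rpz.comp (fun m => 2 * m) tt).ofInt ev
lemma rp2 : Rp ev S.V ((PowerSeries.expand S.q S.q_ne S.hz).map (Int.castRingHom R)) (fun m => S.h (2 * m + 1)) :=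
  (S.rpz2.comp (fun m => 2 * m) tt).ofInt ev
lemma rp3 : Rp ev S.V ((PowerSeries.expand S.q S.q_ne (PowerSeries.expand S.q S.q_ne S.hz)).map (Int.castRingHom R))
    (fun m => S.h (2 * m + 2)) :=
  (S.rpz3.comp (fun m => 2 * m) tt).ofInt ev
lemma rpA : Rp ev S.V ((S.A : PowerSeries ℤ).map (Int.castRingHom R)) (fun m => aeval (S.V m) S.A) := by
  have := Rp.ofInt (Rp.ofPoly (ev := fun _ => Int.castRingHom ℂ) (w := S.V) S.A) ev
  simpa only [aeval_def, algebraMap_int_eq] using this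
end

lemma a_bdd : S.a =O[atTop] (fun _ => (1 : ℂ)) := S.hξ1.isBigO_one ℂ

lemma rel0 (n : ℕ) : S.h n * S.a (n + 2) = aeval (S.w n) S.A * S.ξ1 +
    S.w n ^ (S.q * S.q - 1) * S.h (n + 2) * S.a n := by
  have e : S.q * S.q - 1 = S.q * (S.q - 1) + (S.q - 1) := by
    obtain ⟨k, hk⟩ : ∃ k, S.q = k + 1 := ⟨S.q - 1, by have := S.hq; omega⟩
    rw [hk]; simp; ring_nf; omega
  rw [e, pow_add]
  linear_combination S.h n * S.ha n - aeval (S.w n) S.A * S.xi1_eq n + S.w n ^ (S.q - 1) * S.a n * S.h_rec n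

/-- Zariski density of the orbit. -/
theorem dense (h1 : S.ξ1 ≠ 0) (g : MvPolynomial (Fin 4) ℂ)
    (hg : ∀ᶠ m in atTop, MvPolynomial.aeval ![S.V m, S.a (2 * m + 1), S.b (2 * m + 1), S.a (2 * m)] g = 0) :
    g = 0 := by
  have hev : ∀ r : ℂ, (fun n : ℕ => RingHom.id ℂ r) =O[atTop] (fun _ => (1 : ℂ)) :=
    fun r => isBigO_const_const _ one_ne_zero _
  set D := S.fd with hD
  have r1 : Rp (fun _ => RingHom.id ℂ) S.V D.h (fun m => S.h (2 * m)) := S.rp1 _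
  have r2 : Rp (fun _ => RingHom.id ℂ) S.V (D.e D.h) (fun m => S.h (2 * m + 1)) := by
    have := S.rp2 (fun _ => RingHom.id ℂ)
    rw [PowerSeries.map_expand] at this
    exact this
  have r3 : Rp (fun _ => RingHom.id ℂ) S.V (D.e (D.e D.h)) (fun m => S.h (2 * m + 2)) := by
    have := S.rp3 (fun _ => RingHom.id ℂ)
    rw [PowerSeries.map_expand, PowerSeries.map_expand] at this
    exact this
  have rA : Rp (fun _ => RingHom.id ℂ) S.V D.A (fun m => aeval (S.V m) S.A) := S.rpA _
  have ht : Tendsto (fun m => S.h (2 * m)) atTop (nhds 1) := S.h_tendsto.comp tt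
  have hne : ∀ᶠ m in atTop, S.h (2 * m) ≠ 0 := ht.eventually_ne one_ne_zero
  have hinv : D.h * (D.h)⁻¹ = 1 := PowerSeries.mul_inv_cancel _ (by rw [D.h0]; exact one_ne_zero)
  have rI : Rp (fun _ => RingHom.id ℂ) S.V (D.h)⁻¹ (fun m => (S.h (2 * m))⁻¹) :=
    r1.inv hev S.V_bdd hinv ((ht.inv₀ one_ne_zero).isBigO_one ℂ) hne
  let y : ℕ → ℂ := fun m => S.a (2 * m) / S.ξ1
  have hy : y =O[atTop] (fun _ => (1 : ℂ)) :=
    ((S.hξ1.comp tt).div_const S.ξ1).isBigO_one ℂ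
  have rel : ∀ m, S.h (2 * m) * y (m + 1) = aeval (S.V m) S.A + S.V m ^ (D.q * D.q - 1) * S.h (2 * m + 2) * y m := by
    intro m
    have := S.rel0 (2 * m)
    simp only [y]
    field_simp
    rw [mul_comm S.ξ1]
    exact this
  have rX : Rp (fun _ => RingHom.id ℂ) S.V PowerSeries.X S.V := Rp.X
  have fz := D.flat_zero S.V_bdd S.V_tendsto S.V_ne S.V_succ _ _ _ y r1 r3 rA hy rel
  let P := PP S.V S.V_bdd
  let hi : P := ⟨(D.h⁻¹, fun m => (S.h (2 * m))⁻¹), rI⟩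
  let xq : P := ⟨(PowerSeries.X ^ (D.q - 1) * D.e D.h, fun m => S.V m ^ (D.q - 1) * S.h (2 * m + 1)),
    (rX.pow hev S.V_bdd _).mul hev S.V_bdd r2⟩
  let xd : P := ⟨(PowerSeries.C S.Dd * PowerSeries.X ^ D.q * D.e D.h, fun m => S.Dd * S.V m ^ D.q * S.h (2 * m + 1)),
    ((Rp.const (ev := fun _ => RingHom.id ℂ) S.Dd).mul hev S.V_bdd (rX.pow hev S.V_bdd _)).mul hev S.V_bdd r2⟩
  let xx : P := ⟨(PowerSeries.X, S.V), rX⟩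
  let cc : ℂ → P := fun c => ⟨(PowerSeries.C c, fun _ => c), Rp.const (ev := fun _ => RingHom.id ℂ) c⟩
  let ah : P[X] := C hi * (C (cc S.ξ1) * (1 - C xq * X))
  let bh : P[X] := C (cc S.ξ1⁻¹) * (C (cc S.ξ2) * ah - C xd)
  let ch : P[X] := C (cc S.ξ1) * X
  let vh : Fin 4 → P[X] := ![C xx, ah, bh, ch]
  have vsub : ∀ m (p p' : P[X]), PP.val S.V S.V_bdd y m (p - p') = PP.val S.V S.V_bdd y m p - PP.val S.V S.V_bdd y m p' :=
    fun m p p' => map_sub (PP.val S.V S.V_bdd y m) p p'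
  have va : ∀ m, S.h (2 * m) ≠ 0 → PP.val S.V S.V_bdd y m ah = S.a (2 * m + 1) := by
    intro m hm
    have e : PP.val S.V S.V_bdd y m ah = (S.h (2 * m))⁻¹ * (S.ξ1 * (1 - S.V m ^ (D.q - 1) * S.h (2 * m + 1) * y m)) := by
      simp only [ah]
      rw [map_mul, map_mul, vsub, map_mul, map_one, PP.val_C, PP.val_C, PP.val_C, PP.val_X]
      rfl
    rw [e]
    have := S.xi1_eq (2 * m)
    simp only [y]
    field_simp
    change S.ξ1 - S.w (2 * m) ^ (S.q - 1) * S.h (2 * m + 1) * S.a (2 * m) = _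
    linear_combination this
  have vb : ∀ m, S.h (2 * m) ≠ 0 → PP.val S.V S.V_bdd y m bh = S.b (2 * m + 1) := by
    intro m hm
    have e : PP.val S.V S.V_bdd y m bh = S.ξ1⁻¹ * (S.ξ2 * S.a (2 * m + 1) - S.Dd * S.V m ^ D.q * S.h (2 * m + 1)) := by
      simp only [bh]
      rw [map_mul, vsub, map_mul, PP.val_C, PP.val_C, PP.val_C, va m hm]
      rfl
    rw [e]
    have h2 := S.d_h (2 * m + 1)
    rw [S.d_succ, S.d_even] at h2
    have h3 : S.V m ^ D.q = S.w (2 * m) ^ (S.q - 1) * S.V m := by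
      change S.V m ^ S.q = S.V m ^ (S.q - 1) * S.V m
      rw [← pow_succ]; congr 1; have := S.hq; omega
    rw [h3]
    field_simp
    linear_combination h2
  have vc : ∀ m, PP.val S.V S.V_bdd y m ch = S.a (2 * m) := by
    intro m
    have e : PP.val S.V S.V_bdd y m ch = S.ξ1 * y m := by
      simp only [ch]
      rw [map_mul, PP.val_C, PP.val_X]
      rfl
    rw [e]; simp only [y]; field_simp
  have hflat : PP.Flat y (MvPolynomial.aeval vh g) := by
    intro N
    refine (isBigO_zero (fun m => S.V m ^ N) atTop).congr' (f₁ := fun _ => (0 : ℂ)) ?_ EventuallyEq.rfl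
    filter_upwards [hg, hne] with m hm1 hm2
    rw [MvPolynomial.comp_aeval_apply, ← hm1]
    congr 2
    funext i
    fin_cases i
    · change S.V m = PP.val S.V S.V_bdd y m (C xx)
      rw [PP.val_C]; rfl
    · exact (va m hm2).symm
    · exact (vb m hm2).symm
    · exact (vc m).symm
  have hz := fz _ hflat
  have hz2 : (mapAlgHom (PP.pi S.V S.V_bdd)) (MvPolynomial.aeval vh g) = 0 := hz
  rw [MvPolynomial.comp_aeval_apply] at hz2
  let M := mapAlgHom (PP.pi S.V S.V_bdd)
  have MC : ∀ c : P, M (C c) = C c.1.1 := by intro c; simp [M]; rfl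
  have Msub : ∀ p p' : P[X], M (p - p') = M p - M p' := fun p p' => map_sub M p p'
  have MX : M X = X := by simp [M]
  have Ma : M ah = C (D.h⁻¹) * (C (PowerSeries.C S.ξ1) * (1 - C (PowerSeries.X ^ (D.q - 1) * D.e D.h) * X)) := by
    simp only [ah]
    rw [map_mul, map_mul, Msub, map_mul, map_one, MC, MC, MC, MX]
  have hind := D.indep_abc S.ξ1 S.ξ2 S.Dd h1 S.Dd_ne (M ah) (M bh) (M ch) (by
      rw [Ma, ← mul_assoc, ← C_mul, hinv, C_1, one_mul]) (by
      simp only [bh]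
      rw [map_mul, Msub, map_mul, MC, MC, MC, ← mul_assoc, ← C_mul, ← map_mul, mul_inv_cancel₀ h1]
      simp only [map_one, one_mul, cc, xd]) (by
      simp only [ch]
      rw [map_mul, MC, MX])
  apply hind
  rw [map_zero, ← hz2]
  congr 2
  funext i
  fin_cases i
  · exact (MC xx).symm
  · rfl
  · rfl
  · rfl
end SD


section Liouville
variable {K : Type*} [Field K] [NumberField K]
open NumberField

/-- `y` has denominator dividing `L ^ s` and house at most `L ^ s`. -/
def Sz (L s : ℕ) (y : K) : Prop := IsIntegral ℤ ((L : K) ^ s * y) ∧ house y ≤ (L : ℝ) ^ s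

lemma house_one_le : house (1 : K) ≤ 1 := by
  have := house_intCast (K := K) 1
  simp at this
  exact this.le

lemma house_zero_eq : house (0 : K) = 0 := by
  have := house_intCast (K := K) 0
  simpa using this

lemma isIntegral_natCast' (n : ℕ) : IsIntegral ℤ (n : K) := by
  have := isIntegral_algebraMap (R := ℤ) (A := K) (x := (n : ℤ))
  simpa using this

lemma Sz.mono {L s s' : ℕ} {y : K} (hL : 1 ≤ L) (h : Sz L s y) (hs : s ≤ s') : Sz L s' y := by
  refine ⟨?_, h.2.trans (pow_le_pow_right₀ (by exact_mod_cast hL) hs)⟩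
  have := ((isIntegral_natCast' (K := K) L).pow (s' - s)).mul h.1
  rw [← mul_assoc, ← pow_add, Nat.sub_add_cancel hs] at this
  exact this

lemma Sz.dvd {L L' s : ℕ} {y : K} (hL : 1 ≤ L') (h : Sz L s y) (hd : L ∣ L') : Sz L' s y := by
  refine ⟨?_, h.2.trans (pow_le_pow_left₀ (by positivity) (by exact_mod_cast Nat.le_of_dvd hL hd) _)⟩
  obtain ⟨e, rfl⟩ := hd
  have := ((isIntegral_natCast' (K := K) e).pow s).mul h.1
  have e2 : ((L * e : ℕ) : K) ^ s * y = (e : K) ^ s * ((L : K) ^ s * y) := by push_cast; ring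
  rw [e2]; exact this

lemma Sz.mul {L s s' : ℕ} {y y' : K} (h : Sz L s y) (h' : Sz L s' y') : Sz L (s + s') (y * y') := by
  refine ⟨?_, ?_⟩
  · have := h.1.mul h'.1
    have e2 : (L : K) ^ (s + s') * (y * y') = (L : K) ^ s * y * ((L : K) ^ s' * y') := by ring
    rw [e2]; exact this
  · rw [pow_add]
    exact (house_mul_le _ _).trans (mul_le_mul h.2 h'.2 (house_nonneg _) (by positivity))

lemma Sz.one {L : ℕ} : Sz L 0 (1 : K) := ⟨by simpa using isIntegral_one, by simpa using house_one_le⟩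

lemma Sz.pow {L s : ℕ} {y : K} (h : Sz L s y) (n : ℕ) : Sz L (n * s) (y ^ n) := by
  induction n with
  | zero => simpa using Sz.one
  | succ n ih => rw [pow_succ, Nat.succ_mul]; exact ih.mul h

lemma Sz.sum {ι : Type*} {L s : ℕ} (hL : 2 ≤ L) (t : Finset ι) (f : ι → K) (h : ∀ i ∈ t, Sz L s (f i)) :
    Sz L (t.card + s) (∑ i ∈ t, f i) := by
  refine ⟨?_, ?_⟩
  · have h1 : IsIntegral ℤ (∑ i ∈ t, (L : K) ^ s * f i) := IsIntegral.sum _ (fun i hi => (h i hi).1)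
    have := ((isIntegral_natCast' (K := K) L).pow t.card).mul h1
    rw [← Finset.mul_sum, ← mul_assoc, ← pow_add] at this
    exact this
  · refine (house_sum_le_sum_house _ _).trans ((Finset.sum_le_card_nsmul t _ ((L : ℝ) ^ s) (fun i hi => (h i hi).2)).trans ?_)
    rw [nsmul_eq_mul, pow_add]
    gcongr
    have : t.card < L ^ t.card := Nat.lt_pow_self (by omega)
    exact_mod_cast this.le

lemma Sz.add {L s : ℕ} (hL : 2 ≤ L) {y y' : K} (h : Sz L s y) (h' : Sz L s y') : Sz L (s + 1) (y + y') := by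
  refine ⟨?_, ?_⟩
  · have := (isIntegral_natCast' (K := K) L).mul (h.1.add h'.1)
    have e2 : (L : K) ^ (s + 1) * (y + y') = (L : K) * ((L : K) ^ s * y + (L : K) ^ s * y') := by ring
    rw [e2]; exact this
  · refine (house_add_le _ _).trans ((add_le_add h.2 h'.2).trans ?_)
    rw [pow_succ]
    have : (2 : ℝ) ≤ L := by exact_mod_cast hL
    have h3 : (0 : ℝ) ≤ (L : ℝ) ^ s := by positivity
    nlinarith

lemma exists_den (s : Finset K) : ∃ N : ℕ, N ≠ 0 ∧ ∀ y ∈ s, IsIntegral ℤ ((N : K) * y) := by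
  obtain ⟨d, hd, hi⟩ := exists_integral_multiples ℤ ℚ s
  refine ⟨d.natAbs, by simpa using hd, fun y hy => ?_⟩
  have h1 : IsIntegral ℤ ((d : K) * y) := by simpa using hi y hy
  rcases Int.natAbs_eq d with h | h
  · have e : ((d.natAbs : ℕ) : K) = (d : K) := by
      conv_rhs => rw [h]
      simp
    rw [e]; exact h1
  · have e : ((d.natAbs : ℕ) : K) = -(d : K) := by
      conv_rhs => rw [h]
      simp
    rw [e, neg_mul]; exact h1.neg

lemma Sz.exists (y : K) : ∃ L : ℕ, 2 ≤ L ∧ Sz L 1 y := by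
  obtain ⟨N, hN, hi⟩ := exists_den {y}
  have hi := hi y (by simp)
  obtain ⟨M, hM⟩ := exists_nat_ge (house y)
  have hN1 : 1 ≤ N := Nat.one_le_iff_ne_zero.2 hN
  refine ⟨N * (M + 2), by nlinarith, ?_, ?_⟩
  · have := (isIntegral_natCast' (K := K) (M + 2)).mul hi
    have e2 : ((N * (M + 2) : ℕ) : K) ^ 1 * y = ((M + 2 : ℕ) : K) * ((N : K) * y) := by push_cast; ring
    rw [e2]; exact this
  · refine hM.trans ?_
    rw [pow_one]
    have : M ≤ N * (M + 2) := by nlinarith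
    exact_mod_cast this

lemma Sz.lower {L s : ℕ} (hL : 1 ≤ L) {y : K} (h : Sz L s y) (hy : y ≠ 0) (σ : K →+* ℂ) :
    1 ≤ ((L : ℝ) ^ (2 * Module.finrank ℚ K)) ^ s * ‖σ y‖ := by
  set z : K := (L : K) ^ s * y with hz
  have hz0 : z ≠ 0 := mul_ne_zero (pow_ne_zero _ (by exact_mod_cast (by omega : L ≠ 0))) hy
  have hn : (1 : ℝ) ≤ ‖Algebra.norm ℚ z‖ := by
    have hi : IsIntegral ℤ (Algebra.norm ℚ z) := Algebra.isIntegral_norm ℚ h.1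
    obtain ⟨m, hm⟩ := IsIntegrallyClosed.isIntegral_iff.1 hi
    have hne : Algebra.norm ℚ z ≠ 0 := Algebra.norm_ne_zero_iff.2 hz0
    rw [← hm] at hne ⊢
    have hm0 : m ≠ 0 := by rintro rfl; simp at hne
    have : (1 : ℝ) ≤ |(m : ℝ)| := by exact_mod_cast Int.one_le_abs hm0
    simpa [Int.norm_eq_abs] using this
  have h1 := hn.trans (norm_norm_le_norm_mul_house_pow z σ)
  have hf : 0 < Module.finrank ℚ K := Module.finrank_pos
  have hhz : house z ≤ (L : ℝ) ^ (2 * s) := by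
    have : house z = (L : ℝ) ^ s * house y := by
      have := house_nat_mul y (L ^ s)
      push_cast at this
      exact this
    rw [this, two_mul, pow_add]
    gcongr
    exact h.2
  have hσ : ‖σ z‖ = (L : ℝ) ^ s * ‖σ y‖ := by
    rw [hz, map_mul, norm_mul, map_pow, map_natCast, norm_pow, Complex.norm_natCast]
  refine h1.trans ?_
  have hL1 : (1 : ℝ) ≤ L := by exact_mod_cast hL
  calc ‖σ z‖ * house z ^ (Module.finrank ℚ K - 1)
      ≤ ((L : ℝ) ^ s * ‖σ y‖) * ((L : ℝ) ^ (2 * s)) ^ (Module.finrank ℚ K - 1) := by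
        rw [hσ]
        have := house_nonneg z
        gcongr
    _ = (L : ℝ) ^ (s + 2 * s * (Module.finrank ℚ K - 1)) * ‖σ y‖ := by rw [pow_add, pow_mul (L : ℝ) (2 * s)]; ring
    _ ≤ (L : ℝ) ^ (2 * Module.finrank ℚ K * s) * ‖σ y‖ := by
        gcongr
        obtain ⟨e, he⟩ : ∃ e, Module.finrank ℚ K = e + 1 := ⟨_, (Nat.succ_pred_eq_of_pos hf).symm⟩
        rw [he]; simp; nlinarith
    _ = _ := by rw [pow_mul]

lemma Sz.ofInt {L : ℕ} (hL : 2 ≤ L) (m : ℤ) : Sz L m.natAbs (m : K) := by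
  refine ⟨((isIntegral_natCast' (K := K) L).pow _).mul (isIntegral_algebraMap (R := ℤ) (A := K) (x := m)), ?_⟩
  rw [house_intCast]
  have h1 : m.natAbs < L ^ m.natAbs := Nat.lt_pow_self (by omega)
  have : ((m.natAbs : ℕ) : ℝ) ≤ (L : ℝ) ^ m.natAbs := by exact_mod_cast h1.le
  simpa [Nat.cast_natAbs] using this

lemma w_Sz {L q : ℕ} (w : ℕ → K) (hw : ∀ n, w (n + 1) = w n ^ q) (h0 : Sz L 1 (w 0)) (n : ℕ) :
    Sz L (q ^ n) (w n) := by
  induction n with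
  | zero => simpa using h0
  | succ n ih => rw [hw, pow_succ, mul_comm]; exact ih.pow q

lemma A_Sz {L q : ℕ} (hL : 2 ≤ L) (hq : 2 ≤ q) (A : ℤ[X]) (Adeg : A.natDegree + 2 ≤ q) : ∃ c : ℕ, ∀ (w : K) (s : ℕ),
    Sz L s w → Sz L (c + (q - 2) * s) (aeval w A) := by
  refine ⟨(A.natDegree + 1) + ∑ i ∈ Finset.range (A.natDegree + 1), (A.coeff i).natAbs, fun w s h => ?_⟩
  rw [aeval_eq_sum_range]
  have := Sz.sum (s := (∑ i ∈ Finset.range (A.natDegree + 1), (A.coeff i).natAbs) + (q - 2) * s) hL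
    (Finset.range (A.natDegree + 1)) (fun i => A.coeff i • w ^ i) (fun i hi => ?_)
  · rw [Finset.card_range, ← add_assoc] at this
    exact this
  · rw [zsmul_eq_mul]
    refine ((Sz.ofInt hL _).mul (h.pow i)).mono (by omega) (add_le_add ?_ ?_)
    · exact Finset.single_le_sum (f := fun i => (A.coeff i).natAbs) (fun _ _ => Nat.zero_le _) hi
    · apply Nat.mul_le_mul_right
      have := Finset.mem_range.1 hi
      omega

lemma u_Sz {L q : ℕ} (hL : 2 ≤ L) (hq : 2 ≤ q) (A : ℤ[X]) (Adeg : A.natDegree + 2 ≤ q)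
    (w : ℕ → K) (hw : ∀ n, w (n + 1) = w n ^ q) (h0 : Sz L 1 (w 0)) : ∃ C : ℕ, 1 ≤ C ∧ ∀ u : ℕ → K,
    (∀ n, u (n + 2) = aeval (w n) A * u (n + 1) + w n ^ (q - 1) * u n) →
    Sz L 1 (u 0) → Sz L 1 (u 1) → ∀ n, Sz L (C * q ^ n) (u n) ∧ Sz L (C * q ^ (n + 1)) (u (n + 1)) := by
  obtain ⟨c, hc⟩ := A_Sz (K := K) hL hq A Adeg
  refine ⟨c + q + 1, by omega, fun u hu u0 u1 n => ?_⟩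
  induction n with
  | zero =>
    refine ⟨u0.mono (by omega) (by simp), u1.mono (by omega) ?_⟩
    simp; nlinarith
  | succ n ih =>
    refine ⟨ih.2, ?_⟩
    rw [show n + 1 + 1 = n + 2 from rfl, hu]
    have hn : 1 ≤ q ^ n := Nat.one_le_pow _ _ (by omega)
    have e1 : q ^ (n + 1) = q * q ^ n := by ring
    have e2 : q ^ (n + 2) = q * (q * q ^ n) := by ring
    have hwn := w_Sz w hw h0 n
    set Q := q ^ n
    obtain ⟨r, rfl⟩ : ∃ r, q = r + 2 := ⟨q - 2, by omega⟩
    have t1 := ((hc _ _ hwn).mul ih.2)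
    have t2 := ((hwn.pow (r + 2 - 1)).mul ih.1)
    rw [e1] at t1
    rw [e2]
    have g1 : c + (r + 2 - 2) * Q + (c + (r + 2) + 1) * ((r + 2) * Q) ≤
        (c + (r + 2) + 1) * ((r + 2) * ((r + 2) * Q)) - 1 := by
      apply Nat.le_sub_of_add_le
      simp only [Nat.add_sub_cancel]
      have : c ≤ c * Q := Nat.le_mul_of_pos_right _ hn
      nlinarith [Nat.zero_le (c * r * Q), Nat.zero_le (c * r ^ 2 * Q), Nat.zero_le (r * Q), Nat.zero_le (r ^ 2 * Q), Nat.zero_le (r ^ 3 * Q)]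
    have g2 : (r + 2 - 1) * Q + (c + (r + 2) + 1) * Q ≤
        (c + (r + 2) + 1) * ((r + 2) * ((r + 2) * Q)) - 1 := by
      apply Nat.le_sub_of_add_le
      rw [show r + 2 - 1 = r + 1 from rfl]
      nlinarith [Nat.zero_le (c * Q), Nat.zero_le (c * r * Q), Nat.zero_le (c * r ^ 2 * Q), Nat.zero_le (r * Q), Nat.zero_le (r ^ 2 * Q), Nat.zero_le (r ^ 3 * Q)]
    refine ((t1.mono (by omega) g1).add hL (t2.mono (by omega) g2)).mono (by omega) ?_
    have : 1 ≤ (c + (r + 2) + 1) * ((r + 2) * ((r + 2) * Q)) := Nat.one_le_iff_ne_zero.2 (by positivity)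
    omega

/-- Liouville-type lower bound. -/
theorem liouville {q : ℕ} (hq : 2 ≤ q) (A : ℤ[X]) (Adeg : A.natDegree + 2 ≤ q)
    (w : ℕ → K) (hw : ∀ n, w (n + 1) = w n ^ q) (a b : ℕ → K)
    (ha : ∀ n, a (n + 2) = aeval (w n) A * a (n + 1) + w n ^ (q - 1) * a n)
    (hb : ∀ n, b (n + 2) = aeval (w n) A * b (n + 1) + w n ^ (q - 1) * b n) (σ : K →+* ℂ) :
    ∃ Λ : ℝ, 1 ≤ Λ ∧ ∀ G : MvPolynomial (Fin 4) K, ∃ c : ℝ, ∀ n,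
      MvPolynomial.eval ![w n, a (n + 1), b (n + 1), a n] G ≠ 0 →
      1 ≤ c * Λ ^ (G.totalDegree * q ^ n) *
        ‖σ (MvPolynomial.eval ![w n, a (n + 1), b (n + 1), a n] G)‖ := by
  classical
  obtain ⟨L0, l0, s0⟩ := Sz.exists (w 0)
  obtain ⟨L1, l1, s1⟩ := Sz.exists (a 0)
  obtain ⟨L2, l2, s2⟩ := Sz.exists (a 1)
  obtain ⟨L3, l3, s3⟩ := Sz.exists (b 0)
  obtain ⟨L4, l4, s4⟩ := Sz.exists (b 1)
  obtain ⟨L, hLdef⟩ : ∃ L, L = L0 * L1 * L2 * L3 * L4 := ⟨_, rfl⟩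
  have hL1 : 1 ≤ L := by rw [hLdef]; exact Nat.one_le_iff_ne_zero.2 (by positivity)
  have d0 : L0 ∣ L := ⟨L1 * L2 * L3 * L4, by rw [hLdef]; ring⟩
  have d1 : L1 ∣ L := ⟨L0 * L2 * L3 * L4, by rw [hLdef]; ring⟩
  have d2 : L2 ∣ L := ⟨L0 * L1 * L3 * L4, by rw [hLdef]; ring⟩
  have d3 : L3 ∣ L := ⟨L0 * L1 * L2 * L4, by rw [hLdef]; ring⟩
  have d4 : L4 ∣ L := ⟨L0 * L1 * L2 * L3, by rw [hLdef]; ring⟩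
  have hL : 2 ≤ L := l0.trans (Nat.le_of_dvd hL1 d0)
  have hw0 := s0.dvd hL1 d0
  obtain ⟨C, hC1, hC⟩ := u_Sz hL hq A Adeg w hw hw0
  have za := hC a ha (s1.dvd hL1 d1) (s2.dvd hL1 d2)
  have zb := hC b hb (s3.dvd hL1 d3) (s4.dvd hL1 d4)
  have hLR : (1 : ℝ) ≤ L := by exact_mod_cast hL1
  set B : ℝ := (L : ℝ) ^ (2 * Module.finrank ℚ K) with hB
  have hB1 : 1 ≤ B := one_le_pow₀ hLR
  refine ⟨B ^ (C * q), one_le_pow₀ hB1, fun G => ?_⟩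
  obtain ⟨N, hN, hNi⟩ := exists_den (G.support.image G.coeff)
  obtain ⟨M, hM⟩ : ∃ M : ℕ, ∀ μ ∈ G.support, Sz L M ((N : K) * G.coeff μ) := by
    refine ⟨∑ μ ∈ G.support, (Nat.ceil (house ((N : K) * G.coeff μ))), fun μ hμ => ?_⟩
    have h1 : Sz L (Nat.ceil (house ((N : K) * G.coeff μ))) ((N : K) * G.coeff μ) := by
      refine ⟨((isIntegral_natCast' (K := K) L).pow _).mul (hNi _ (Finset.mem_image_of_mem _ hμ)), ?_⟩
      refine (Nat.le_ceil _).trans ?_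
      have := (Nat.lt_pow_self (n := Nat.ceil (house ((N : K) * G.coeff μ))) (by omega : 1 < L)).le
      exact_mod_cast this
    exact h1.mono hL1 (Finset.single_le_sum (f := fun μ => Nat.ceil (house ((N : K) * G.coeff μ))) (fun _ _ => Nat.zero_le _) hμ)
  refine ⟨B ^ (G.support.card + M) * N, fun n hne => ?_⟩
  set x : Fin 4 → K := ![w n, a (n + 1), b (n + 1), a n] with hx
  have hxz : ∀ i, Sz L (C * q ^ (n + 1)) (x i) := by
    have hqn : q ^ n ≤ q ^ (n + 1) := Nat.pow_le_pow_right (by omega) (by omega)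
    intro i
    fin_cases i
    · exact (w_Sz w hw hw0 n).mono hL1 (hqn.trans (Nat.le_mul_of_pos_left _ hC1))
    · exact (za n).2
    · exact (zb n).2
    · exact (za n).1.mono hL1 (Nat.mul_le_mul_left _ hqn)
  have hy : Sz L (G.support.card + (M + G.totalDegree * (C * q ^ (n + 1)))) ((N : K) * MvPolynomial.eval x G) := by
    rw [MvPolynomial.eval_eq, Finset.mul_sum]
    refine Sz.sum hL _ _ (fun μ hμ => ?_)
    rw [← mul_assoc (N : K)]
    refine (hM μ hμ).mul ?_
    have hp : ∀ s : Finset (Fin 4), Sz L ((∑ i ∈ s, μ i) * (C * q ^ (n + 1))) (∏ i ∈ s, x i ^ μ i) := by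
      intro s
      classical
      induction s using Finset.induction_on with
      | empty => simpa using Sz.one
      | insert i s hi ih =>
        rw [Finset.sum_insert hi, Finset.prod_insert hi, add_mul]
        exact ((hxz i).pow _).mul ih
    refine (hp _).mono hL1 (Nat.mul_le_mul_right _ ?_)
    have := MvPolynomial.le_totalDegree hμ
    rwa [Finsupp.sum] at this
  have hfin := hy.lower hL1 (mul_ne_zero (by exact_mod_cast hN) hne) σ
  rw [map_mul, norm_mul, map_natCast, Complex.norm_natCast] at hfin
  refine hfin.trans (le_of_eq ?_)
  rw [← hB, ← pow_mul B (C * q), show C * q * (G.totalDegree * q ^ n) = G.totalDegree * (C * q ^ (n + 1)) by ring]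
  rw [← add_assoc, pow_add B (_ + _)]
  ring

end Liouville


section Aux
variable {K : Type*} [Field K]

/-- bounded degree of coefficients -/
def DL (e : ℕ) (φ : PowerSeries (MvPolynomial (Fin 3) K)) : Prop :=
  ∀ n, (PowerSeries.coeff n φ).totalDegree ≤ e

lemma DL.mono {e e' : ℕ} {φ : PowerSeries (MvPolynomial (Fin 3) K)} (h : DL e φ) (he : e ≤ e') : DL e' φ :=
  fun n => (h n).trans he

lemma DL.add {e : ℕ} {φ ψ : PowerSeries (MvPolynomial (Fin 3) K)} (h : DL e φ) (h' : DL e ψ) : DL e (φ + ψ) := by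
  intro n
  rw [map_add]
  exact (MvPolynomial.totalDegree_add _ _).trans (max_le (h n) (h' n))

lemma DL.mul {e e' : ℕ} {φ ψ : PowerSeries (MvPolynomial (Fin 3) K)} (h : DL e φ) (h' : DL e' ψ) :
    DL (e + e') (φ * ψ) := by
  intro n
  rw [PowerSeries.coeff_mul]
  refine MvPolynomial.totalDegree_finsetSum_le (fun i _ => ?_)
  exact (MvPolynomial.totalDegree_mul _ _).trans (add_le_add (h _) (h' _))

lemma DL.const (r : MvPolynomial (Fin 3) K) : DL r.totalDegree (PowerSeries.C r) := by
  intro n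
  rw [PowerSeries.coeff_C]
  split_ifs
  · exact le_rfl
  · simp

lemma DL.one : DL 0 (1 : PowerSeries (MvPolynomial (Fin 3) K)) := by
  have := DL.const (K := K) 1
  simpa using this

lemma DL.X_pow (k : ℕ) : DL 0 (PowerSeries.X ^ k : PowerSeries (MvPolynomial (Fin 3) K)) := by
  intro n
  rw [PowerSeries.coeff_X_pow]
  split_ifs <;> simp

lemma DL.pow {e : ℕ} {φ : PowerSeries (MvPolynomial (Fin 3) K)} (h : DL e φ) (k : ℕ) : DL (k * e) (φ ^ k) := by
  induction k with
  | zero => simpa using DL.one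
  | succ k ih => rw [pow_succ, Nat.succ_mul]; exact ih.mul h

/-- the natural map from polynomials in four variables to power series -/
noncomputable def toPS : MvPolynomial (Fin 4) K →ₐ[K] PowerSeries (MvPolynomial (Fin 3) K) :=
  MvPolynomial.aeval ![PowerSeries.X, PowerSeries.C (MvPolynomial.X 0), PowerSeries.C (MvPolynomial.X 1),
    PowerSeries.C (MvPolynomial.X 2)]

noncomputable def mon {δ : ℕ} (μ : Fin 4 → Fin δ) : Fin 4 →₀ ℕ :=
  Finsupp.equivFunOnFinite.symm (fun i => (μ i : ℕ))

lemma mon_inj {δ : ℕ} : Function.Injective (mon (δ := δ)) := by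
  intro μ ν h
  have := Finsupp.equivFunOnFinite.symm.injective h
  funext i
  exact Fin.ext (congrFun this i)

lemma toPS_mon {δ : ℕ} (μ : Fin 4 → Fin δ) :
    DL (3 * δ) (toPS (MvPolynomial.monomial (mon μ) (1 : K))) := by
  have e : toPS (MvPolynomial.monomial (mon μ) (1 : K)) = PowerSeries.X ^ (μ 0 : ℕ) *
      PowerSeries.C (MvPolynomial.X 0) ^ (μ 1 : ℕ) * PowerSeries.C (MvPolynomial.X 1) ^ (μ 2 : ℕ) *
      PowerSeries.C (MvPolynomial.X 2) ^ (μ 3 : ℕ) := by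
    rw [toPS, MvPolynomial.aeval_monomial, map_one, one_mul, Finsupp.prod_fintype _ _ (by simp), Fin.prod_univ_four]
    rfl
  rw [e]
  have hc : ∀ i : Fin 3, DL 1 (PowerSeries.C (MvPolynomial.X i : MvPolynomial (Fin 3) K)) := fun i =>
    (DL.const _).mono (by simp)
  refine ((((DL.X_pow _).mul ((hc 0).pow _)).mul ((hc 1).pow _)).mul ((hc 2).pow _)).mono ?_
  have := (μ 1).2
  have := (μ 2).2
  have := (μ 3).2
  omega

/-- Auxiliary functions (Thue-Siegel linear algebra, without heights). -/
theorem aux_exists (E : PowerSeries (MvPolynomial (Fin 3) K)) (e : ℕ) (hE : DL e E) (g : ℕ) (hg : 1 ≤ g) :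
    ∃ δ : ℕ, 1 ≤ δ ∧ ∃ F : Fin (δ + 1) → MvPolynomial (Fin 4) K, F ≠ 0 ∧ (∀ j, (F j).totalDegree ≤ 4 * δ) ∧
      PowerSeries.X ^ (δ * g) ∣ ∑ j, toPS (F j) * E ^ (j : ℕ) := by
  classical
  set δ := g * (4 + e) ^ 3 with hδ
  have hδ1 : 1 ≤ δ := Nat.one_le_iff_ne_zero.2 (by positivity)
  refine ⟨δ, hδ1, ?_⟩
  let M := (3 + e) * δ + 1
  let v : Fin (δ + 1) × (Fin 4 → Fin δ) → PowerSeries (MvPolynomial (Fin 3) K) := fun p =>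
    toPS (MvPolynomial.monomial (mon p.2) (1 : K)) * E ^ (p.1 : ℕ)
  have hv : ∀ p, DL ((3 + e) * δ) (v p) := by
    intro p
    refine ((toPS_mon p.2).mul (hE.pow _)).mono ?_
    have := p.1.2
    nlinarith
  let v' : Fin (δ + 1) × (Fin 4 → Fin δ) → (Fin (δ * g) × (Fin 3 → Fin M) → K) := fun p r =>
    (PowerSeries.coeff (r.1 : ℕ) (v p)).coeff (Finsupp.equivFunOnFinite.symm (fun i => (r.2 i : ℕ)))
  have hdep : ¬ LinearIndependent K v' := by
    intro h
    have := h.fintype_card_le_finrank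
    rw [Module.finrank_fintype_fun_eq_card] at this
    simp only [Fintype.card_prod, Fintype.card_fin, Fintype.card_fun] at this
    have hM : M ≤ (4 + e) * δ := by simp only [M]; nlinarith
    have h2 : δ * g * M ^ 3 ≤ δ * g * ((4 + e) * δ) ^ 3 := by gcongr
    have h3 : δ * g * ((4 + e) * δ) ^ 3 = δ * δ ^ 4 := by
      rw [mul_pow]
      calc δ * g * ((4 + e) ^ 3 * δ ^ 3) = δ * (g * (4 + e) ^ 3) * δ ^ 3 := by ring
        _ = _ := by rw [← hδ]; ring
    have h4 : 0 < δ ^ 4 := by positivity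
    nlinarith
  rw [Fintype.not_linearIndependent_iff] at hdep
  obtain ⟨c, hc, p0, hp0⟩ := hdep
  let F : Fin (δ + 1) → MvPolynomial (Fin 4) K := fun j => ∑ μ, MvPolynomial.monomial (mon μ) (c (j, μ))
  have hcoeff : ∀ j μ, (F j).coeff (mon μ) = c (j, μ) := by
    intro j μ
    simp only [F, MvPolynomial.coeff_sum, MvPolynomial.coeff_monomial]
    rw [Finset.sum_eq_single μ]
    · simp
    · intro ν _ hν
      rw [if_neg (fun h => hν (mon_inj h))]
    · simp
  refine ⟨F, ?_, ?_, ?_⟩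
  · intro h
    apply hp0
    rw [← Prod.mk.eta (p := p0), ← hcoeff, h]
    simp
  · intro j
    refine MvPolynomial.totalDegree_finsetSum_le (fun μ _ => ?_)
    refine (MvPolynomial.totalDegree_monomial_le _ _).trans ?_
    rw [Finsupp.sum_fintype _ _ (by simp), Fin.sum_univ_four]
    have h0 := (μ 0).2
    have h1 := (μ 1).2
    have h2 := (μ 2).2
    have h3 := (μ 3).2
    change (μ 0 : ℕ) + (μ 1 : ℕ) + (μ 2 : ℕ) + (μ 3 : ℕ) ≤ _
    omega
  · have hsum : ∑ j, toPS (F j) * E ^ (j : ℕ) = ∑ p, c p • v p := by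
      rw [Fintype.sum_prod_type]
      refine Finset.sum_congr rfl (fun j _ => ?_)
      simp only [F, map_sum, Finset.sum_mul, v]
      refine Finset.sum_congr rfl (fun μ _ => ?_)
      rw [← smul_mul_assoc, ← map_smul, MvPolynomial.smul_monomial, smul_eq_mul, mul_one]
    rw [hsum, PowerSeries.X_pow_dvd_iff]
    intro m hm
    ext ν
    rw [map_sum, MvPolynomial.coeff_sum, MvPolynomial.coeff_zero]
    by_cases hν : ∀ i, ν i < M
    · have := congrFun hc (⟨m, hm⟩, fun i => ⟨ν i, hν i⟩)
      rw [Finset.sum_apply] at this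
      simp only [Pi.smul_apply, Pi.zero_apply, v', smul_eq_mul] at this
      rw [← this]
      refine Finset.sum_congr rfl (fun p _ => ?_)
      rw [PowerSeries.coeff_smul, MvPolynomial.coeff_smul, smul_eq_mul]
      congr 2
      ext i; rfl
    · push Not at hν
      obtain ⟨i, hi⟩ := hν
      refine Finset.sum_eq_zero (fun p _ => ?_)
      rw [PowerSeries.coeff_smul, MvPolynomial.coeff_smul, smul_eq_mul]
      rw [MvPolynomial.coeff_eq_zero_of_totalDegree_lt, mul_zero]
      refine lt_of_le_of_lt (hv p m) ?_
      have h5 : ν i ≤ ∑ i ∈ ν.support, ν i := by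
        by_cases h6 : i ∈ ν.support
        · exact Finset.single_le_sum (f := fun i => ν i) (fun _ _ => Nat.zero_le _) h6
        · rw [Finsupp.notMem_support_iff.1 h6]; exact Nat.zero_le _
      simp only [M] at hi
      omega

end Aux


section Core
open Asymptotics Filter
variable {K : Type*} [Field K]

/-- evaluation map -/
noncomputable def evm (σ : K →+* ℂ) (x : ℕ → Fin 3 → ℂ) (m : ℕ) : MvPolynomial (Fin 3) K →+* ℂ :=
  MvPolynomial.eval₂Hom σ (x m)

lemma evm_bdd (σ : K →+* ℂ) (x : ℕ → Fin 3 → ℂ) (hx : ∀ i, (fun m => x m i) =O[atTop] (fun _ => (1 : ℂ)))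
    (r : MvPolynomial (Fin 3) K) : (fun m => evm σ x m r) =O[atTop] (fun _ => (1 : ℂ)) := by
  induction r using MvPolynomial.induction_on with
  | C a => simp only [evm, MvPolynomial.eval₂Hom_C]; exact isBigO_const_const _ one_ne_zero _
  | add p q hp hq => simp only [map_add]; exact hp.add hq
  | mul_X p i hp =>
    simp only [map_mul]
    have : (fun m => evm σ x m (MvPolynomial.X i)) =O[atTop] (fun _ => (1 : ℂ)) := by
      simp only [evm, MvPolynomial.eval₂Hom_X']; exact hx i
    simpa using hp.mul this

lemma rp_toPS (σ : K →+* ℂ) (x : ℕ → Fin 3 → ℂ) (hx : ∀ i, (fun m => x m i) =O[atTop] (fun _ => (1 : ℂ)))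
    (V : ℕ → ℂ) (hV : V =O[atTop] (fun _ => (1 : ℂ))) (F : MvPolynomial (Fin 4) K) :
    Rp (evm σ x) V (toPS F) (fun m => MvPolynomial.eval₂ σ ![V m, x m 0, x m 1, x m 2] F) := by
  induction F using MvPolynomial.induction_on with
  | C a =>
    have := Rp.const (ev := evm σ x) (w := V) (MvPolynomial.C a)
    simp only [evm, MvPolynomial.eval₂Hom_C] at this
    simp only [toPS, MvPolynomial.aeval_C, MvPolynomial.eval₂_C]
    rw [PowerSeries.algebraMap_apply, MvPolynomial.algebraMap_eq]
    exact this
  | add p q hp hq => simp only [map_add, MvPolynomial.eval₂_add]; exact hp.add hq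
  | mul_X p i hp =>
    simp only [map_mul, MvPolynomial.eval₂_mul]
    refine hp.mul (evm_bdd σ x hx) hV ?_
    simp only [toPS, MvPolynomial.aeval_X, MvPolynomial.eval₂_X]
    have hc : ∀ i, Rp (evm σ x) V (PowerSeries.C (MvPolynomial.X i)) (fun m => x m i) := by
      intro i
      have := Rp.const (ev := evm σ x) (w := V) (MvPolynomial.X i)
      simpa only [evm, MvPolynomial.eval₂Hom_X'] using this
    fin_cases i
    · exact Rp.X
    · exact hc 0
    · exact hc 1
    · exact hc 2

lemma DL.ofInt (φ : PowerSeries ℤ) : DL 0 (φ.map (Int.castRingHom (MvPolynomial (Fin 3) K))) := by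
  intro n
  rw [PowerSeries.coeff_map]
  have : Int.castRingHom (MvPolynomial (Fin 3) K) (PowerSeries.coeff n φ) = MvPolynomial.C ((PowerSeries.coeff n φ : ℤ) : K) := by
    simp
  rw [this, MvPolynomial.totalDegree_C]

/-- bounded degree -/
def BD (φ : PowerSeries (MvPolynomial (Fin 3) K)) : Prop := ∃ e, DL e φ

lemma BD.add {φ ψ : PowerSeries (MvPolynomial (Fin 3) K)} (h : BD φ) (h' : BD ψ) : BD (φ + ψ) := by
  obtain ⟨e, h⟩ := h
  obtain ⟨e', h'⟩ := h'
  exact ⟨max e e', (h.mono (le_max_left _ _)).add (h'.mono (le_max_right _ _))⟩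

lemma BD.mul {φ ψ : PowerSeries (MvPolynomial (Fin 3) K)} (h : BD φ) (h' : BD ψ) : BD (φ * ψ) := by
  obtain ⟨e, h⟩ := h
  obtain ⟨e', h'⟩ := h'
  exact ⟨_, h.mul h'⟩

lemma BD.pow {φ : PowerSeries (MvPolynomial (Fin 3) K)} (h : BD φ) (k : ℕ) : BD (φ ^ k) := by
  obtain ⟨e, h⟩ := h
  exact ⟨_, h.pow k⟩

lemma BD.sum {ι : Type*} (t : Finset ι) (φ : ι → PowerSeries (MvPolynomial (Fin 3) K)) (h : ∀ i, BD (φ i)) :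
    BD (∑ i ∈ t, φ i) := by
  classical
  induction t using Finset.induction_on with
  | empty => exact ⟨0, fun n => by simp⟩
  | insert i t hi ih => rw [Finset.sum_insert hi]; exact (h i).add ih

variable [NumberField K]

theorem core (S : SD) (h1 : S.ξ1 ≠ 0) (σ : K →+* ℂ) (w a b : ℕ → K) (hw : ∀ n, σ (w n) = S.w n)
    (ha : ∀ n, σ (a n) = S.a n) (hb : ∀ n, σ (b n) = S.b n) (P : MvPolynomial (Fin 2) K) (hP : P ≠ 0) :
    MvPolynomial.eval₂ σ ![S.ξ1, S.ξ2] P ≠ 0 := by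
  intro hP0
  have hσ : Function.Injective σ := σ.injective
  have hAw : ∀ n, σ (aeval (w n) S.A) = aeval (S.w n) S.A := by
    intro n
    rw [← hw]
    exact (Polynomial.aeval_algHom_apply (σ.toIntAlgHom) (w n) S.A).symm
  -- Liouville
  obtain ⟨Λ, hΛ1, hΛ⟩ := liouville S.hq S.A S.Adeg w (fun n => hσ (by rw [map_pow, hw, hw, S.hw])) a b
    (fun n => hσ (by rw [map_add, map_mul, map_mul, map_pow, ha, ha, ha, hAw, hw]; exact S.ha n))
    (fun n => hσ (by rw [map_add, map_mul, map_mul, map_pow, hb, hb, hb, hAw, hw]; exact S.hb n)) σ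
  -- the evaluation
  set x : ℕ → Fin 3 → ℂ := fun m => ![S.a (2 * m + 1), S.b (2 * m + 1), S.a (2 * m)] with hx
  have t1 : Tendsto (fun m : ℕ => 2 * m + 1) atTop atTop :=
    tendsto_atTop_mono (fun m => show m ≤ 2 * m + 1 by omega) tendsto_id
  have hxb : ∀ i, (fun m => x m i) =O[atTop] (fun _ => (1 : ℂ)) := by
    intro i
    fin_cases i
    · exact (S.hξ1.comp t1).isBigO_one ℂ
    · exact (S.hξ2.comp t1).isBigO_one ℂ
    · exact (S.hξ1.comp SD.tt).isBigO_one ℂ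
  have hev := evm_bdd σ x hxb
  -- the function E
  set D : K := (a 1 * b 0 - b 1 * a 0) / w 0 with hD
  have hσD : σ D = S.Dd := by
    simp only [hD, map_div₀, map_sub, map_mul, ha, hb, hw]; rfl
  let R := MvPolynomial (Fin 3) K
  let cc : R → PowerSeries R := fun r => PowerSeries.C r
  let xa : R := MvPolynomial.X 0
  let xb : R := MvPolynomial.X 1
  let xc : R := MvPolynomial.X 2
  let h : PowerSeries R := S.hz.map (Int.castRingHom R)
  let h2 : PowerSeries R := (PowerSeries.expand S.q S.q_ne S.hz).map (Int.castRingHom R)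
  let Y : PowerSeries R := PowerSeries.X
  let Z1 : PowerSeries R := cc xa * h + Y ^ (S.q - 1) * h2 * cc xc
  let Z2 : PowerSeries R := cc (xa * xb) * h + Y ^ (S.q - 1) * h2 * (cc (MvPolynomial.C D) * Y + cc (xb * xc))
  let d := P.totalDegree
  let E : PowerSeries R := ∑ μ ∈ P.support, cc (MvPolynomial.C (P.coeff μ)) * (cc xa ^ (d - μ 1) * Z1 ^ (μ 0) * Z2 ^ (μ 1))
  have rc : ∀ r : R, Rp (evm σ x) S.V (cc r) (fun m => evm σ x m r) := fun r => Rp.const r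
  have rh : Rp (evm σ x) S.V h (fun m => S.h (2 * m)) := S.rp1 _
  have rh2 : Rp (evm σ x) S.V h2 (fun m => S.h (2 * m + 1)) := S.rp2 _
  have rY : Rp (evm σ x) S.V Y S.V := Rp.X
  have ea : ∀ m, evm σ x m xa = S.a (2 * m + 1) := fun m => by simp [evm, xa, hx]
  have eb : ∀ m, evm σ x m xb = S.b (2 * m + 1) := fun m => by simp [evm, xb, hx]
  have ec : ∀ m, evm σ x m xc = S.a (2 * m) := fun m => by simp [evm, xc, hx]
  have eC : ∀ (y : K) m, evm σ x m (MvPolynomial.C y) = σ y := fun y m => by simp [evm]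
  have rZ1 : Rp (evm σ x) S.V Z1 (fun _ => S.ξ1) := by
    refine (((rc xa).mul hev S.V_bdd rh).add ((((rY.pow hev S.V_bdd (S.q - 1)).mul hev S.V_bdd rh2)).mul hev S.V_bdd
      (rc xc))).congr (Eventually.of_forall (fun m => ?_))
    rw [ea, ec, S.xi1_eq (2 * m)]; rfl
  have rZ2 : Rp (evm σ x) S.V Z2 (fun m => S.a (2 * m + 1) * S.ξ2) := by
    refine (((rc (xa * xb)).mul hev S.V_bdd rh).add ((((rY.pow hev S.V_bdd (S.q - 1)).mul hev S.V_bdd rh2)).mul hev S.V_bdd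
      (((rc (MvPolynomial.C D)).mul hev S.V_bdd rY).add (rc (xb * xc))))).congr (Eventually.of_forall (fun m => ?_))
    rw [map_mul, map_mul, ea, ec, eb, eC, hσD, S.xi2_eq (2 * m)]
    have := S.d_even m
    simp only [SD.d] at this
    rw [← this]
    simp only [SD.V]
    ring
  have rE : Rp (evm σ x) S.V E (fun _ => 0) := by
    have := Rp.sum (ev := evm σ x) (w := S.V) P.support
      (fun μ => cc (MvPolynomial.C (P.coeff μ)) * (cc xa ^ (d - μ 1) * Z1 ^ (μ 0) * Z2 ^ (μ 1))) _
      (fun μ _ => (rc (MvPolynomial.C (P.coeff μ))).mul hev S.V_bdd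
        ((((rc xa).pow hev S.V_bdd (d - μ 1)).mul hev S.V_bdd (rZ1.pow hev S.V_bdd (μ 0))).mul hev S.V_bdd
          (rZ2.pow hev S.V_bdd (μ 1))))
    refine this.congr (Eventually.of_forall (fun m => ?_))
    have e2 : ∑ μ ∈ P.support, S.a (2 * m + 1) ^ d * (σ (P.coeff μ) * (S.ξ1 ^ μ 0 * S.ξ2 ^ μ 1)) = 0 := by
      rw [← Finset.mul_sum]
      rw [MvPolynomial.eval₂_eq'] at hP0
      simp only [Fin.prod_univ_two, Matrix.cons_val_zero, Matrix.cons_val_one] at hP0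
      rw [hP0, mul_zero]
    rw [← e2]
    refine Finset.sum_congr rfl (fun μ hμ => ?_)
    rw [eC, ea]
    have hμd : μ 1 ≤ d := by
      have := MvPolynomial.le_totalDegree hμ
      rw [Finsupp.sum_fintype _ _ (by simp), Fin.sum_univ_two] at this
      exact (Nat.le_add_left _ _).trans this
    rw [mul_pow]
    have e3 : S.a (2 * m + 1) ^ d = S.a (2 * m + 1) ^ (d - μ 1) * S.a (2 * m + 1) ^ (μ 1) := by
      rw [← pow_add, Nat.sub_add_cancel hμd]
    rw [e3]; ring
  have bE : BD E := by
    have bc : ∀ r : R, BD (cc r) := fun r => ⟨_, DL.const r⟩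
    have bh : BD h := ⟨_, DL.ofInt _⟩
    have bh2 : BD h2 := ⟨_, DL.ofInt _⟩
    have bY : BD Y := ⟨0, by have := DL.X_pow (K := K) 1; rwa [pow_one] at this⟩
    have bZ1 : BD Z1 := ((bc _).mul bh).add (((bY.pow _).mul bh2).mul (bc _))
    have bZ2 : BD Z2 := ((bc _).mul bh).add (((bY.pow _).mul bh2).mul (((bc _).mul bY).add (bc _)))
    exact BD.sum _ _ (fun μ => (bc _).mul ((((bc _).pow _).mul (bZ1.pow _)).mul (bZ2.pow _)))
  have hE0 : PowerSeries.constantCoeff E ≠ 0 := by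
    have kc : ∀ r : R, PowerSeries.constantCoeff (cc r) = r := fun r => by simp [cc]
    have kh : PowerSeries.constantCoeff h = 1 := by
      have := S.hz0
      rw [← PowerSeries.coeff_zero_eq_constantCoeff_apply, PowerSeries.coeff_map, PowerSeries.coeff_zero_eq_constantCoeff_apply, this]
      simp
    have kY : PowerSeries.constantCoeff (Y ^ (S.q - 1)) = 0 := by
      rw [map_pow, PowerSeries.constantCoeff_X, zero_pow (by have := S.hq; omega)]
    have kZ1 : PowerSeries.constantCoeff Z1 = xa := by
      simp only [Z1, map_add, map_mul, kc, kh, kY]; ring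
    have kZ2 : PowerSeries.constantCoeff Z2 = xa * xb := by
      have : PowerSeries.constantCoeff Z2 = PowerSeries.constantCoeff (cc (xa * xb)) * PowerSeries.constantCoeff h +
        PowerSeries.constantCoeff (Y ^ (S.q - 1)) * PowerSeries.constantCoeff h2 *
          PowerSeries.constantCoeff (cc (MvPolynomial.C D) * Y + cc (xb * xc)) := by
        simp only [Z2, map_add, map_mul]
      rw [this, kc, kh, kY]; ring
    have e1 : PowerSeries.constantCoeff E = xa ^ d * MvPolynomial.rename ![(0 : Fin 3), 1] P := by
      have e2 : MvPolynomial.rename ![(0 : Fin 3), 1] P =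
          ∑ μ ∈ P.support, MvPolynomial.C (P.coeff μ) * (xa ^ μ 0 * xb ^ μ 1) := by
        rw [MvPolynomial.rename_eq_aeval, MvPolynomial.aeval_def, MvPolynomial.eval₂_eq']
        simp only [Fin.prod_univ_two]
        rfl
      rw [e2, Finset.mul_sum]
      simp only [E, map_sum]
      refine Finset.sum_congr rfl (fun μ hμ => ?_)
      simp only [map_mul, map_pow, kc, kZ1, kZ2]
      have hμd : μ 1 ≤ d := by
        have := MvPolynomial.le_totalDegree hμ
        rw [Finsupp.sum_fintype _ _ (by simp), Fin.sum_univ_two] at this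
        exact (Nat.le_add_left _ _).trans this
      have e3 : xa ^ d = xa ^ (d - μ 1) * xa ^ (μ 1) := by
        rw [← pow_add, Nat.sub_add_cancel hμd]
      rw [e3]; ring
    rw [e1]
    refine mul_ne_zero (pow_ne_zero _ (MvPolynomial.X_ne_zero _)) ?_
    intro h0
    apply hP
    apply MvPolynomial.rename_injective ![(0 : Fin 3), 1] (by decide)
    rw [h0, map_zero]
  -- choice of parameters
  obtain ⟨e, he⟩ := bE
  have hw0 : 0 < ‖S.w 0‖ := norm_pos_iff.2 S.hw0
  obtain ⟨g, hg1, hg⟩ : ∃ g : ℕ, 1 ≤ g ∧ Λ ^ 4 * ‖S.w 0‖ ^ g < 1 := by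
    have := (tendsto_pow_atTop_nhds_zero_of_lt_one hw0.le S.hw1).const_mul (Λ ^ 4)
    rw [mul_zero] at this
    obtain ⟨g, hg, hg1⟩ := ((this.eventually (gt_mem_nhds one_pos)).and (eventually_ge_atTop 1)).exists
    exact ⟨g, hg1, hg⟩
  obtain ⟨δ, hδ, F, hF0, hFd, hFdvd⟩ := aux_exists E e he g hg1
  -- minimal index
  obtain ⟨j0, hj0, hmin⟩ : ∃ j0, F j0 ≠ 0 ∧ ∀ j, j < j0 → F j = 0 := by
    classical
    have hne : (Finset.univ.filter (fun j => F j ≠ 0)).Nonempty := by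
      obtain ⟨j, hj⟩ := Function.ne_iff.1 hF0
      exact ⟨j, by simpa using hj⟩
    refine ⟨Finset.min' _ hne, ?_, ?_⟩
    · simpa using Finset.min'_mem _ hne
    · intro j hj
      by_contra hc
      exact absurd (Finset.min'_le _ j (by simpa using hc)) (not_le.2 hj)
  set F' : PowerSeries R := ∑ j, toPS (F j) * E ^ ((j : ℕ) - (j0 : ℕ)) with hF'
  have hfac : ∑ j, toPS (F j) * E ^ (j : ℕ) = E ^ (j0 : ℕ) * F' := by
    rw [hF', Finset.mul_sum]
    refine Finset.sum_congr rfl (fun j _ => ?_)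
    by_cases hj : j < j0
    · simp [hmin j hj]
    · have : (j0 : ℕ) ≤ j := by simpa using hj
      have e3 : E ^ (j : ℕ) = E ^ (j0 : ℕ) * E ^ ((j : ℕ) - (j0 : ℕ)) := by
        rw [← pow_add, Nat.add_sub_cancel' this]
      rw [e3]; ring
  have hdvd : PowerSeries.X ^ (δ * g) ∣ F' := by
    rw [hfac] at hFdvd
    refine (PowerSeries.X_prime (R := R)).pow_dvd_of_dvd_mul_left _ ?_ hFdvd
    rw [PowerSeries.X_dvd_iff, map_pow]
    exact pow_ne_zero _ hE0
  have rF' : Rp (evm σ x) S.V F' (fun m => MvPolynomial.eval₂ σ ![S.V m, x m 0, x m 1, x m 2] (F j0)) := by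
    have := Rp.sum (ev := evm σ x) (w := S.V) Finset.univ
      (fun j => toPS (F j) * E ^ ((j : ℕ) - (j0 : ℕ))) _
      (fun j _ => (rp_toPS σ x hxb S.V S.V_bdd (F j)).mul hev S.V_bdd (rE.pow hev S.V_bdd ((j : ℕ) - (j0 : ℕ))))
    refine this.congr (Eventually.of_forall (fun m => ?_))
    rw [Finset.sum_eq_single j0]
    · simp
    · intro j _ hj
      by_cases hj1 : j < j0
      · simp [hmin j hj1]
      · have h2 : j0 < j := lt_of_le_of_ne (not_lt.1 hj1) (Ne.symm hj)
        have h3 : (j : ℕ) - (j0 : ℕ) ≠ 0 := by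
          have : (j0 : ℕ) < j := h2
          omega
        rw [zero_pow h3, mul_zero]
    · simp
  have hO := rF'.isBigO_of_dvd hev S.V_bdd (δ * g) hdvd
  obtain ⟨B, hB⟩ := hO.bound
  -- nonvanishing
  have hvec : ∀ m, (fun i => σ (![w (2 * m), a (2 * m + 1), b (2 * m + 1), a (2 * m)] i)) =
      ![S.V m, x m 0, x m 1, x m 2] := by
    intro m
    funext i
    fin_cases i
    · exact hw _
    · exact ha _
    · exact hb _
    · exact ha _
  have hval : ∀ m, σ (MvPolynomial.eval ![w (2 * m), a (2 * m + 1), b (2 * m + 1), a (2 * m)] (F j0)) =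
      MvPolynomial.eval₂ σ ![S.V m, x m 0, x m 1, x m 2] (F j0) := by
    intro m
    rw [← hvec, MvPolynomial.eval_eq', MvPolynomial.eval₂_eq', map_sum]
    refine Finset.sum_congr rfl (fun μ _ => ?_)
    rw [map_mul, map_prod]
    simp only [map_pow]
  have hfreq : ∃ᶠ m in atTop, MvPolynomial.eval₂ σ ![S.V m, x m 0, x m 1, x m 2] (F j0) ≠ 0 := by
    rw [Filter.Frequently]
    intro hc
    apply hj0
    apply MvPolynomial.map_injective σ hσ
    rw [map_zero]
    refine S.dense h1 _ ?_
    filter_upwards [hc] with m hm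
    have hm := not_not.1 hm
    rw [MvPolynomial.aeval_def, MvPolynomial.eval₂_map]
    exact hm
  obtain ⟨c, hc⟩ := hΛ (F j0)
  have hΛp : 0 < Λ := by linarith
  set ρ : ℝ := Λ ^ 4 * ‖S.w 0‖ ^ g with hρ
  have hρ0 : 0 < ρ := by positivity
  -- upper bound
  have hup : ∃ᶠ m in atTop, (1 : ℝ) ≤ |c| * |B| * ρ ^ (2 * m) := by
    refine (hfreq.and_eventually hB).mono ?_
    rintro m ⟨hm1, hm2⟩
    have k1 := hc (2 * m) (by intro h0; apply hm1; rw [← hval, h0, map_zero])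
    rw [hval] at k1
    have hVm : ‖S.V m ^ (δ * g)‖ = ((‖S.w 0‖ ^ g) ^ (S.q ^ (2 * m))) ^ δ := by
      rw [norm_pow, SD.V, S.w_eq, norm_pow, ← pow_mul, ← pow_mul, ← pow_mul]
      congr 1; ring
    rw [hVm] at hm2
    have hT : Λ ^ ((F j0).totalDegree * S.q ^ (2 * m)) ≤ ((Λ ^ 4) ^ (S.q ^ (2 * m))) ^ δ := by
      rw [← pow_mul, ← pow_mul]
      refine pow_le_pow_right₀ hΛ1 ?_
      have := Nat.mul_le_mul_right (S.q ^ (2 * m)) (hFd j0)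
      refine this.trans (le_of_eq (by ring))
    have k2 : (1 : ℝ) ≤ |c| * (((Λ ^ 4) ^ (S.q ^ (2 * m))) ^ δ) * (|B| * ((‖S.w 0‖ ^ g) ^ (S.q ^ (2 * m))) ^ δ) := by
      refine k1.trans ?_
      have hm3 := hm2.trans (mul_le_mul_of_nonneg_right (le_abs_self B) (by positivity))
      refine mul_le_mul ?_ hm3 (norm_nonneg _) (by positivity)
      exact mul_le_mul (le_abs_self c) hT (by positivity) (abs_nonneg c)
    refine k2.trans ?_
    have k3 : |c| * (((Λ ^ 4) ^ (S.q ^ (2 * m))) ^ δ) * (|B| * ((‖S.w 0‖ ^ g) ^ (S.q ^ (2 * m))) ^ δ) =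
        |c| * |B| * ρ ^ (S.q ^ (2 * m) * δ) := by
      rw [hρ, pow_mul (Λ ^ 4 * ‖S.w 0‖ ^ g) (S.q ^ (2 * m)), mul_pow, mul_pow]; ring
    rw [k3]
    refine mul_le_mul_of_nonneg_left (pow_le_pow_of_le_one hρ0.le hg.le ?_) (by positivity)
    have : 2 * m < S.q ^ (2 * m) := Nat.lt_pow_self (by have := S.hq; omega)
    nlinarith
  have hlim : Tendsto (fun m : ℕ => |c| * |B| * ρ ^ (2 * m)) atTop (nhds 0) := by
    have := ((tendsto_pow_atTop_nhds_zero_of_lt_one hρ0.le hg).comp SD.tt).const_mul (|c| * |B|)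
    rw [mul_zero] at this
    exact this
  obtain ⟨m, hm1, hm2⟩ := (hup.and_eventually (hlim.eventually (gt_mem_nhds one_pos))).exists
  linarith

end Core


section Finish
open Filter

/-- exchange of the two sequences -/
noncomputable def SD.swap (S : SD) : SD where
  q := S.q
  hq := S.hq
  A := S.A
  A0 := S.A0
  Adeg := S.Adeg
  w := S.w
  hw := S.hw
  hw0 := S.hw0
  hw1 := S.hw1
  a := S.b
  b := S.a
  ha := S.hb
  hb := S.ha
  hd := by
    intro h
    apply S.hd
    linear_combination -h
  ξ1 := S.ξ2
  ξ2 := S.ξ1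
  hξ1 := S.hξ2
  hξ2 := S.hξ1

theorem core' {K : Type*} [Field K] [NumberField K] (S : SD) (σ : K →+* ℂ) (w a b : ℕ → K) (hw : ∀ n, σ (w n) = S.w n)
    (ha : ∀ n, σ (a n) = S.a n) (hb : ∀ n, σ (b n) = S.b n) (P : MvPolynomial (Fin 2) K) (hP : P ≠ 0) :
    MvPolynomial.eval₂ σ ![S.ξ1, S.ξ2] P ≠ 0 := by
  rcases S.xi_ne with h | h
  · exact core S h σ w a b hw ha hb P hP
  · have hi : Function.Injective ![(1 : Fin 2), 0] := by decide
    have := core S.swap h σ w b a hw hb ha (MvPolynomial.rename ![(1 : Fin 2), 0] P)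
      (fun h0 => hP (MvPolynomial.rename_injective _ hi (by rw [h0, map_zero])))
    rw [MvPolynomial.eval₂_rename] at this
    convert this using 2
    funext i
    fin_cases i <;> rfl

lemma map_pst {R R' : Type*} [CommRing R] [CommRing R'] (σ : R →+* R') (t k n : ℕ) (y : R) :
    σ (pst t k n y) = pst t k n (σ y) := by
  simp only [pst, sv]
  rw [← map_pow]
  exact (Polynomial.aeval_algHom_apply (σ.toIntAlgHom) _ _).symm

end Finish

/-- Main theorem: for any algebraic number `α` with `0 < |α| < 1`, the numbers
`H_k(α)` and `H_k(α^{t^k})` are algebraically independent over `ℚ`, where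
`H_k(z)` is the limit of `a_t(α_n; z)` as `n → ∞`. -/
theorem Hk_values_algebraicIndependent (t k : ℕ) (ht : 2 ≤ t) (hk : 1 ≤ k) (H : ℂ → ℂ)
    (hH : ∀ z : ℂ, ‖z‖ < 1 →
      Filter.Tendsto (fun n => Polynomial.aeval z (sternPoly t (sternAlpha k n)))
        Filter.atTop (nhds (H z)))
    (α : ℂ) (halg : IsAlgebraic ℚ α) (h0 : 0 < ‖α‖) (h1 : ‖α‖ < 1) :
    AlgebraicIndependent ℚ ![H α, H (α ^ t ^ k)] := by
  obtain ⟨β, hβ⟩ := IsAlgClosed.exists_pow_nat_eq α (show 0 < t - 1 by omega)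
  have hβalg : IsAlgebraic ℚ β := by
    refine IsAlgebraic.of_pow (show 0 < t - 1 by omega) ?_
    rw [hβ]; exact halg
  have hq1 : t ^ k ≠ 0 := by positivity
  have hq2 : 2 ≤ t ^ k := ht.trans (Nat.le_self_pow (by omega) t)
  have hα0 : α ≠ 0 := norm_pos_iff.1 h0
  have hβ0 : β ≠ 0 := by
    rintro rfl
    rw [zero_pow (by omega)] at hβ
    exact hα0 hβ.symm
  have hβ1 : ‖β‖ < 1 := by
    by_contra hc
    have : 1 ≤ ‖β‖ ^ (t - 1) := one_le_pow₀ (not_lt.1 hc)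
    rw [← norm_pow, hβ] at this
    linarith
  let S : SD :=
    { q := t ^ k
      hq := hq2
      A := sternA t k
      A0 := sternA_coeff_zero t k ht hk
      Adeg := sternA_natDegree t k ht hk
      w := fun n => (β ^ t ^ k) ^ (t ^ k) ^ n
      hw := fun n => by rw [← pow_mul _ ((t ^ k) ^ n), ← pow_succ]
      hw0 := pow_ne_zero _ (pow_ne_zero _ hβ0)
      hw1 := by
        simp only [pow_zero, pow_one, norm_pow]
        exact pow_lt_one₀ (norm_nonneg _) hβ1 hq1
      a := fun n => pst t k (n + 1) β
      b := fun n => pst t k n (β ^ t ^ k)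
      ha := fun n => by
        rw [show n + 2 + 1 = n + 1 + 2 by ring, pst_rec' t k ht (n + 1) β, ← pow_mul β (t ^ k) ((t ^ k) ^ n), ← pow_succ']
      hb := fun n => pst_rec' t k ht n _
      hd := by simp [pst_zero, pst_one]
      ξ1 := H α
      ξ2 := H (α ^ t ^ k)
      hξ1 := by
        have := (hH α h1).comp (Filter.tendsto_add_atTop_nat 1)
        rw [← hβ] at this ⊢
        exact this
      hξ2 := by
        have h2 : ‖α ^ t ^ k‖ < 1 := by
          rw [norm_pow]; exact pow_lt_one₀ (norm_nonneg _) h1 hq1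
        have := hH _ h2
        have e : α ^ t ^ k = (β ^ t ^ k) ^ (t - 1) := by
          rw [← hβ, ← pow_mul, ← pow_mul, mul_comm]
        rw [e] at this ⊢
        exact this }
  let K := IntermediateField.adjoin ℚ {β}
  haveI : FiniteDimensional ℚ K := IntermediateField.adjoin.finiteDimensional hβalg.isIntegral
  haveI : NumberField K := ⟨⟩
  let b0 : K := IntermediateField.AdjoinSimple.gen ℚ β
  let σ : K →+* ℂ := algebraMap K ℂ
  have hb0 : σ b0 = β := IntermediateField.AdjoinSimple.algebraMap_gen ℚ β
  rw [algebraicIndependent_iff]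
  intro P hP
  by_contra hP0
  refine core' S σ (fun n => (b0 ^ t ^ k) ^ (t ^ k) ^ n) (fun n => pst t k (n + 1) b0) (fun n => pst t k n (b0 ^ t ^ k))
    (fun n => by rw [map_pow, map_pow, hb0]) (fun n => by rw [map_pst, hb0])
    (fun n => by rw [map_pst, map_pow, hb0]) (MvPolynomial.map (algebraMap ℚ K) P) ?_ ?_
  · intro h
    exact hP0 (MvPolynomial.map_injective _ (algebraMap ℚ K).injective (by rw [h, map_zero]))
  · rw [MvPolynomial.eval₂_map]
    exact hP
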